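/- Suppose |1−χ| = O(ε), Re < Re₀ and ε ≤ ε₂. Then for all t ∈ [0,T]: ε⁻²∫₀ᵗ‖∇²θ(s)‖²_{L²}ds ≤ C(A₁(0) + ε⁻²A₀(0)), where C depends only on Re, Pr, μ′/μ and γ. -/

import Mathlib

noncomputable section

open MeasureTheory Real Filter Topology

namespace Couette

/-- The periodic cell of the horizontally periodic layer `Ω = 𝕊¹ × (0,1)`. -/
def Ω : Set (ℝ × ℝ) := {x : ℝ × ℝ | x.1 ∈ Set.Ioo 0 (2 * π) ∧ x.2 ∈ Set.Ioo 0 1}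

variable {F : Type*} [NormedAddCommGroup F] [NormedSpace ℝ F]

/-- Partial derivative in the horizontal direction `x₁`. -/
def d1 (f : ℝ × ℝ → F) (x : ℝ × ℝ) : F := fderiv ℝ f x (1, 0)

/-- Partial derivative in the vertical direction `x₂`. -/
def d2 (f : ℝ × ℝ → F) (x : ℝ × ℝ) : F := fderiv ℝ f x (0, 1)

/-- Time derivative of a time-dependent field. -/
def dt (f : ℝ → ℝ × ℝ → F) (t : ℝ) (x : ℝ × ℝ) : F := deriv (fun s => f s x) t

/-- Divergence of a (two-dimensional) vector field. -/
def divv (v : ℝ × ℝ → ℝ × ℝ) (x : ℝ × ℝ) : ℝ :=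
  d1 (fun y => (v y).1) x + d2 (fun y => (v y).2) x

/-- Gradient of a scalar field. -/
def grad (f : ℝ × ℝ → ℝ) (x : ℝ × ℝ) : ℝ × ℝ := (d1 f x, d2 f x)

/-- Laplacian. -/
def lap (f : ℝ × ℝ → F) (x : ℝ × ℝ) : F := d1 (d1 f) x + d2 (d2 f) x

/-- Euclidean inner product on `ℝ²`. -/
def dot (a b : ℝ × ℝ) : ℝ := a.1 * b.1 + a.2 * b.2

/-- The contraction `𝔇(v) : 𝔇(w)` of deformation tensors, where
`𝔇(v) = (∇v + (∇v)ᵀ)/2`. -/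
def defContract (v w : ℝ × ℝ → ℝ × ℝ) (x : ℝ × ℝ) : ℝ :=
  d1 (fun y => (v y).1) x * d1 (fun y => (w y).1) x
    + d2 (fun y => (v y).2) x * d2 (fun y => (w y).2) x
    + 2 * ((d1 (fun y => (v y).2) x + d2 (fun y => (v y).1) x) / 2)
        * ((d1 (fun y => (w y).2) x + d2 (fun y => (w y).1) x) / 2)

/-- Squared `L²(Ω)` norm of the `j`-th spatial derivative. -/
def dSq (j : ℕ) (f : ℝ × ℝ → F) : ℝ := ∫ x in Ω, ‖iteratedFDeriv ℝ j f x‖ ^ 2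

/-- Squared `L²(Ω)` norm. -/
def L2Sq (f : ℝ × ℝ → F) : ℝ := dSq 0 f

/-- Squared `Hᵏ(Ω)` norm. -/
def HSq (k : ℕ) (f : ℝ × ℝ → F) : ℝ := ∑ j ∈ Finset.range (k + 1), dSq j f

/-- `L∞(Ω)` (sup) norm. -/
def LinfSup (f : ℝ × ℝ → F) : ℝ := ⨆ x ∈ Ω, ‖f x‖

/-- Membership in the Sobolev space `Hᵏ(Ω)`. -/
def MemH (k : ℕ) (f : ℝ × ℝ → F) : Prop :=
  ∀ j ≤ k, IntegrableOn (fun x => ‖iteratedFDeriv ℝ j f x‖ ^ 2) Ω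

/-- Continuity in time, with values in `Hᵏ(Ω)`, on the time set `s`. -/
def ContInH (k : ℕ) (f : ℝ → ℝ × ℝ → F) (s : Set ℝ) : Prop :=
  (∀ t ∈ s, MemH k (f t)) ∧
    ∀ t₀ ∈ s, Tendsto (fun t => HSq k (fun x => f t x - f t₀ x)) (nhdsWithin t₀ s) (nhds 0)

/-- Square integrability in time, with values in `Hᵏ(Ω)`, on the time set `s`. -/
def L2InH (k : ℕ) (f : ℝ → ℝ × ℝ → F) (s : Set ℝ) : Prop :=
  IntegrableOn (fun t => HSq k (f t)) s

/-- Temperature `𝒯̃` of the non-dimensional plane Couette flow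
(here `C_p = γ/(γ-1)`, the gas constant being normalized to `R = 1`). -/
def tT (γ Pr ε χ : ℝ) (x : ℝ × ℝ) : ℝ :=
  χ + (1 - χ) * x.2 - ε ^ 2 * Pr / (2 * (γ / (γ - 1))) * (x.2 ^ 2 - x.2)

/-- Density `ρ̃ = 𝒯̃⁻¹` of the plane Couette flow. -/
def tρ (γ Pr ε χ : ℝ) (x : ℝ × ℝ) : ℝ := (tT γ Pr ε χ x)⁻¹

/-- Velocity `ũ = (x₂, 0)` of the plane Couette flow. -/
def tu (x : ℝ × ℝ) : ℝ × ℝ := (x.2, 0)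

/-- Total density `ρ = ρ̃ + φ`. -/
def pρ (γ Pr ε χ : ℝ) (φ : ℝ → ℝ × ℝ → ℝ) (t : ℝ) (x : ℝ × ℝ) : ℝ := tρ γ Pr ε χ x + φ t x

/-- Total temperature `𝒯 = 𝒯̃ + θ`. -/
def pT (γ Pr ε χ : ℝ) (θ : ℝ → ℝ × ℝ → ℝ) (t : ℝ) (x : ℝ × ℝ) : ℝ := tT γ Pr ε χ x + θ t x

/-- Total velocity `u = ũ + ψ`. -/
def pu (ψ : ℝ → ℝ × ℝ → ℝ × ℝ) (t : ℝ) (x : ℝ × ℝ) : ℝ × ℝ := tu x + ψ t x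

/-- A classical solution `(φ, ψ, θ) = (ρ - ρ̃, u - ũ, 𝒯 - 𝒯̃)` of the perturbation
system around the plane Couette flow on `Ω × [0,T]`, with non-slip and isothermal
boundary conditions and periodicity in `x₁`.  Here `μ = 1/Re`, `μ' = r·μ`
(`r = μ'/μ = ν'/ν`), and `κ = C_p/(Re·Pr)` with `C_p = γ/(γ-1)`. -/
structure PerturbSol (γ Pr r Re ε χ T : ℝ) where
  φ : ℝ → ℝ × ℝ → ℝ
  ψ : ℝ → ℝ × ℝ → ℝ × ℝ
  θ : ℝ → ℝ × ℝ → ℝ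
  mass_eq : ∀ t ∈ Set.Icc (0 : ℝ) T, ∀ x ∈ Ω,
    dt φ t x + dot (pu ψ t x) (grad (φ t) x) + pρ γ Pr ε χ φ t x * divv (ψ t) x
      + dot (ψ t x) (grad (tρ γ Pr ε χ) x) = 0
  mom_eq1 : ∀ t ∈ Set.Icc (0 : ℝ) T, ∀ x ∈ Ω,
    pρ γ Pr ε χ φ t x * ((dt ψ t x).1 + dot (pu ψ t x) (grad (fun y => (ψ t y).1) x)
        + dot (ψ t x) (grad (fun y => (tu y).1) x))
      + (ε ^ 2)⁻¹ * d1 (fun y => pρ γ Pr ε χ φ t y * pT γ Pr ε χ θ t y) x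
      - Re⁻¹ * lap (fun y => (ψ t y).1) x
      - (Re⁻¹ + r * Re⁻¹) * d1 (divv (ψ t)) x = 0
  mom_eq2 : ∀ t ∈ Set.Icc (0 : ℝ) T, ∀ x ∈ Ω,
    pρ γ Pr ε χ φ t x * ((dt ψ t x).2 + dot (pu ψ t x) (grad (fun y => (ψ t y).2) x)
        + dot (ψ t x) (grad (fun y => (tu y).2) x))
      + (ε ^ 2)⁻¹ * d2 (fun y => pρ γ Pr ε χ φ t y * pT γ Pr ε χ θ t y) x
      - Re⁻¹ * lap (fun y => (ψ t y).2) x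
      - (Re⁻¹ + r * Re⁻¹) * d2 (divv (ψ t)) x = 0
  energy_eq : ∀ t ∈ Set.Icc (0 : ℝ) T, ∀ x ∈ Ω,
    pρ γ Pr ε χ φ t x / (γ - 1) * (dt θ t x + dot (pu ψ t x) (grad (θ t) x)
        + dot (ψ t x) (grad (tT γ Pr ε χ) x))
      + pρ γ Pr ε χ φ t x * pT γ Pr ε χ θ t x * divv (ψ t) x
      - γ / (γ - 1) / (Re * Pr) * lap (θ t) x
      = ε ^ 2 * (2 * Re⁻¹ * defContract (ψ t) (ψ t) x
          + 4 * Re⁻¹ * defContract tu (ψ t) x + r * Re⁻¹ * (divv (ψ t) x) ^ 2)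
  bc_ψ : ∀ t ∈ Set.Icc (0 : ℝ) T, ∀ x : ℝ × ℝ, (x.2 = 0 ∨ x.2 = 1) → ψ t x = 0
  bc_θ : ∀ t ∈ Set.Icc (0 : ℝ) T, ∀ x : ℝ × ℝ, (x.2 = 0 ∨ x.2 = 1) → θ t x = 0
  periodic_φ : ∀ t x, φ t (x.1 + 2 * π, x.2) = φ t x
  periodic_ψ : ∀ t x, ψ t (x.1 + 2 * π, x.2) = ψ t x
  periodic_θ : ∀ t x, θ t (x.1 + 2 * π, x.2) = θ t x

/-- Smoothness (in time and space) of a solution of the perturbation system. -/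
def SmoothSol {γ Pr r Re ε χ T : ℝ} (S : PerturbSol γ Pr r Re ε χ T) : Prop :=
  ContDiff ℝ (⊤ : ℕ∞) (Function.uncurry S.φ) ∧ ContDiff ℝ (⊤ : ℕ∞) (Function.uncurry S.ψ) ∧
    ContDiff ℝ (⊤ : ℕ∞) (Function.uncurry S.θ)

/-- Standing hypotheses on a solution of the perturbation system: initial regularity
`(φ₀, ψ₀, θ₀) ∈ H³`, zero average of the initial density perturbation, and the
compatibility conditions `∂tψ(0) = ∂tθ(0) = 0` on `∂Ω`. -/
def StdHyp {γ Pr r Re ε χ T : ℝ} (S : PerturbSol γ Pr r Re ε χ T) : Prop :=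
  MemH 3 (S.φ 0) ∧ MemH 3 (S.ψ 0) ∧ MemH 3 (S.θ 0) ∧
    (∫ x in Ω, S.φ 0 x) = 0 ∧
    ∀ x : ℝ × ℝ, (x.2 = 0 ∨ x.2 = 1) → dt S.ψ 0 x = 0 ∧ dt S.θ 0 x = 0

/-- The energy functional `A₀`. -/
def A0 (ε : ℝ) (φ : ℝ → ℝ × ℝ → ℝ) (ψ : ℝ → ℝ × ℝ → ℝ × ℝ) (θ : ℝ → ℝ × ℝ → ℝ)
    (t : ℝ) : ℝ :=
  (⨆ s ∈ Set.Icc (0 : ℝ) t,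
      (L2Sq (ψ s) + (ε ^ 2)⁻¹ * L2Sq (φ s) + (ε ^ 2)⁻¹ * L2Sq (θ s)))
    + ∫ s in (0 : ℝ)..t, (HSq 1 (ψ s) + (ε ^ 2)⁻¹ * HSq 1 (θ s))

/-- The energy functional `A₁`. -/
def A1 (ε : ℝ) (φ : ℝ → ℝ × ℝ → ℝ) (ψ : ℝ → ℝ × ℝ → ℝ × ℝ) (θ : ℝ → ℝ × ℝ → ℝ)
    (t : ℝ) : ℝ :=
  (⨆ s ∈ Set.Icc (0 : ℝ) t, (dSq 1 (ψ s) + (ε ^ 2)⁻¹ * dSq 1 (θ s)))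
    + ∫ s in (0 : ℝ)..t, (L2Sq (dt ψ s) + (ε ^ 2)⁻¹ * L2Sq (dt θ s))

/-- The energy functional `A₂`. -/
def A2 (ε : ℝ) (φ : ℝ → ℝ × ℝ → ℝ) (ψ : ℝ → ℝ × ℝ → ℝ × ℝ) (θ : ℝ → ℝ × ℝ → ℝ)
    (t : ℝ) : ℝ :=
  (ε ^ 2)⁻¹ * (⨆ s ∈ Set.Icc (0 : ℝ) t, dSq 1 (φ s))
    + (∫ s in (0 : ℝ)..t, ((ε ^ 4)⁻¹ * HSq 1 (φ s) + (ε ^ 2)⁻¹ * L2Sq (dt φ s)))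
    + ∫ s in (0 : ℝ)..t, (HSq 2 (ψ s) + (ε ^ 2)⁻¹ * HSq 2 (θ s))

/-- The energy functional `A₃`. -/
def A3 (ε : ℝ) (φ : ℝ → ℝ × ℝ → ℝ) (ψ : ℝ → ℝ × ℝ → ℝ × ℝ) (θ : ℝ → ℝ × ℝ → ℝ)
    (t : ℝ) : ℝ :=
  (⨆ s ∈ Set.Icc (0 : ℝ) t,
      ((ε ^ 2)⁻¹ * L2Sq (dt φ s) + L2Sq (dt ψ s) + (ε ^ 2)⁻¹ * L2Sq (dt θ s)))
    + ∫ s in (0 : ℝ)..t, (dSq 1 (dt ψ s) + (ε ^ 2)⁻¹ * dSq 1 (dt θ s))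

/-- The energy functional `A₄`. -/
def A4 (ε : ℝ) (φ : ℝ → ℝ × ℝ → ℝ) (ψ : ℝ → ℝ × ℝ → ℝ × ℝ) (θ : ℝ → ℝ × ℝ → ℝ)
    (t : ℝ) : ℝ :=
  (⨆ s ∈ Set.Icc (0 : ℝ) t,
      ((ε ^ 2)⁻¹ * dSq 2 (φ s) + dSq 2 (ψ s) + (ε ^ 2)⁻¹ * dSq 2 (θ s)))
    + ∫ s in (0 : ℝ)..t, ((ε ^ 4)⁻¹ * HSq 2 (φ s) + HSq 3 (ψ s) + (ε ^ 2)⁻¹ * HSq 3 (θ s))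

/-- The energy functional `A₅`. -/
def A5 (ε : ℝ) (φ : ℝ → ℝ × ℝ → ℝ) (ψ : ℝ → ℝ × ℝ → ℝ × ℝ) (θ : ℝ → ℝ × ℝ → ℝ)
    (t : ℝ) : ℝ :=
  (⨆ s ∈ Set.Icc (0 : ℝ) t,
      ((ε ^ 2)⁻¹ * dSq 3 (φ s) + (dSq 3 (ψ s) + dSq 1 (dt ψ s))
        + (ε ^ 2)⁻¹ * (dSq 3 (θ s) + dSq 1 (dt θ s))))
    + ∫ s in (0 : ℝ)..t, (L2Sq (dt (dt ψ) s) + (ε ^ 2)⁻¹ * L2Sq (dt (dt θ) s))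

/-- The total weighted energy functional `N(t)`. -/
def Nfun (ε : ℝ) (φ : ℝ → ℝ × ℝ → ℝ) (ψ : ℝ → ℝ × ℝ → ℝ × ℝ) (θ : ℝ → ℝ × ℝ → ℝ)
    (t : ℝ) : ℝ :=
  (ε ^ 2)⁻¹ * A0 ε φ ψ θ t + A1 ε φ ψ θ t + A2 ε φ ψ θ t
    + ε ^ 2 * A3 ε φ ψ θ t + ε ^ 2 * A4 ε φ ψ θ t + ε ^ 4 * A5 ε φ ψ θ t

/-- The relative entropy
`η = (ε²ρ/𝒯̃)|ψ|² + (ρ/(γ-1))(𝒯/𝒯̃ - ln(𝒯/𝒯̃) - 1) + ρ(τ/τ̃ - ln(τ/τ̃) - 1)`,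
where `τ = 1/ρ`, `τ̃ = 1/ρ̃`. -/
def relEnt (γ Pr ε χ : ℝ) (φ θ : ℝ → ℝ × ℝ → ℝ) (ψ : ℝ → ℝ × ℝ → ℝ × ℝ)
    (t : ℝ) (x : ℝ × ℝ) : ℝ :=
  ε ^ 2 * pρ γ Pr ε χ φ t x / tT γ Pr ε χ x * ‖ψ t x‖ ^ 2
    + pρ γ Pr ε χ φ t x / (γ - 1) *
        (pT γ Pr ε χ θ t x / tT γ Pr ε χ x
          - Real.log (pT γ Pr ε χ θ t x / tT γ Pr ε χ x) - 1)
    + pρ γ Pr ε χ φ t x *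
        ((pρ γ Pr ε χ φ t x)⁻¹ / (tρ γ Pr ε χ x)⁻¹
          - Real.log ((pρ γ Pr ε χ φ t x)⁻¹ / (tρ γ Pr ε χ x)⁻¹) - 1)

/-- A classical solution `(ρ, u, 𝒯)` of the non-dimensional full compressible
Navier–Stokes system on `Ω × (0,∞)`, with non-slip and isothermal boundary
conditions and periodicity in `x₁`. -/
structure FullSol (γ Pr r Re ε χ : ℝ) where
  rho : ℝ → ℝ × ℝ → ℝ
  vel : ℝ → ℝ × ℝ → ℝ × ℝ
  temp : ℝ → ℝ × ℝ → ℝ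
  mass_eq : ∀ t ∈ Set.Ioi (0 : ℝ), ∀ x ∈ Ω,
    dt rho t x + divv (fun y => rho t y • vel t y) x = 0
  mom_eq1 : ∀ t ∈ Set.Ioi (0 : ℝ), ∀ x ∈ Ω,
    rho t x * ((dt vel t x).1 + dot (vel t x) (grad (fun y => (vel t y).1) x))
      + (ε ^ 2)⁻¹ * d1 (fun y => rho t y * temp t y) x
      = Re⁻¹ * lap (fun y => (vel t y).1) x + (Re⁻¹ + r * Re⁻¹) * d1 (divv (vel t)) x
  mom_eq2 : ∀ t ∈ Set.Ioi (0 : ℝ), ∀ x ∈ Ω,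
    rho t x * ((dt vel t x).2 + dot (vel t x) (grad (fun y => (vel t y).2) x))
      + (ε ^ 2)⁻¹ * d2 (fun y => rho t y * temp t y) x
      = Re⁻¹ * lap (fun y => (vel t y).2) x + (Re⁻¹ + r * Re⁻¹) * d2 (divv (vel t)) x
  energy_eq : ∀ t ∈ Set.Ioi (0 : ℝ), ∀ x ∈ Ω,
    rho t x / (γ - 1) * (dt temp t x + dot (vel t x) (grad (temp t) x))
      + rho t x * temp t x * divv (vel t) x
      = γ / (γ - 1) / (Re * Pr) * lap (temp t) x
        + ε ^ 2 * (2 * Re⁻¹ * defContract (vel t) (vel t) x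
            + r * Re⁻¹ * (divv (vel t) x) ^ 2)
  bc_top : ∀ t ∈ Set.Ioi (0 : ℝ), ∀ x : ℝ × ℝ, x.2 = 1 →
    vel t x = (1, 0) ∧ temp t x = 1
  bc_bot : ∀ t ∈ Set.Ioi (0 : ℝ), ∀ x : ℝ × ℝ, x.2 = 0 →
    vel t x = 0 ∧ temp t x = χ
  periodic_rho : ∀ t x, rho t (x.1 + 2 * π, x.2) = rho t x
  periodic_vel : ∀ t x, vel t (x.1 + 2 * π, x.2) = vel t x
  periodic_temp : ∀ t x, temp t (x.1 + 2 * π, x.2) = temp t x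

/-- `∂tφ(0)`, defined from the initial data by taking `t = 0` in the mass equation
of the perturbation system. -/
def dtφ0 (γ Pr ε χ : ℝ) (φ₀ : ℝ × ℝ → ℝ) (ψ₀ : ℝ × ℝ → ℝ × ℝ) (x : ℝ × ℝ) : ℝ :=
  -(dot (tu x + ψ₀ x) (grad φ₀ x) + (tρ γ Pr ε χ x + φ₀ x) * divv ψ₀ x
      + dot (ψ₀ x) (grad (tρ γ Pr ε χ) x))

/-- `∂tψ(0)`, defined from the initial data by taking `t = 0` in the momentum
equation of the perturbation system. -/
def dtψ0 (γ Pr r Re ε χ : ℝ) (φ₀ θ₀ : ℝ × ℝ → ℝ) (ψ₀ : ℝ × ℝ → ℝ × ℝ)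
    (x : ℝ × ℝ) : ℝ × ℝ :=
  ((tρ γ Pr ε χ x + φ₀ x)⁻¹ *
      (Re⁻¹ * lap (fun y => (ψ₀ y).1) x + (Re⁻¹ + r * Re⁻¹) * d1 (divv ψ₀) x
        - (ε ^ 2)⁻¹ * d1 (fun y => (tρ γ Pr ε χ y + φ₀ y) * (tT γ Pr ε χ y + θ₀ y)) x)
      - dot (tu x + ψ₀ x) (grad (fun y => (ψ₀ y).1) x)
      - dot (ψ₀ x) (grad (fun y => (tu y).1) x),
   (tρ γ Pr ε χ x + φ₀ x)⁻¹ *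
      (Re⁻¹ * lap (fun y => (ψ₀ y).2) x + (Re⁻¹ + r * Re⁻¹) * d2 (divv ψ₀) x
        - (ε ^ 2)⁻¹ * d2 (fun y => (tρ γ Pr ε χ y + φ₀ y) * (tT γ Pr ε χ y + θ₀ y)) x)
      - dot (tu x + ψ₀ x) (grad (fun y => (ψ₀ y).2) x)
      - dot (ψ₀ x) (grad (fun y => (tu y).2) x))

/-- `∂tθ(0)`, defined from the initial data by taking `t = 0` in the temperature
equation of the perturbation system. -/
def dtθ0 (γ Pr r Re ε χ : ℝ) (φ₀ θ₀ : ℝ × ℝ → ℝ) (ψ₀ : ℝ × ℝ → ℝ × ℝ)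
    (x : ℝ × ℝ) : ℝ :=
  (γ - 1) * (tρ γ Pr ε χ x + φ₀ x)⁻¹ *
      (γ / (γ - 1) / (Re * Pr) * lap θ₀ x
        - (tρ γ Pr ε χ x + φ₀ x) * (tT γ Pr ε χ x + θ₀ x) * divv ψ₀ x
        + ε ^ 2 * (2 * Re⁻¹ * defContract ψ₀ ψ₀ x + 4 * Re⁻¹ * defContract tu ψ₀ x
            + r * Re⁻¹ * (divv ψ₀ x) ^ 2))
    - dot (tu x + ψ₀ x) (grad θ₀ x) - dot (ψ₀ x) (grad (tT γ Pr ε χ) x)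


/-! ### Calculus on space-time -/

abbrev E3 := ℝ × ℝ × ℝ

/-- Directional derivative on space-time. -/
def DD (v : E3) (f : E3 → ℝ) (p : E3) : ℝ := fderiv ℝ f p v

def vt : E3 := (1, 0, 0)
def v1 : E3 := (0, 1, 0)
def v2 : E3 := (0, 0, 1)

abbrev Sm (f : E3 → ℝ) : Prop := ContDiff ℝ (⊤ : ℕ∞) f

lemma Sm.dd {f : E3 → ℝ} (hf : Sm f) (v : E3) : Sm (DD v f) := by
  have h : ContDiff ℝ (⊤ : ℕ∞) (fderiv ℝ f) := hf.fderiv_right (by simp)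
  exact h.clm_apply contDiff_const

@[fun_prop]
lemma dd_contDiff {f : E3 → ℝ} (v : E3) (hf : ContDiff ℝ (⊤ : ℕ∞) f) :
    ContDiff ℝ (⊤ : ℕ∞) (DD v f) := Sm.dd hf v

@[fun_prop]
lemma dd_cont {X : Type*} [TopologicalSpace X] {f : E3 → ℝ} (v : E3)
    (hf : ContDiff ℝ (⊤ : ℕ∞) f) {g : X → E3} (hg : Continuous g) :
    Continuous (fun x => DD v f (g x)) := (Sm.dd hf v).continuous.comp hg

@[fun_prop]
lemma dd_contOn {X : Type*} [TopologicalSpace X] {f : E3 → ℝ} (v : E3)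
    (hf : ContDiff ℝ (⊤ : ℕ∞) f) {g : X → E3} {s : Set X} (hg : ContinuousOn g s) :
    ContinuousOn (fun x => DD v f (g x)) s := (Sm.dd hf v).continuous.comp_continuousOn hg

lemma Sm.diff {f : E3 → ℝ} (hf : Sm f) : Differentiable ℝ f := hf.differentiable (by simp)

lemma Sm.ht {f : E3 → ℝ} (hf : Sm f) (t x y : ℝ) :
    HasDerivAt (fun s => f (s, x, y)) (DD vt f (t, x, y)) t := by
  have h1 : HasDerivAt (fun s : ℝ => ((s, x, y) : E3)) vt t := by
    have := (hasDerivAt_id t).prodMk (hasDerivAt_const t ((x, y) : ℝ × ℝ))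
    exact this
  exact (hf.diff (t, x, y)).hasFDerivAt.comp_hasDerivAt t h1

lemma Sm.h1 {f : E3 → ℝ} (hf : Sm f) (t x y : ℝ) :
    HasDerivAt (fun s => f (t, s, y)) (DD v1 f (t, x, y)) x := by
  have h1 : HasDerivAt (fun s : ℝ => ((t, s, y) : E3)) v1 x := by
    have := (hasDerivAt_const x t).prodMk ((hasDerivAt_id x).prodMk (hasDerivAt_const x y))
    exact this
  exact (hf.diff (t, x, y)).hasFDerivAt.comp_hasDerivAt x h1

lemma Sm.h2 {f : E3 → ℝ} (hf : Sm f) (t x y : ℝ) :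
    HasDerivAt (fun s => f (t, x, s)) (DD v2 f (t, x, y)) y := by
  have h1 : HasDerivAt (fun s : ℝ => ((t, x, s) : E3)) v2 y := by
    have := (hasDerivAt_const y t).prodMk ((hasDerivAt_const y x).prodMk (hasDerivAt_id y))
    exact this
  exact (hf.diff (t, x, y)).hasFDerivAt.comp_hasDerivAt y h1

lemma Sm.dd_comm {f : E3 → ℝ} (hf : Sm f) (v w : E3) (p : E3) :
    DD v (DD w f) p = DD w (DD v f) p := by
  have hd : Differentiable ℝ (fderiv ℝ f) :=
    (hf.fderiv_right (m := (⊤ : ℕ∞)) (by simp)).differentiable (by simp)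
  have key : ∀ v w : E3, DD v (DD w f) p = fderiv ℝ (fderiv ℝ f) p v w := by
    intro v w
    have h2 : HasFDerivAt (DD w f) ((ContinuousLinearMap.apply ℝ ℝ w).comp (fderiv ℝ (fderiv ℝ f) p)) p :=
      (ContinuousLinearMap.apply ℝ ℝ w).hasFDerivAt.comp p (hd p).hasFDerivAt
    unfold DD at h2 ⊢
    rw [h2.fderiv]; rfl
  rw [key, key]
  have hs : IsSymmSndFDerivAt ℝ f p := hf.contDiffAt.isSymmSndFDerivAt (by simp only [minSmoothness_of_isRCLikeNormedField]; exact WithTop.coe_le_coe.2 (le_top (a := (2 : ℕ∞))))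
  exact hs v w

abbrev Per (f : E3 → ℝ) : Prop := ∀ t x y, f (t, x + 2 * π, y) = f (t, x, y)

lemma Per.dd {f : E3 → ℝ} (hf : Per f) (v : E3) : Per (DD v f) := by
  intro t x y
  have h : (fun p : E3 => f (p + (0, 2 * π, 0))) = f := by
    funext ⟨t, x, y⟩
    simpa using hf t x y
  have h2 := fderiv_comp_add_right (𝕜 := ℝ) (f := f) (x := ((t, x, y) : E3)) (0, 2 * π, 0)
  rw [h] at h2
  unfold DD
  rw [h2]
  simp

lemma Per.zero {f : E3 → ℝ} (hf : Per f) (t y : ℝ) : f (t, 2 * π, y) = f (t, 0, y) := by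
  simpa using hf t 0 y

/-- Dirichlet condition on the time interval `[0,T]`. -/
abbrev Bc (T : ℝ) (f : E3 → ℝ) : Prop :=
  ∀ t ∈ Set.Icc (0 : ℝ) T, ∀ x, f (t, x, 0) = 0 ∧ f (t, x, 1) = 0

lemma Bc.d1 {T : ℝ} {f : E3 → ℝ} (hs : Sm f) (hf : Bc T f) : Bc T (DD v1 f) := by
  intro t ht x
  have h : ∀ y, (∀ x, f (t, x, y) = 0) → DD v1 f (t, x, y) = 0 := by
    intro y hy
    have h1 := hs.h1 t x y
    have h2 : (fun s => f (t, s, y)) = fun _ => 0 := by funext s; exact hy s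
    rw [h2] at h1
    exact h1.unique (hasDerivAt_const x 0)
  exact ⟨h 0 fun x => (hf t ht x).1, h 1 fun x => (hf t ht x).2⟩

lemma Bc.dt {T : ℝ} (hT : 0 < T) {f : E3 → ℝ} (hs : Sm f) (hf : Bc T f) : Bc T (DD vt f) := by
  intro t ht x
  have h : ∀ y, (∀ s ∈ Set.Icc (0 : ℝ) T, f (s, x, y) = 0) → DD vt f (t, x, y) = 0 := by
    intro y hy
    have h1 := (hs.ht t x y).hasDerivWithinAt (s := Set.Icc 0 T)
    have h2 : HasDerivWithinAt (fun s => f (s, x, y)) 0 (Set.Icc 0 T) t :=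
      (hasDerivWithinAt_const t _ (0 : ℝ)).congr (fun s hs => hy s hs) (hy t ht)
    exact (uniqueDiffOn_Icc hT t ht).eq_deriv _ h1 h2
  exact ⟨h 0 fun s hs => (hf s hs x).1, h 1 fun s hs => (hf s hs x).2⟩

/-! ### Integration over the cell -/

/-- Closed cell. -/
def Kc : Set (ℝ × ℝ) := Set.Icc 0 (2 * π) ×ˢ Set.Icc 0 1

lemma Kc_compact : IsCompact Kc := isCompact_Icc.prod isCompact_Icc

lemma Ω_eq : Ω = Set.Ioo 0 (2 * π) ×ˢ Set.Ioo 0 1 := rfl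

lemma Ω_sub : Ω ⊆ Kc := Set.prod_mono Set.Ioo_subset_Icc_self Set.Ioo_subset_Icc_self

lemma Ω_meas : MeasurableSet Ω := measurableSet_Ioo.prod measurableSet_Ioo

lemma intΩ {f : ℝ × ℝ → ℝ} (hf : ContinuousOn f Kc) : IntegrableOn f Ω :=
  (hf.integrableOn_compact Kc_compact).mono_set Ω_sub

lemma Ω_finite : volume Ω < ⊤ := lt_of_le_of_lt (measure_mono Ω_sub) Kc_compact.measure_lt_top

lemma pi2 : (0 : ℝ) ≤ 2 * π := by positivity

lemma Ω_fub {f : ℝ × ℝ → ℝ} (hf : ContinuousOn f Kc) :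
    ∫ x in Ω, f x = ∫ x in (0 : ℝ)..(2 * π), ∫ y in (0 : ℝ)..1, f (x, y) := by
  have h := intΩ hf
  rw [Ω_eq] at h ⊢
  rw [Measure.volume_eq_prod] at h ⊢
  rw [setIntegral_prod _ h]
  rw [intervalIntegral.integral_of_le pi2, integral_Ioc_eq_integral_Ioo]
  simp_rw [intervalIntegral.integral_of_le (zero_le_one' ℝ), integral_Ioc_eq_integral_Ioo]

lemma Ω_fub' {f : ℝ × ℝ → ℝ} (hf : ContinuousOn f Kc) :
    ∫ x in Ω, f x = ∫ y in (0 : ℝ)..1, ∫ x in (0 : ℝ)..(2 * π), f (x, y) := by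
  rw [Ω_fub hf]
  have h := intΩ hf
  rw [Ω_eq, Measure.volume_eq_prod, IntegrableOn, ← Measure.prod_restrict] at h
  simp_rw [intervalIntegral.integral_of_le (zero_le_one' ℝ), intervalIntegral.integral_of_le pi2,
    integral_Ioc_eq_integral_Ioo]
  exact integral_integral_swap (f := fun x y => f (x, y)) h

lemma slice1 {f : ℝ × ℝ → ℝ} (hf : ContinuousOn f Kc) {y : ℝ} (hy : y ∈ Set.Icc (0 : ℝ) 1) :
    IntervalIntegrable (fun x => f (x, y)) volume 0 (2 * π) := by
  apply ContinuousOn.intervalIntegrable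
  rw [Set.uIcc_of_le pi2]
  exact hf.comp (by fun_prop) (fun x hx => ⟨hx, hy⟩)

lemma slice2 {f : ℝ × ℝ → ℝ} (hf : ContinuousOn f Kc) {x : ℝ} (hx : x ∈ Set.Icc (0 : ℝ) (2 * π)) :
    IntervalIntegrable (fun y => f (x, y)) volume 0 1 := by
  apply ContinuousOn.intervalIntegrable
  rw [Set.uIcc_of_le (zero_le_one' ℝ)]
  exact hf.comp (by fun_prop) (fun y hy => ⟨hx, hy⟩)

lemma ibp1 {g g' : ℝ × ℝ → ℝ} (hc : ContinuousOn g' Kc)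
    (hd : ∀ x y, (x, y) ∈ Kc → HasDerivAt (fun s => g (s, y)) (g' (x, y)) x)
    (hp : ∀ y ∈ Set.Icc (0 : ℝ) 1, g (2 * π, y) = g (0, y)) : ∫ x in Ω, g' x = 0 := by
  rw [Ω_fub' hc]
  apply intervalIntegral.integral_zero_ae
  refine Eventually.of_forall fun y hy => ?_
  rw [Set.uIoc_of_le (zero_le_one' ℝ)] at hy
  have hy' : y ∈ Set.Icc (0 : ℝ) 1 := ⟨hy.1.le, hy.2⟩
  rw [intervalIntegral.integral_eq_sub_of_hasDerivAt (f := fun s => g (s, y)) _ (slice1 hc hy')]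
  · rw [hp y hy', sub_self]
  · intro x hx
    rw [Set.uIcc_of_le pi2] at hx
    exact hd x y ⟨hx, hy'⟩

lemma ibp2 {g g' : ℝ × ℝ → ℝ} (hc : ContinuousOn g' Kc)
    (hd : ∀ x y, (x, y) ∈ Kc → HasDerivAt (fun s => g (x, s)) (g' (x, y)) y)
    (hp : ∀ x ∈ Set.Icc (0 : ℝ) (2 * π), g (x, 1) = g (x, 0)) : ∫ x in Ω, g' x = 0 := by
  rw [Ω_fub hc]
  apply intervalIntegral.integral_zero_ae
  refine Eventually.of_forall fun x hx => ?_
  rw [Set.uIoc_of_le pi2] at hx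
  have hx' : x ∈ Set.Icc (0 : ℝ) (2 * π) := ⟨hx.1.le, hx.2⟩
  rw [intervalIntegral.integral_eq_sub_of_hasDerivAt (f := fun s => g (x, s)) _ (slice2 hc hx')]
  · rw [hp x hx', sub_self]
  · intro y hy
    rw [Set.uIcc_of_le (zero_le_one' ℝ)] at hy
    exact hd x y ⟨hx', hy⟩

/-- Space-time closed cell. -/
def KT (T : ℝ) : Set E3 := Set.Icc 0 T ×ˢ Kc

lemma KT_compact (T : ℝ) : IsCompact (KT T) := isCompact_Icc.prod Kc_compact

lemma sliceT {T : ℝ} {f : E3 → ℝ} (hf : ContinuousOn f (KT T)) {t : ℝ} (ht : t ∈ Set.Icc 0 T) :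
    ContinuousOn (fun x : ℝ × ℝ => f (t, x)) Kc :=
  hf.comp (by fun_prop) (fun x hx => ⟨ht, hx⟩)

lemma intT {T : ℝ} {f : E3 → ℝ} (hf : ContinuousOn f (KT T)) {t : ℝ} (ht : t ∈ Set.Icc 0 T) :
    Integrable f ((volume.restrict (Set.Ioc 0 t)).prod (volume.restrict Ω)) := by
  rw [Measure.prod_restrict, ← Measure.volume_eq_prod]
  refine (hf.integrableOn_compact (KT_compact T)).mono_set ?_
  exact Set.prod_mono (fun s hs => ⟨hs.1.le, hs.2.trans ht.2⟩) Ω_sub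

lemma intT' {T : ℝ} {f : E3 → ℝ} (hf : ContinuousOn f (KT T)) {t : ℝ} (ht : t ∈ Set.Icc 0 T) :
    IntervalIntegrable (fun s => ∫ x in Ω, f (s, x)) volume 0 t := by
  rw [intervalIntegrable_iff_integrableOn_Ioc_of_le ht.1]
  exact (intT hf ht).integral_prod_left

lemma timeFTC {T : ℝ} {e e' : E3 → ℝ} (he : ContinuousOn e (KT T)) (he' : ContinuousOn e' (KT T))
    (hd : ∀ t x y, (t, x, y) ∈ KT T → HasDerivAt (fun s => e (s, x, y)) (e' (t, x, y)) t)
    {t : ℝ} (ht : t ∈ Set.Icc 0 T) :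
    (∫ x in Ω, e (t, x)) - ∫ x in Ω, e (0, x) = ∫ s in (0 : ℝ)..t, ∫ x in Ω, e' (s, x) := by
  have h0 : (0 : ℝ) ∈ Set.Icc 0 T := ⟨le_rfl, ht.1.trans ht.2⟩
  rw [← integral_sub (intΩ (sliceT he ht)) (intΩ (sliceT he h0)),
    intervalIntegral.integral_of_le ht.1,
    integral_integral_swap (f := fun s x => e' (s, x)) (intT he' ht)]
  refine setIntegral_congr_fun Ω_meas fun x hx => ?_
  have hx' := Ω_sub hx
  obtain ⟨x, y⟩ := x
  rw [← intervalIntegral.integral_of_le ht.1,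
    intervalIntegral.integral_eq_sub_of_hasDerivAt (f := fun s => e (s, x, y))]
  · intro s hs
    rw [Set.uIcc_of_le ht.1] at hs
    exact hd s x y ⟨⟨hs.1, hs.2.trans ht.2⟩, hx'⟩
  · apply ContinuousOn.intervalIntegrable
    rw [Set.uIcc_of_le ht.1]
    exact he'.comp (by fun_prop) (fun s hs => ⟨⟨hs.1, hs.2.trans ht.2⟩, hx'⟩)

/-- Integrated balance law. -/
lemma balance {T : ℝ} {e e' g g' k k' R : E3 → ℝ}
    (he : ContinuousOn e (KT T)) (he' : ContinuousOn e' (KT T))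
    (hg' : ContinuousOn g' (KT T)) (hk' : ContinuousOn k' (KT T))
    (hde : ∀ t x y, (t, x, y) ∈ KT T → HasDerivAt (fun s => e (s, x, y)) (e' (t, x, y)) t)
    (hdg : ∀ t x y, (t, x, y) ∈ KT T → HasDerivAt (fun s => g (t, s, y)) (g' (t, x, y)) x)
    (hdk : ∀ t x y, (t, x, y) ∈ KT T → HasDerivAt (fun s => k (t, x, s)) (k' (t, x, y)) y)
    (hpg : ∀ t ∈ Set.Icc (0 : ℝ) T, ∀ y ∈ Set.Icc (0 : ℝ) 1, g (t, 2 * π, y) = g (t, 0, y))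
    (hpk : ∀ t ∈ Set.Icc (0 : ℝ) T, ∀ x ∈ Set.Icc (0 : ℝ) (2 * π), k (t, x, 1) = k (t, x, 0))
    (hR : ∀ t ∈ Set.Icc (0 : ℝ) T, ∀ x ∈ Ω, e' (t, x) + g' (t, x) + k' (t, x) = R (t, x))
    {t : ℝ} (ht : t ∈ Set.Icc 0 T) :
    (∫ x in Ω, e (t, x)) - ∫ x in Ω, e (0, x) = ∫ s in (0 : ℝ)..t, ∫ x in Ω, R (s, x) := by
  rw [timeFTC he he' hde ht]
  refine intervalIntegral.integral_congr fun s hs => ?_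
  rw [Set.uIcc_of_le ht.1] at hs
  have hs' : s ∈ Set.Icc 0 T := ⟨hs.1, hs.2.trans ht.2⟩
  rw [← setIntegral_congr_fun Ω_meas (hR s hs')]
  have i1 := intΩ (sliceT he' hs')
  have i2 := intΩ (sliceT hg' hs')
  have i3 := intΩ (sliceT hk' hs')
  have z1 : ∫ x in Ω, g' (s, x) = 0 :=
    ibp1 (g := fun x => g (s, x)) (sliceT hg' hs') (fun x y h => hdg s x y ⟨hs', h⟩) (hpg s hs')
  have z2 : ∫ x in Ω, k' (s, x) = 0 :=
    ibp2 (g := fun x => k (s, x)) (sliceT hk' hs') (fun x y h => hdk s x y ⟨hs', h⟩) (hpk s hs')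
  have i12 : IntegrableOn (fun x => e' (s, x) + g' (s, x)) Ω := i1.add i2
  rw [integral_add i12 i3, integral_add i1 i2, z1, z2]; simp

/-- Integration in time of a pointwise-in-time inequality. -/
lemma timeMono {T : ℝ} {f g : E3 → ℝ} (hf : ContinuousOn f (KT T)) (hg : ContinuousOn g (KT T))
    (h : ∀ t ∈ Set.Icc (0 : ℝ) T, ∫ x in Ω, f (t, x) ≤ ∫ x in Ω, g (t, x))
    {t : ℝ} (ht : t ∈ Set.Icc 0 T) :
    ∫ s in (0 : ℝ)..t, ∫ x in Ω, f (s, x) ≤ ∫ s in (0 : ℝ)..t, ∫ x in Ω, g (s, x) :=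
  intervalIntegral.integral_mono_on ht.1 (intT' hf ht) (intT' hg ht)
    (fun s hs => h s ⟨hs.1, hs.2.trans ht.2⟩)

/-! ### Functional inequalities -/

lemma emb_one {L : ℝ} (hL : 1 ≤ L) {g g' : ℝ → ℝ} (hg' : ContinuousOn g' (Set.Icc 0 L))
    (hd : ∀ s ∈ Set.Icc 0 L, HasDerivAt g (g' s) s) {s : ℝ} (hs : s ∈ Set.Icc 0 L) :
    |g s| ≤ (∫ z in (0 : ℝ)..L, |g z|) + ∫ z in (0 : ℝ)..L, |g' z| := by
  have hL0 : (0 : ℝ) ≤ L := by linarith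
  have hg : ContinuousOn g (Set.Icc 0 L) := fun z hz => (hd z hz).continuousAt.continuousWithinAt
  have ig : IntervalIntegrable (fun z => |g z|) volume 0 L := by
    apply ContinuousOn.intervalIntegrable; rw [Set.uIcc_of_le hL0]; exact hg.abs
  have ig' : IntervalIntegrable (fun z => |g' z|) volume 0 L := by
    apply ContinuousOn.intervalIntegrable; rw [Set.uIcc_of_le hL0]; exact hg'.abs
  set J := ∫ z in (0 : ℝ)..L, |g' z| with hJ
  have key : ∀ z ∈ Set.Icc 0 L, |g s| ≤ |g z| + J := by
    intro z hz
    have hsub : Set.uIcc z s ⊆ Set.Icc 0 L := Set.uIcc_subset_Icc hz hs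
    have h1 : ∫ w in z..s, g' w = g s - g z :=
      intervalIntegral.integral_eq_sub_of_hasDerivAt (fun w hw => hd w (hsub hw))
        (ContinuousOn.intervalIntegrable (hg'.mono hsub))
    have h2 : |∫ w in z..s, g' w| ≤ J := by
      have h3 := intervalIntegral.norm_integral_le_integral_norm_uIoc (f := g') (a := z) (b := s)
        (μ := volume)
      refine h3.trans ?_
      rw [hJ, intervalIntegral.integral_of_le hL0]
      apply setIntegral_mono_set
      · exact (intervalIntegrable_iff_integrableOn_Ioc_of_le hL0).1 ig'
      · exact Eventually.of_forall fun w => abs_nonneg _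
      · apply LE.le.eventuallyLE
        intro w hw
        rw [Set.uIoc, Set.mem_Ioc] at hw
        exact ⟨lt_of_le_of_lt (le_min hz.1 hs.1) hw.1, hw.2.trans (max_le hz.2 hs.2)⟩
    rw [h1] at h2
    have := abs_sub_abs_le_abs_sub (g s) (g z)
    linarith
  have h_intg : ∫ z in (0 : ℝ)..L, |g s| ≤ ∫ z in (0 : ℝ)..L, (|g z| + J) :=
    intervalIntegral.integral_mono_on hL0 (by simp) (ig.add (by simp)) key
  rw [intervalIntegral.integral_add ig (by simp)] at h_intg
  simp only [intervalIntegral.integral_const, smul_eq_mul, sub_zero] at h_intg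
  have hI : 0 ≤ ∫ z in (0 : ℝ)..L, |g z| :=
    intervalIntegral.integral_nonneg hL0 fun _ _ => abs_nonneg _
  nlinarith [abs_nonneg (g s)]

lemma emb_two {f f1 f2 f12 : ℝ × ℝ → ℝ} (hf : ContinuousOn f Kc) (hf1 : ContinuousOn f1 Kc)
    (hf2 : ContinuousOn f2 Kc) (hf12 : ContinuousOn f12 Kc)
    (d1 : ∀ x y, (x, y) ∈ Kc → HasDerivAt (fun s => f (s, y)) (f1 (x, y)) x)
    (d2 : ∀ x y, (x, y) ∈ Kc → HasDerivAt (fun s => f (x, s)) (f2 (x, y)) y)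
    (d12 : ∀ x y, (x, y) ∈ Kc → HasDerivAt (fun s => f2 (s, y)) (f12 (x, y)) x)
    {x y : ℝ} (hxy : (x, y) ∈ Kc) :
    |f (x, y)| ≤ ∫ z in Ω, (|f z| + |f1 z| + |f2 z| + |f12 z|) := by
  have hpi : (1 : ℝ) ≤ 2 * π := by linarith [Real.pi_gt_three]
  have hc : ContinuousOn (fun z => |f z| + |f1 z| + |f2 z| + |f12 z|) Kc := by
    exact ((hf.abs.add hf1.abs).add hf2.abs).add hf12.abs
  rw [Ω_fub' hc]
  have hx := hxy.1
  have s2 : ∀ {h : ℝ × ℝ → ℝ}, ContinuousOn h Kc →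
      ContinuousOn (fun w => h (x, w)) (Set.Icc 0 1) := fun hh =>
    hh.comp (by fun_prop) (fun y hy => ⟨hx, hy⟩)
  have h1 := emb_one (g := fun w => f (x, w)) (g' := fun w => f2 (x, w)) le_rfl
    (s2 hf2) (fun w hw => d2 x w ⟨hx, hw⟩) hxy.2
  refine h1.trans ?_
  rw [← intervalIntegral.integral_add (slice2 hf.abs hx) (slice2 hf2.abs hx)]
  have hcon : IntervalIntegrable (fun w => ∫ z in (0 : ℝ)..(2 * π),
      (|f (z, w)| + |f1 (z, w)| + |f2 (z, w)| + |f12 (z, w)|)) volume 0 1 := by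
    have h := intΩ hc
    rw [Ω_eq, Measure.volume_eq_prod, IntegrableOn, ← Measure.prod_restrict] at h
    rw [intervalIntegrable_iff_integrableOn_Ioc_of_le zero_le_one,
      integrableOn_Ioc_iff_integrableOn_Ioo]
    simp_rw [intervalIntegral.integral_of_le pi2, integral_Ioc_eq_integral_Ioo]
    exact h.integral_prod_right
  refine intervalIntegral.integral_mono_on zero_le_one
    ((slice2 hf.abs hx).add (slice2 hf2.abs hx)) hcon ?_
  intro w hw
  have s1 : ∀ {h : ℝ × ℝ → ℝ}, ContinuousOn h Kc →
      ContinuousOn (fun z => h (z, w)) (Set.Icc 0 (2 * π)) := fun hh =>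
    hh.comp (by fun_prop) (fun y hy => ⟨hy, hw⟩)
  have a1 := emb_one (g := fun z => f (z, w)) (g' := fun z => f1 (z, w)) hpi
    (s1 hf1) (fun z hz => d1 z w ⟨hz, hw⟩) hx
  have a2 := emb_one (g := fun z => f2 (z, w)) (g' := fun z => f12 (z, w)) hpi
    (s1 hf12) (fun z hz => d12 z w ⟨hz, hw⟩) hx
  have i0 := slice1 hf.abs hw
  have i1 := slice1 hf1.abs hw
  have i2 := slice1 hf2.abs hw
  have i3 := slice1 hf12.abs hw
  rw [intervalIntegral.integral_add ((i0.add i1).add i2) i3,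
    intervalIntegral.integral_add (i0.add i1) i2, intervalIntegral.integral_add i0 i1]
  linarith

lemma Sm.cont2 {f : E3 → ℝ} (hf : Sm f) (t : ℝ) : Continuous (fun x : ℝ × ℝ => f (t, x)) :=
  hf.continuous.comp (by fun_prop)

lemma Sm.int {f : E3 → ℝ} (hf : Sm f) (t : ℝ) : IntegrableOn (fun x : ℝ × ℝ => f (t, x)) Ω :=
  intΩ (hf.cont2 t).continuousOn

lemma Sm.int2 {f : E3 → ℝ} (hf : Sm f) (t : ℝ) :
    IntegrableOn (fun x : ℝ × ℝ => f (t, x) ^ 2) Ω :=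
  intΩ ((hf.cont2 t).pow 2).continuousOn

lemma sup_bound {f : E3 → ℝ} (hf : Sm f) {ε M : ℝ} (hε : 0 < ε) (hε1 : ε ≤ 1) (hM : 0 ≤ M)
    {t : ℝ} (h0 : ∫ x in Ω, f (t, x) ^ 2 ≤ ε ^ 2 * M ^ 2)
    (h1 : ∫ x in Ω, DD v1 f (t, x) ^ 2 ≤ M ^ 2) (h2 : ∫ x in Ω, DD v2 f (t, x) ^ 2 ≤ M ^ 2)
    (h12 : ε ^ 2 * ∫ x in Ω, DD v1 (DD v2 f) (t, x) ^ 2 ≤ M ^ 2) {x : ℝ × ℝ} (hx : x ∈ Kc) :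
    |f (t, x)| ≤ 3 * M := by
  obtain ⟨x, y⟩ := x
  have hc := hf.continuous
  have key := emb_two (f := fun x => f (t, x) * f (t, x))
    (f1 := fun x => DD v1 f (t, x) * f (t, x) + f (t, x) * DD v1 f (t, x))
    (f2 := fun x => DD v2 f (t, x) * f (t, x) + f (t, x) * DD v2 f (t, x))
    (f12 := fun x => DD v1 (DD v2 f) (t, x) * f (t, x) + DD v2 f (t, x) * DD v1 f (t, x)
      + (DD v1 f (t, x) * DD v2 f (t, x) + f (t, x) * DD v1 (DD v2 f) (t, x)))
    (Continuous.continuousOn (by fun_prop)) (Continuous.continuousOn (by fun_prop)) (Continuous.continuousOn (by fun_prop)) (Continuous.continuousOn (by fun_prop))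
    (fun x y _ => (hf.h1 t x y).mul (hf.h1 t x y))
    (fun x y _ => (hf.h2 t x y).mul (hf.h2 t x y))
    (fun x y _ => (((hf.dd v2).h1 t x y).mul (hf.h1 t x y)).add
      ((hf.h1 t x y).mul ((hf.dd v2).h1 t x y))) hx
  have i0 := hf.int2 t
  have i1 := (hf.dd v1).int2 t
  have i2 := (hf.dd v2).int2 t
  have i12 := ((hf.dd v2).dd v1).int2 t
  have hmono := integral_mono (μ := volume.restrict Ω)
    (f := fun x => |f (t, x) * f (t, x)| +
      |DD v1 f (t, x) * f (t, x) + f (t, x) * DD v1 f (t, x)| +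
      |DD v2 f (t, x) * f (t, x) + f (t, x) * DD v2 f (t, x)| +
      |DD v1 (DD v2 f) (t, x) * f (t, x) + DD v2 f (t, x) * DD v1 f (t, x)
      + (DD v1 f (t, x) * DD v2 f (t, x) + f (t, x) * DD v1 (DD v2 f) (t, x))|)
    (g := fun x => (3 + (ε ^ 2)⁻¹) * f (t, x) ^ 2 + 2 * DD v1 f (t, x) ^ 2
      + 2 * DD v2 f (t, x) ^ 2 + ε ^ 2 * DD v1 (DD v2 f) (t, x) ^ 2)
    (intΩ (Continuous.continuousOn (by fun_prop))) (intΩ (Continuous.continuousOn (by fun_prop))) ?_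
  · have j0 : Integrable (fun x => (3 + (ε ^ 2)⁻¹) * f (t, x) ^ 2) (volume.restrict Ω) :=
      i0.const_mul _
    have j1 : Integrable (fun x => 2 * DD v1 f (t, x) ^ 2) (volume.restrict Ω) := i1.const_mul _
    have j2 : Integrable (fun x => 2 * DD v2 f (t, x) ^ 2) (volume.restrict Ω) := i2.const_mul _
    have j12 : Integrable (fun x => ε ^ 2 * DD v1 (DD v2 f) (t, x) ^ 2) (volume.restrict Ω) :=
      i12.const_mul _
    have j01 : Integrable (fun x => (3 + (ε ^ 2)⁻¹) * f (t, x) ^ 2 + 2 * DD v1 f (t, x) ^ 2)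
      (volume.restrict Ω) := j0.add j1
    have j012 : Integrable (fun x => (3 + (ε ^ 2)⁻¹) * f (t, x) ^ 2 + 2 * DD v1 f (t, x) ^ 2
      + 2 * DD v2 f (t, x) ^ 2) (volume.restrict Ω) := j01.add j2
    rw [integral_add j012 j12, integral_add j01 j2, integral_add j0 j1] at hmono
    simp only [integral_const_mul] at hmono
    have hle := key.trans hmono
    have hz : (3 + (ε ^ 2)⁻¹) * ∫ x in Ω, f (t, x) ^ 2 ≤ 4 * M ^ 2 := by
      calc _ ≤ (3 + (ε ^ 2)⁻¹) * (ε ^ 2 * M ^ 2) := by gcongr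
        _ = 3 * ε ^ 2 * M ^ 2 + M ^ 2 := by field_simp
        _ ≤ 3 * 1 * M ^ 2 + M ^ 2 := by gcongr; nlinarith
        _ = _ := by ring
    rw [abs_mul_self] at hle
    apply abs_le_of_sq_le_sq _ (by positivity)
    nlinarith
  · intro x
    dsimp only
    generalize f (t, x) = F0
    generalize DD v1 f (t, x) = F1
    generalize DD v2 f (t, x) = F2
    generalize DD v1 (DD v2 f) (t, x) = F12
    have e1 : |F0 * F0| = F0 ^ 2 := by rw [abs_mul_self]; ring
    have e2 : |F1 * F0 + F0 * F1| ≤ F0 ^ 2 + F1 ^ 2 := by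
      rw [abs_le]; constructor <;> nlinarith [sq_nonneg (F0 + F1), sq_nonneg (F0 - F1)]
    have e3 : |F2 * F0 + F0 * F2| ≤ F0 ^ 2 + F2 ^ 2 := by
      rw [abs_le]; constructor <;> nlinarith [sq_nonneg (F0 + F2), sq_nonneg (F0 - F2)]
    have e4 : |F12 * F0 + F2 * F1 + (F1 * F2 + F0 * F12)| ≤
        F1 ^ 2 + F2 ^ 2 + (ε ^ 2)⁻¹ * F0 ^ 2 + ε ^ 2 * F12 ^ 2 := by
      have w : ∀ z : ℝ, (ε⁻¹ * F0) * (ε * z) = F0 * z := by intro z; field_simp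
      have w1 := w F12
      rw [abs_le, ← inv_pow]
      constructor <;> nlinarith [sq_nonneg (F1 + F2), sq_nonneg (F1 - F2),
        sq_nonneg (ε⁻¹ * F0 + ε * F12), sq_nonneg (ε⁻¹ * F0 - ε * F12)]
    linarith

lemma poincare {T : ℝ} {f : E3 → ℝ} (hf : Sm f) (hb : Bc T f) {t : ℝ} (ht : t ∈ Set.Icc 0 T) :
    ∫ x in Ω, f (t, x) ^ 2 ≤ ∫ x in Ω, DD v2 f (t, x) ^ 2 := by
  have hc := hf.continuous
  have hz := ibp2 (g := fun x => (x.2 - 1 / 2) * (f (t, x) * f (t, x)))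
    (g' := fun x => 1 * (f (t, x) * f (t, x)) +
      (x.2 - 1 / 2) * (DD v2 f (t, x) * f (t, x) + f (t, x) * DD v2 f (t, x)))
    (Continuous.continuousOn (by fun_prop))
    (fun x y _ => ((hasDerivAt_id y).sub_const (1 / 2)).mul ((hf.h2 t x y).mul (hf.h2 t x y)))
    (fun x _ => by simp [(hb t ht x).1, (hb t ht x).2])
  have i0 := hf.int2 t
  have i2 := (hf.dd v2).int2 t
  have j0 : Integrable (fun x => (1 / 2) * f (t, x) ^ 2) (volume.restrict Ω) := i0.const_mul _
  have j2 : Integrable (fun x => (1 / 2) * DD v2 f (t, x) ^ 2) (volume.restrict Ω) :=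
    i2.const_mul _
  have hm := setIntegral_mono_on (s := Ω) (μ := volume)
    (f := fun x => (1 / 2) * f (t, x) ^ 2 - (1 / 2) * DD v2 f (t, x) ^ 2)
    (g := fun x => 1 * (f (t, x) * f (t, x)) +
      (x.2 - 1 / 2) * (DD v2 f (t, x) * f (t, x) + f (t, x) * DD v2 f (t, x)))
    (intΩ (Continuous.continuousOn (by fun_prop))) (intΩ (Continuous.continuousOn (by fun_prop))) Ω_meas ?_
  · rw [hz, integral_sub j0 j2, integral_const_mul, integral_const_mul] at hm
    linarith
  · rintro ⟨x, y⟩ hx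
    have hy : y ∈ Set.Ioo (0 : ℝ) 1 := hx.2
    dsimp only
    generalize f (t, x, y) = F0
    generalize DD v2 f (t, x, y) = F2
    nlinarith [mul_nonneg hy.1.le (sq_nonneg (F0 + F2)),
      mul_nonneg (sub_nonneg.2 hy.2.le) (sq_nonneg (F0 - F2))]

lemma elliptic {T : ℝ} {f : E3 → ℝ} (hf : Sm f) (hp : Per f) (hb : Bc T f) {t : ℝ}
    (ht : t ∈ Set.Icc 0 T) :
    ∫ x in Ω, (DD v1 (DD v1 f) (t, x) ^ 2 + 2 * DD v1 (DD v2 f) (t, x) ^ 2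
      + DD v2 (DD v2 f) (t, x) ^ 2)
      = ∫ x in Ω, (DD v1 (DD v1 f) (t, x) + DD v2 (DD v2 f) (t, x)) ^ 2 := by
  have hc := hf.continuous
  have s1 := hf.dd v1
  have s2 := hf.dd v2
  have s11 := s1.dd v1
  have s12 := s2.dd v1
  have s22 := s2.dd v2
  have z1 := ibp1 (g := fun x => DD v1 f (t, x) * DD v2 (DD v2 f) (t, x))
    (g' := fun x => DD v1 (DD v1 f) (t, x) * DD v2 (DD v2 f) (t, x)
      + DD v1 f (t, x) * DD v1 (DD v2 (DD v2 f)) (t, x)) (Continuous.continuousOn (by fun_prop))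
    (fun x y _ => (s1.h1 t x y).mul (s22.h1 t x y))
    (fun y _ => by
      show DD v1 f (t, 2 * π, y) * DD v2 (DD v2 f) (t, 2 * π, y) = _
      rw [(hp.dd v1).zero, ((hp.dd v2).dd v2).zero])
  have z2 := ibp2 (g := fun x => DD v1 f (t, x) * DD v1 (DD v2 f) (t, x))
    (g' := fun x => DD v1 (DD v2 f) (t, x) * DD v1 (DD v2 f) (t, x)
      + DD v1 f (t, x) * DD v1 (DD v2 (DD v2 f)) (t, x)) (Continuous.continuousOn (by fun_prop))
    (fun x y _ => by
      have := (s1.h2 t x y).mul (s12.h2 t x y)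
      rw [hf.dd_comm v2 v1, s2.dd_comm v2 v1] at this
      exact this)
    (fun x _ => by simp [(hb.d1 hf t ht x).1, (hb.d1 hf t ht x).2])
  have hsub := integral_sub (μ := volume.restrict Ω)
    (f := fun x => (DD v1 (DD v1 f) (t, x) + DD v2 (DD v2 f) (t, x)) ^ 2)
    (g := fun x => DD v1 (DD v1 f) (t, x) ^ 2 + 2 * DD v1 (DD v2 f) (t, x) ^ 2
      + DD v2 (DD v2 f) (t, x) ^ 2) (intΩ (Continuous.continuousOn (by fun_prop))) (intΩ (Continuous.continuousOn (by fun_prop)))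
  have hsub2 := integral_sub (μ := volume.restrict Ω)
    (f := fun x => DD v1 (DD v1 f) (t, x) * DD v2 (DD v2 f) (t, x)
      + DD v1 f (t, x) * DD v1 (DD v2 (DD v2 f)) (t, x))
    (g := fun x => DD v1 (DD v2 f) (t, x) * DD v1 (DD v2 f) (t, x)
      + DD v1 f (t, x) * DD v1 (DD v2 (DD v2 f)) (t, x))
      (intΩ (Continuous.continuousOn (by fun_prop))) (intΩ (Continuous.continuousOn (by fun_prop)))
  rw [z1, z2] at hsub2
  have h3 : ∫ x in Ω, ((DD v1 (DD v1 f) (t, x) + DD v2 (DD v2 f) (t, x)) ^ 2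
      - (DD v1 (DD v1 f) (t, x) ^ 2 + 2 * DD v1 (DD v2 f) (t, x) ^ 2
      + DD v2 (DD v2 f) (t, x) ^ 2)) = 2 * 0 := by
    rw [← sub_self (0 : ℝ), ← hsub2, ← integral_const_mul]
    congr 1
    funext x
    ring
  linarith

/-! ### The perturbation system in coordinates -/

/-- The perturbation system, written in coordinates, together with the a priori pointwise bounds. -/
structure Sys (c μ r κ ε T K : ℝ) (τ τ1 : ℝ → ℝ) (a b φ θ : E3 → ℝ) : Prop where
  hε : 0 < ε
  hε1 : 3 * ε ≤ 1 / 4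
  hc : 0 < c
  hμ : 0 < μ
  hr : 0 < 1 + r
  hκ : 0 < κ
  hT : 0 < T
  hK : 0 < K
  sa : Sm a
  sb : Sm b
  sφ : Sm φ
  sθ : Sm θ
  pa : Per a
  pb : Per b
  pφ : Per φ
  pθ : Per θ
  ba : Bc T a
  bb : Bc T b
  bθ : Bc T θ
  hτ : ∀ y, HasDerivAt τ (τ1 y) y
  hτ1 : Continuous τ1
  τlo : ∀ y ∈ Set.Icc (0 : ℝ) 1, 1 / 2 ≤ τ y
  τhi : ∀ y ∈ Set.Icc (0 : ℝ) 1, τ y ≤ 2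
  τder_bd : ∀ y ∈ Set.Icc (0 : ℝ) 1, |τ1 y| ≤ K * ε
  φb : ∀ p ∈ KT T, |φ p| ≤ 3 * ε
  θb : ∀ p ∈ KT T, |θ p| ≤ 3 * ε
  ab : ∀ p ∈ KT T, |a p| ≤ 3
  bbd : ∀ p ∈ KT T, |b p| ≤ 3
  a1b : ∀ p ∈ KT T, |DD v1 a p| ≤ 3 * ε⁻¹
  a2b : ∀ p ∈ KT T, |DD v2 a p| ≤ 3 * ε⁻¹
  b1b : ∀ p ∈ KT T, |DD v1 b p| ≤ 3 * ε⁻¹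
  b2b : ∀ p ∈ KT T, |DD v2 b p| ≤ 3 * ε⁻¹
  mass : ∀ t ∈ Set.Icc (0 : ℝ) T, ∀ x y, (x, y) ∈ Ω → ∀ p : E3, p = (t, x, y) →
    DD vt φ p + ((y + a p) * DD v1 φ p + b p * DD v2 φ p)
      + ((τ y)⁻¹ + φ p) * (DD v1 a p + DD v2 b p)
      + b p * (-(τ1 y * (τ y)⁻¹ ^ 2)) = 0
  mom1 : ∀ t ∈ Set.Icc (0 : ℝ) T, ∀ x y, (x, y) ∈ Ω → ∀ p : E3, p = (t, x, y) →
    ((τ y)⁻¹ + φ p) * (DD vt a p + ((y + a p) * DD v1 a p + b p * DD v2 a p) + b p)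
      + (ε ^ 2)⁻¹ * (DD v1 φ p * (τ y + θ p) + ((τ y)⁻¹ + φ p) * DD v1 θ p)
      - μ * (DD v1 (DD v1 a) p + DD v2 (DD v2 a) p)
      - (μ + r * μ) * (DD v1 (DD v1 a) p + DD v1 (DD v2 b) p) = 0
  mom2 : ∀ t ∈ Set.Icc (0 : ℝ) T, ∀ x y, (x, y) ∈ Ω → ∀ p : E3, p = (t, x, y) →
    ((τ y)⁻¹ + φ p) * (DD vt b p + ((y + a p) * DD v1 b p + b p * DD v2 b p))
      + (ε ^ 2)⁻¹ * ((-(τ1 y * (τ y)⁻¹ ^ 2) + DD v2 φ p) * (τ y + θ p)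
        + ((τ y)⁻¹ + φ p) * (τ1 y + DD v2 θ p))
      - μ * (DD v1 (DD v1 b) p + DD v2 (DD v2 b) p)
      - (μ + r * μ) * (DD v2 (DD v1 a) p + DD v2 (DD v2 b) p) = 0
  energy : ∀ t ∈ Set.Icc (0 : ℝ) T, ∀ x y, (x, y) ∈ Ω → ∀ p : E3, p = (t, x, y) →
    c * ((τ y)⁻¹ + φ p) * (DD vt θ p + ((y + a p) * DD v1 θ p + b p * DD v2 θ p) + b p * τ1 y)
      + ((τ y)⁻¹ + φ p) * (τ y + θ p) * (DD v1 a p + DD v2 b p)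
      - κ * (DD v1 (DD v1 θ) p + DD v2 (DD v2 θ) p)
      = ε ^ 2 * (2 * μ * (DD v1 a p ^ 2 + DD v2 b p ^ 2 + (DD v1 b p + DD v2 a p) ^ 2 / 2)
        + 4 * μ * ((DD v1 b p + DD v2 a p) / 2) + r * μ * (DD v1 a p + DD v2 b p) ^ 2)

/-- Density `e` satisfies a balance law with source `R` and fluxes of zero total divergence. -/
def Bal (T : ℝ) (e R : E3 → ℝ) : Prop :=
  ∃ e' g g' k k' : E3 → ℝ, ContinuousOn e (KT T) ∧ ContinuousOn e' (KT T) ∧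
    ContinuousOn g' (KT T) ∧ ContinuousOn k' (KT T) ∧
    (∀ t x y, (t, x, y) ∈ KT T → HasDerivAt (fun s => e (s, x, y)) (e' (t, x, y)) t) ∧
    (∀ t x y, (t, x, y) ∈ KT T → HasDerivAt (fun s => g (t, s, y)) (g' (t, x, y)) x) ∧
    (∀ t x y, (t, x, y) ∈ KT T → HasDerivAt (fun s => k (t, x, s)) (k' (t, x, y)) y) ∧
    (∀ t ∈ Set.Icc (0 : ℝ) T, ∀ y ∈ Set.Icc (0 : ℝ) 1, g (t, 2 * π, y) = g (t, 0, y)) ∧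
    (∀ t ∈ Set.Icc (0 : ℝ) T, ∀ x ∈ Set.Icc (0 : ℝ) (2 * π), k (t, x, 1) = k (t, x, 0)) ∧
    (∀ t ∈ Set.Icc (0 : ℝ) T, ∀ x y, (x, y) ∈ Ω →
      e' (t, x, y) + g' (t, x, y) + k' (t, x, y) = R (t, x, y))

lemma Bal.add {T : ℝ} {e R f S : E3 → ℝ} (h1 : Bal T e R) (h2 : Bal T f S) :
    Bal T (fun p => e p + f p) (fun p => R p + S p) := by
  obtain ⟨e', g, g', k, k', c1, c2, c3, c4, d1, d2, d3, p1, p2, hR⟩ := h1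
  obtain ⟨f', l, l', m, m', c1', c2', c3', c4', d1', d2', d3', p1', p2', hR'⟩ := h2
  refine ⟨fun p => e' p + f' p, fun p => g p + l p, fun p => g' p + l' p, fun p => k p + m p,
    fun p => k' p + m' p, c1.add c1', c2.add c2', c3.add c3', c4.add c4',
    fun t x y h => (d1 t x y h).add (d1' t x y h), fun t x y h => (d2 t x y h).add (d2' t x y h),
    fun t x y h => (d3 t x y h).add (d3' t x y h), fun t ht y hy => ?_, fun t ht x hx => ?_,
    fun t ht x y hx => ?_⟩
  · simp only [p1 t ht y hy, p1' t ht y hy]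
  · simp only [p2 t ht x hx, p2' t ht x hx]
  · simp only [← hR t ht x y hx, ← hR' t ht x y hx]; ring

lemma Bal.smul {T : ℝ} {e R : E3 → ℝ} (z : ℝ) (h1 : Bal T e R) :
    Bal T (fun p => z * e p) (fun p => z * R p) := by
  obtain ⟨e', g, g', k, k', c1, c2, c3, c4, d1, d2, d3, p1, p2, hR⟩ := h1
  refine ⟨fun p => z * e' p, fun p => z * g p, fun p => z * g' p, fun p => z * k p,
    fun p => z * k' p, c1.const_mul z, c2.const_mul z, c3.const_mul z, c4.const_mul z,
    fun t x y h => (d1 t x y h).const_mul z, fun t x y h => (d2 t x y h).const_mul z,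
    fun t x y h => (d3 t x y h).const_mul z, fun t ht y hy => ?_, fun t ht x hx => ?_,
    fun t ht x y hx => ?_⟩
  · simp only [p1 t ht y hy]
  · simp only [p2 t ht x hx]
  · simp only [← hR t ht x y hx]; ring

lemma Bal.eq {T : ℝ} {e R : E3 → ℝ} (h1 : Bal T e R) {t : ℝ} (ht : t ∈ Set.Icc 0 T) :
    (∫ x in Ω, e (t, x)) - ∫ x in Ω, e (0, x) = ∫ s in (0 : ℝ)..t, ∫ x in Ω, R (s, x) := by
  obtain ⟨e', g, g', k, k', c1, c2, c3, c4, d1, d2, d3, p1, p2, hR⟩ := h1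
  exact balance c1 c2 c3 c4 d1 d2 d3 p1 p2 (fun t ht x hx => hR t ht x.1 x.2 hx) ht

section
variable {c μ r κ ε T K : ℝ} {τ τ1 : ℝ → ℝ} {a b φ θ : E3 → ℝ}

namespace Sys

lemma τpos (H : Sys c μ r κ ε T K τ τ1 a b φ θ) {y : ℝ} (hy : y ∈ Set.Icc (0 : ℝ) 1) : 0 < τ y := by
  linarith [H.τlo y hy]

lemma hq (H : Sys c μ r κ ε T K τ τ1 a b φ θ) {y : ℝ} (hy : y ∈ Set.Icc (0 : ℝ) 1) :
    HasDerivAt (fun y => (τ y)⁻¹) (-(τ1 y * (τ y)⁻¹ ^ 2)) y := by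
  have := (H.hτ y).inv (H.τpos hy).ne'
  refine HasDerivAt.congr_deriv this ?_
  have := (H.τpos hy).ne'
  field_simp

lemma qlo (H : Sys c μ r κ ε T K τ τ1 a b φ θ) {y : ℝ} (hy : y ∈ Set.Icc (0 : ℝ) 1) :
    1 / 2 ≤ (τ y)⁻¹ := by
  rw [one_div]
  exact inv_anti₀ (H.τpos hy) (H.τhi y hy)

lemma qhi (H : Sys c μ r κ ε T K τ τ1 a b φ θ) {y : ℝ} (hy : y ∈ Set.Icc (0 : ℝ) 1) :
    (τ y)⁻¹ ≤ 2 := by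
  have := inv_anti₀ (by norm_num) (H.τlo y hy)
  norm_num at this
  exact this

lemma ρlo (H : Sys c μ r κ ε T K τ τ1 a b φ θ) {p : E3} (hp : p ∈ KT T) :
    1 / 4 ≤ (τ p.2.2)⁻¹ + φ p := by
  have := H.qlo hp.2.2
  have h2 := abs_le.1 (H.φb p hp)
  linarith [H.hε1]

lemma ρhi (H : Sys c μ r κ ε T K τ τ1 a b φ θ) {p : E3} (hp : p ∈ KT T) :
    (τ p.2.2)⁻¹ + φ p ≤ 3 := by
  have := H.qhi hp.2.2
  have h2 := abs_le.1 (H.φb p hp)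
  linarith [H.hε1]

lemma cτ (H : Sys c μ r κ ε T K τ τ1 a b φ θ) : Continuous τ :=
  continuous_iff_continuousAt.2 fun y => (H.hτ y).continuousAt

lemma cq (H : Sys c μ r κ ε T K τ τ1 a b φ θ) :
    ContinuousOn (fun p : E3 => (τ p.2.2)⁻¹) (KT T) := by
  have := H.cτ
  exact ContinuousOn.inv₀ (Continuous.continuousOn (by fun_prop)) fun p hp => (H.τpos hp.2.2).ne'

lemma cL (H : Sys c μ r κ ε T K τ τ1 a b φ θ) :
    ContinuousOn (fun p : E3 => Real.log ((τ p.2.2)⁻¹ + φ p) + Real.log (τ p.2.2)) (KT T) := by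
  have h1 := H.cτ
  have h2 := H.sφ.continuous
  refine ContinuousOn.add (ContinuousOn.log (H.cq.add h2.continuousOn) fun p hp => ?_)
    (ContinuousOn.log (Continuous.continuousOn (by fun_prop)) fun p hp => (H.τpos hp.2.2).ne')
  have := H.ρlo hp
  linarith

lemma balEnt (H : Sys c μ r κ ε T K τ τ1 a b φ θ) :
    Bal T (fun p => ((τ p.2.2)⁻¹ + φ p) * (Real.log ((τ p.2.2)⁻¹ + φ p) + Real.log (τ p.2.2))
        - ((τ p.2.2)⁻¹ + φ p) + (τ p.2.2)⁻¹)
      (fun p => -(((τ p.2.2)⁻¹ + φ p) * (DD v1 a p + DD v2 b p))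
        + ((τ p.2.2)⁻¹ + φ p) * b p * τ1 p.2.2 * (τ p.2.2)⁻¹) := by
  have hq := H.cq
  have hL := H.cL
  have h1 := H.hτ1
  have ca := H.sa.continuous
  have cb := H.sb.continuous
  have cφ := H.sφ.continuous
  have sa := H.sa
  have sb := H.sb
  have sφ := H.sφ
  generalize hQ : (fun p : E3 => (τ p.2.2)⁻¹) = q at hq
  generalize hLL : (fun p : E3 => Real.log ((τ p.2.2)⁻¹ + φ p) + Real.log (τ p.2.2)) = L at hL
  have hQ' : ∀ p : E3, (τ p.2.2)⁻¹ = q p := fun p => by rw [← hQ]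
  have hL' : ∀ p : E3, Real.log ((τ p.2.2)⁻¹ + φ p) + Real.log (τ p.2.2) = L p :=
    fun p => by rw [← hLL]
  simp only [hL']
  simp only [hQ']
  have ρne : ∀ p ∈ KT T, q p + φ p ≠ 0 := fun p hp => by
    rw [← hQ']; linarith [H.ρlo hp]
  refine ⟨fun p => DD vt φ p * L p,
    fun p => (q p + φ p) * (p.2.2 + a p) * L p - (p.2.2 + a p) * (q p + φ p),
    fun p => (DD v1 φ p * (p.2.2 + a p) + (q p + φ p) * DD v1 a p) * L p
      - DD v1 a p * (q p + φ p),
    fun p => (q p + φ p) * b p * L p - b p * (q p + φ p),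
    fun p => ((-(τ1 p.2.2 * q p ^ 2) + DD v2 φ p) * b p + (q p + φ p) * DD v2 b p) * L p
      + (q p + φ p) * b p * (τ1 p.2.2 * q p) - DD v2 b p * (q p + φ p),
    ?_, ?_, ?_, ?_, ?_, ?_, ?_, ?_, ?_, ?_⟩
  · fun_prop
  · fun_prop
  · fun_prop
  · fun_prop
  · intro t x y hp
    have hφ := (H.sφ.ht t x y).const_add (q (t, x, y))
    have hl : HasDerivAt (fun s => L (s, x, y)) (DD vt φ (t, x, y) / (q (t, x, y) + φ (t, x, y))) t := by
      have := (hφ.log (ρne _ hp)).add_const (Real.log (τ y))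
      simp only [← hLL, ← hQ] at this ⊢
      exact this
    have hρ : HasDerivAt (fun s => q (s, x, y) + φ (s, x, y)) (DD vt φ (t, x, y)) t := by
      simp only [← hQ] at hφ ⊢; exact hφ
    have hqc : HasDerivAt (fun s => q (s, x, y)) 0 t := by
      simp only [← hQ]; exact hasDerivAt_const _ _
    refine HasDerivAt.congr_deriv (((hρ.mul hl).sub hρ).add hqc) ?_
    have := ρne _ hp
    field_simp
    ring
  · intro t x y hp
    have hφ := (H.sφ.h1 t x y).const_add (q (t, x, y))
    have hl : HasDerivAt (fun s => L (t, s, y)) (DD v1 φ (t, x, y) / (q (t, x, y) + φ (t, x, y))) x := by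
      have := (hφ.log (ρne _ hp)).add_const (Real.log (τ y))
      simp only [← hLL, ← hQ] at this ⊢
      exact this
    have hρ : HasDerivAt (fun s => q (t, s, y) + φ (t, s, y)) (DD v1 φ (t, x, y)) x := by
      simp only [← hQ] at hφ ⊢; exact hφ
    have hu := (H.sa.h1 t x y).const_add y
    refine HasDerivAt.congr_deriv (((hρ.mul hu).mul hl).sub (hu.mul hρ)) ?_
    have := ρne _ hp
    simp only [Pi.mul_apply]
    field_simp
    ring
  · intro t x y hp
    have hqd : HasDerivAt (fun s => q (t, x, s)) (-(τ1 y * q (t, x, y) ^ 2)) y := by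
      simp only [← hQ]; exact H.hq hp.2.2
    have hρ := hqd.add (H.sφ.h2 t x y)
    have hl : HasDerivAt (fun s => L (t, x, s)) ((-(τ1 y * q (t, x, y) ^ 2) + DD v2 φ (t, x, y)) / (q (t, x, y) + φ (t, x, y)) + τ1 y / τ y) y := by
      have := (hρ.log (ρne _ hp)).add ((H.hτ y).log (H.τpos hp.2.2).ne')
      simp only [← hLL, ← hQ] at this ⊢
      exact this
    have hbd := (H.sb.h2 t x y)
    refine HasDerivAt.congr_deriv (((hρ.mul hbd).mul hl).sub (hbd.mul hρ)) ?_
    have := ρne _ hp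
    simp only [Pi.mul_apply, Pi.add_apply]
    rw [div_eq_mul_inv (τ1 y), show (τ y)⁻¹ = q (t, x, y) from hQ' (t, x, y)]
    field_simp
    ring
  · intro t ht y hy
    have e1 : q (t, 2 * π, y) = q (t, 0, y) := by simp only [← hQ]
    have e2 : L (t, 2 * π, y) = L (t, 0, y) := by simp only [← hLL, H.pφ.zero]
    simp only [e1, e2, H.pφ.zero, H.pa.zero]
  · intro t ht x hx
    simp only [(H.bb t ht x).1, (H.bb t ht x).2]; ring
  · intro t ht x y hx
    have hm := H.mass t ht x y hx _ rfl
    rw [show (τ y)⁻¹ = q (t, x, y) from hQ' (t, x, y)] at hm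
    dsimp only
    linear_combination (L (t, x, y)) * hm

end Sys
end

section
variable {c μ r κ ε T K : ℝ} {τ τ1 : ℝ → ℝ} {a b φ θ : E3 → ℝ}

namespace Sys

lemma balKin (H : Sys c μ r κ ε T K τ τ1 a b φ θ) :
    Bal T (fun p => 1 / 2 * (((τ p.2.2)⁻¹ + φ p) * (a p * a p + b p * b p) * (τ p.2.2)⁻¹))
      (fun p => -(μ * (DD v1 a p ^ 2 + DD v2 a p ^ 2 + DD v1 b p ^ 2 + DD v2 b p ^ 2) * (τ p.2.2)⁻¹)
        - (μ + r * μ) * (DD v1 a p + DD v2 b p) ^ 2 * (τ p.2.2)⁻¹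
        - ((τ p.2.2)⁻¹ + φ p) * (a p * b p) * (τ p.2.2)⁻¹
        - 1 / 2 * (((τ p.2.2)⁻¹ + φ p) * (a p * a p + b p * b p) * b p * τ1 p.2.2 * (τ p.2.2)⁻¹ ^ 2)
        + (ε ^ 2)⁻¹ * (((τ p.2.2)⁻¹ + φ p) * (τ p.2.2 + θ p) * ((DD v1 a p + DD v2 b p) * (τ p.2.2)⁻¹
          - b p * τ1 p.2.2 * (τ p.2.2)⁻¹ ^ 2))
        + μ * (a p * DD v2 a p + b p * DD v2 b p) * τ1 p.2.2 * (τ p.2.2)⁻¹ ^ 2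
        + (μ + r * μ) * b p * (DD v1 a p + DD v2 b p) * τ1 p.2.2 * (τ p.2.2)⁻¹ ^ 2) := by
  have hq := H.cq
  have h1 := H.hτ1
  have cτ := H.cτ
  have ca := H.sa.continuous
  have cb := H.sb.continuous
  have cφ := H.sφ.continuous
  have cθ := H.sθ.continuous
  have sa := H.sa
  have sb := H.sb
  have sφ := H.sφ
  have sθ := H.sθ
  generalize hQ : (fun p : E3 => (τ p.2.2)⁻¹) = q at hq
  have hQ' : ∀ p : E3, (τ p.2.2)⁻¹ = q p := fun p => by rw [← hQ]
  simp only [hQ']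
  refine ⟨fun p => 1 / 2 * (DD vt φ p * (a p * a p + b p * b p) * q p
      + (q p + φ p) * (2 * a p * DD vt a p + 2 * b p * DD vt b p) * q p),
    fun p => 1 / 2 * ((q p + φ p) * (p.2.2 + a p) * (a p * a p + b p * b p) * q p)
      + (ε ^ 2)⁻¹ * (a p * ((q p + φ p) * (τ p.2.2 + θ p)) * q p)
      - μ * ((a p * DD v1 a p + b p * DD v1 b p) * q p)
      - (μ + r * μ) * (a p * (DD v1 a p + DD v2 b p) * q p),
    fun p => 1 / 2 * (DD v1 φ p * (p.2.2 + a p) * (a p * a p + b p * b p) * q p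
        + (q p + φ p) * DD v1 a p * (a p * a p + b p * b p) * q p
        + (q p + φ p) * (p.2.2 + a p) * (2 * a p * DD v1 a p + 2 * b p * DD v1 b p) * q p)
      + (ε ^ 2)⁻¹ * (DD v1 a p * ((q p + φ p) * (τ p.2.2 + θ p)) * q p
        + a p * (DD v1 φ p * (τ p.2.2 + θ p) + (q p + φ p) * DD v1 θ p) * q p)
      - μ * ((DD v1 a p ^ 2 + DD v1 b p ^ 2 + a p * DD v1 (DD v1 a) p + b p * DD v1 (DD v1 b) p) * q p)
      - (μ + r * μ) * ((DD v1 a p * (DD v1 a p + DD v2 b p)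
        + a p * (DD v1 (DD v1 a) p + DD v1 (DD v2 b) p)) * q p),
    fun p => 1 / 2 * ((q p + φ p) * b p * (a p * a p + b p * b p) * q p)
      + (ε ^ 2)⁻¹ * (b p * ((q p + φ p) * (τ p.2.2 + θ p)) * q p)
      - μ * ((a p * DD v2 a p + b p * DD v2 b p) * q p)
      - (μ + r * μ) * (b p * (DD v1 a p + DD v2 b p) * q p),
    fun p => 1 / 2 * ((-(τ1 p.2.2 * q p ^ 2) + DD v2 φ p) * b p * (a p * a p + b p * b p) * q p
        + (q p + φ p) * DD v2 b p * (a p * a p + b p * b p) * q p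
        + (q p + φ p) * b p * (2 * a p * DD v2 a p + 2 * b p * DD v2 b p) * q p
        + (q p + φ p) * b p * (a p * a p + b p * b p) * (-(τ1 p.2.2 * q p ^ 2)))
      + (ε ^ 2)⁻¹ * (DD v2 b p * ((q p + φ p) * (τ p.2.2 + θ p)) * q p
        + b p * ((-(τ1 p.2.2 * q p ^ 2) + DD v2 φ p) * (τ p.2.2 + θ p)
          + (q p + φ p) * (τ1 p.2.2 + DD v2 θ p)) * q p
        + b p * ((q p + φ p) * (τ p.2.2 + θ p)) * (-(τ1 p.2.2 * q p ^ 2)))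
      - μ * ((DD v2 a p ^ 2 + DD v2 b p ^ 2 + a p * DD v2 (DD v2 a) p + b p * DD v2 (DD v2 b) p) * q p
        + (a p * DD v2 a p + b p * DD v2 b p) * (-(τ1 p.2.2 * q p ^ 2)))
      - (μ + r * μ) * ((DD v2 b p * (DD v1 a p + DD v2 b p)
        + b p * (DD v2 (DD v1 a) p + DD v2 (DD v2 b) p)) * q p
        + b p * (DD v1 a p + DD v2 b p) * (-(τ1 p.2.2 * q p ^ 2))),
    ?_, ?_, ?_, ?_, ?_, ?_, ?_, ?_, ?_, ?_⟩
  · fun_prop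
  · fun_prop
  · fun_prop
  · fun_prop
  · intro t x y hp
    have hqc : HasDerivAt (fun s => q (s, x, y)) 0 t := by
      simp only [← hQ]; exact hasDerivAt_const _ _
    have hρ := hqc.add (H.sφ.ht t x y)
    have ha := H.sa.ht t x y
    have hb := H.sb.ht t x y
    refine HasDerivAt.congr_deriv
      (((hρ.mul ((ha.mul ha).add (hb.mul hb))).mul hqc).const_mul (1 / 2)) ?_
    simp only [Pi.mul_apply, Pi.add_apply]
    ring
  · intro t x y hp
    have hqc : HasDerivAt (fun s => q (t, s, y)) 0 x := by
      simp only [← hQ]; exact hasDerivAt_const _ _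
    have hρ := hqc.add (H.sφ.h1 t x y)
    have ha := H.sa.h1 t x y
    have hb := H.sb.h1 t x y
    have hθ := (H.sθ.h1 t x y).const_add (τ y)
    have ha1 := (H.sa.dd v1).h1 t x y
    have hb1 := (H.sb.dd v1).h1 t x y
    have hb2 := (H.sb.dd v2).h1 t x y
    have hu := ha.const_add y
    refine HasDerivAt.congr_deriv
      ((((((hρ.mul hu).mul ((ha.mul ha).add (hb.mul hb))).mul hqc).const_mul (1 / 2)).add
        (((ha.mul (hρ.mul hθ)).mul hqc).const_mul ((ε ^ 2)⁻¹))).sub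
        ((((ha.mul ha1).add (hb.mul hb1)).mul hqc).const_mul μ) |>.sub
        (((ha.mul (ha1.add hb2)).mul hqc).const_mul (μ + r * μ))) ?_
    simp only [Pi.mul_apply, Pi.add_apply]
    ring
  · intro t x y hp
    have hqc : HasDerivAt (fun s => q (t, x, s)) (-(τ1 y * q (t, x, y) ^ 2)) y := by
      simp only [← hQ]; exact H.hq hp.2.2
    have hρ := hqc.add (H.sφ.h2 t x y)
    have ha := H.sa.h2 t x y
    have hb := H.sb.h2 t x y
    have hθ := (H.hτ y).add (H.sθ.h2 t x y)
    have ha1 := (H.sa.dd v1).h2 t x y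
    have ha2 := (H.sa.dd v2).h2 t x y
    have hb2 := (H.sb.dd v2).h2 t x y
    refine HasDerivAt.congr_deriv
      ((((((hρ.mul hb).mul ((ha.mul ha).add (hb.mul hb))).mul hqc).const_mul (1 / 2)).add
        (((hb.mul (hρ.mul hθ)).mul hqc).const_mul ((ε ^ 2)⁻¹))).sub
        ((((ha.mul ha2).add (hb.mul hb2)).mul hqc).const_mul μ) |>.sub
        (((hb.mul (ha1.add hb2)).mul hqc).const_mul (μ + r * μ))) ?_
    simp only [Pi.mul_apply, Pi.add_apply]
    ring
  · intro t ht y hy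
    have e1 : q (t, 2 * π, y) = q (t, 0, y) := by simp only [← hQ]
    simp only [e1, H.pφ.zero, H.pa.zero, H.pb.zero, H.pθ.zero, (H.pa.dd v1).zero,
      (H.pb.dd v1).zero, (H.pb.dd v2).zero]
  · intro t ht x hx
    simp only [(H.bb t ht x).1, (H.bb t ht x).2, (H.ba t ht x).1, (H.ba t ht x).2]; ring
  · intro t ht x y hx
    have hm := H.mass t ht x y hx _ rfl
    have hm1 := H.mom1 t ht x y hx _ rfl
    have hm2 := H.mom2 t ht x y hx _ rfl
    rw [show (τ y)⁻¹ = q (t, x, y) from hQ' (t, x, y)] at hm hm1 hm2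
    dsimp only
    generalize q (t, x, y) = Q at *
    generalize (ε ^ 2)⁻¹ = z at *
    linear_combination (1 / 2 * (a (t, x, y) * a (t, x, y) + b (t, x, y) * b (t, x, y)) * Q) * hm
      + a (t, x, y) * Q * hm1 + b (t, x, y) * Q * hm2

lemma balTh (H : Sys c μ r κ ε T K τ τ1 a b φ θ) :
    Bal T (fun p => 1 / 2 * (c * ((τ p.2.2)⁻¹ + φ p) * (θ p * θ p) * ((τ p.2.2)⁻¹ * (τ p.2.2)⁻¹)))
      (fun p => -(κ * (DD v1 θ p ^ 2 + DD v2 θ p ^ 2) * (τ p.2.2)⁻¹ ^ 2)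
        + 2 * κ * θ p * DD v2 θ p * τ1 p.2.2 * (τ p.2.2)⁻¹ ^ 3
        - c * ((τ p.2.2)⁻¹ + φ p) * θ p ^ 2 * b p * τ1 p.2.2 * (τ p.2.2)⁻¹ ^ 3
        - c * ((τ p.2.2)⁻¹ + φ p) * θ p * b p * τ1 p.2.2 * (τ p.2.2)⁻¹ ^ 2
        - ((τ p.2.2)⁻¹ + φ p) * (τ p.2.2 + θ p) * θ p * (DD v1 a p + DD v2 b p) * (τ p.2.2)⁻¹ ^ 2
        + ε ^ 2 * (2 * μ * (DD v1 a p ^ 2 + DD v2 b p ^ 2 + (DD v1 b p + DD v2 a p) ^ 2 / 2)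
        + 4 * μ * ((DD v1 b p + DD v2 a p) / 2) + r * μ * (DD v1 a p + DD v2 b p) ^ 2)
          * θ p * (τ p.2.2)⁻¹ ^ 2) := by
  have hq := H.cq
  have h1 := H.hτ1
  have cτ := H.cτ
  have ca := H.sa.continuous
  have cb := H.sb.continuous
  have cφ := H.sφ.continuous
  have cθ := H.sθ.continuous
  have sa := H.sa
  have sb := H.sb
  have sφ := H.sφ
  have sθ := H.sθ
  generalize hQ : (fun p : E3 => (τ p.2.2)⁻¹) = q at hq
  have hQ' : ∀ p : E3, (τ p.2.2)⁻¹ = q p := fun p => by rw [← hQ]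
  simp only [hQ']
  refine ⟨fun p => 1 / 2 * (c * DD vt φ p * (θ p * θ p) * (q p * q p)
      + c * (q p + φ p) * (2 * θ p * DD vt θ p) * (q p * q p)),
    fun p => 1 / 2 * (c * ((q p + φ p) * (p.2.2 + a p)) * (θ p * θ p) * (q p * q p))
      - κ * (θ p * DD v1 θ p * (q p * q p)),
    fun p => 1 / 2 * (c * (DD v1 φ p * (p.2.2 + a p) + (q p + φ p) * DD v1 a p) * (θ p * θ p) * (q p * q p)
        + c * ((q p + φ p) * (p.2.2 + a p)) * (2 * θ p * DD v1 θ p) * (q p * q p))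
      - κ * ((DD v1 θ p ^ 2 + θ p * DD v1 (DD v1 θ) p) * (q p * q p)),
    fun p => 1 / 2 * (c * ((q p + φ p) * b p) * (θ p * θ p) * (q p * q p))
      - κ * (θ p * DD v2 θ p * (q p * q p)),
    fun p => 1 / 2 * (c * ((-(τ1 p.2.2 * q p ^ 2) + DD v2 φ p) * b p + (q p + φ p) * DD v2 b p) * (θ p * θ p) * (q p * q p)
        + c * ((q p + φ p) * b p) * (2 * θ p * DD v2 θ p) * (q p * q p)
        + c * ((q p + φ p) * b p) * (θ p * θ p) * (2 * q p * (-(τ1 p.2.2 * q p ^ 2))))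
      - κ * ((DD v2 θ p ^ 2 + θ p * DD v2 (DD v2 θ) p) * (q p * q p)
        + θ p * DD v2 θ p * (2 * q p * (-(τ1 p.2.2 * q p ^ 2)))),
    ?_, ?_, ?_, ?_, ?_, ?_, ?_, ?_, ?_, ?_⟩
  · fun_prop
  · fun_prop
  · fun_prop
  · fun_prop
  · intro t x y hp
    have hqc : HasDerivAt (fun s => q (s, x, y)) 0 t := by
      simp only [← hQ]; exact hasDerivAt_const _ _
    have hρ := hqc.add (H.sφ.ht t x y)
    have hθ := H.sθ.ht t x y
    refine HasDerivAt.congr_deriv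
      ((((hρ.const_mul c).mul (hθ.mul hθ)).mul (hqc.mul hqc)).const_mul (1 / 2)) ?_
    simp only [Pi.mul_apply, Pi.add_apply]
    ring
  · intro t x y hp
    have hqc : HasDerivAt (fun s => q (t, s, y)) 0 x := by
      simp only [← hQ]; exact hasDerivAt_const _ _
    have hρ := hqc.add (H.sφ.h1 t x y)
    have hu := (H.sa.h1 t x y).const_add y
    have hθ := (H.sθ.h1 t x y)
    have hθ1 := (H.sθ.dd v1).h1 t x y
    refine HasDerivAt.congr_deriv
      (((((hρ.mul hu).const_mul c).mul (hθ.mul hθ)).mul (hqc.mul hqc)).const_mul (1 / 2) |>.sub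
        (((hθ.mul hθ1).mul (hqc.mul hqc)).const_mul κ)) ?_
    simp only [Pi.mul_apply, Pi.add_apply]
    ring
  · intro t x y hp
    have hqc : HasDerivAt (fun s => q (t, x, s)) (-(τ1 y * q (t, x, y) ^ 2)) y := by
      simp only [← hQ]; exact H.hq hp.2.2
    have hρ := hqc.add (H.sφ.h2 t x y)
    have hb := H.sb.h2 t x y
    have hθ := (H.sθ.h2 t x y)
    have hθ2 := (H.sθ.dd v2).h2 t x y
    refine HasDerivAt.congr_deriv
      (((((hρ.mul hb).const_mul c).mul (hθ.mul hθ)).mul (hqc.mul hqc)).const_mul (1 / 2) |>.sub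
        (((hθ.mul hθ2).mul (hqc.mul hqc)).const_mul κ)) ?_
    simp only [Pi.mul_apply, Pi.add_apply]
    ring
  · intro t ht y hy
    have e1 : q (t, 2 * π, y) = q (t, 0, y) := by simp only [← hQ]
    simp only [e1, H.pφ.zero, H.pa.zero, H.pθ.zero, (H.pθ.dd v1).zero]
  · intro t ht x hx
    simp only [(H.bθ t ht x).1, (H.bθ t ht x).2]; ring
  · intro t ht x y hx
    have hm := H.mass t ht x y hx _ rfl
    have hm1 := H.energy t ht x y hx _ rfl
    rw [show (τ y)⁻¹ = q (t, x, y) from hQ' (t, x, y)] at hm hm1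
    dsimp only
    generalize q (t, x, y) = Q at *
    linear_combination (1 / 2 * c * θ (t, x, y) ^ 2 * Q ^ 2) * hm + θ (t, x, y) * Q ^ 2 * hm1

lemma balGrad (H : Sys c μ r κ ε T K τ τ1 a b φ θ) :
    Bal T (fun p => 1 / 2 * (DD v1 θ p * DD v1 θ p + DD v2 θ p * DD v2 θ p))
      (fun p => - (DD vt θ p * (DD v1 (DD v1 θ) p + DD v2 (DD v2 θ) p))) := by
  have cθ := H.sθ.continuous
  have sθ := H.sθ
  have bt := H.bθ.dt H.hT H.sθ
  refine ⟨fun p => DD v1 θ p * DD v1 (DD vt θ) p + DD v2 θ p * DD v2 (DD vt θ) p,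
    fun p => - (DD vt θ p * DD v1 θ p),
    fun p => - (DD v1 (DD vt θ) p * DD v1 θ p + DD vt θ p * DD v1 (DD v1 θ) p),
    fun p => - (DD vt θ p * DD v2 θ p),
    fun p => - (DD v2 (DD vt θ) p * DD v2 θ p + DD vt θ p * DD v2 (DD v2 θ) p),
    ?_, ?_, ?_, ?_, ?_, ?_, ?_, ?_, ?_, ?_⟩
  · fun_prop
  · fun_prop
  · fun_prop
  · fun_prop
  · intro t x y hp
    have h1 := (sθ.dd v1).ht t x y
    have h2 := (sθ.dd v2).ht t x y
    rw [sθ.dd_comm] at h1 h2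
    refine HasDerivAt.congr_deriv (((h1.mul h1).add (h2.mul h2)).const_mul (1 / 2)) ?_
    ring
  · intro t x y hp
    exact (((sθ.dd vt).h1 t x y).mul ((sθ.dd v1).h1 t x y)).neg
  · intro t x y hp
    exact (((sθ.dd vt).h2 t x y).mul ((sθ.dd v2).h2 t x y)).neg
  · intro t ht y hy
    simp only [(H.pθ.dd v1).zero, (H.pθ.dd vt).zero]
  · intro t ht x hx
    simp only [(bt t ht x).1, (bt t ht x).2]; ring
  · intro t ht x y hx
    ring

end Sys
end

/-! ### First energy estimate -/

lemma absmul {x y X Y : ℝ} (hx : |x| ≤ X) (hy : |y| ≤ Y) : |x * y| ≤ X * Y := by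
  rw [abs_mul]
  exact mul_le_mul hx hy (abs_nonneg _) ((abs_nonneg _).trans hx)

/-- Coefficients of the error terms. -/
def cW (c μ r ε K : ℝ) : ℝ := 3 + 18 * K * ε + 2 * μ * K * ε + 2 * (μ + r * μ) * K * ε + 6 * (1 + c) * K
def cK (μ r ε K : ℝ) : ℝ :=
  2 * μ * K * ε + 4 * (μ + r * μ) * K * ε + 36 + 24 * μ * ε + 24 * |r| * μ * ε + 8 * μ * ε
def cV (c μ κ ε K : ℝ) : ℝ :=
  6 * (1 + c) * K + 72 * c * K * ε + 18 + 8 * κ * K * ε + 4 * μ * ε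
def cZ (κ ε K : ℝ) : ℝ := 8 * κ * K * ε

set_option maxHeartbeats 1000000 in
lemma ptw1 {c μ r κ ε K ρ q g a b s a1 a2 b1 b2 z1 z2 : ℝ}
    (hε : 0 < ε) (hc : 0 < c) (hμ : 0 < μ) (hr : 0 < 1 + r) (hκ : 0 < κ) (hK : 0 < K)
    (hρ : |ρ| ≤ 3) (hq : |q| ≤ 2) (hq0 : 1 / 2 ≤ q) (hg : |g| ≤ K) (hb : |b| ≤ 3) (hs : |s| ≤ 3) :
    -(μ * (a1 ^ 2 + a2 ^ 2 + b1 ^ 2 + b2 ^ 2) * q) - (μ + r * μ) * (a1 + b2) ^ 2 * q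
      - κ * (z1 ^ 2 + z2 ^ 2) * q ^ 2
      - ρ * (a * b) * q - 1 / 2 * (ρ * (a * a + b * b) * b * (ε * g) * q ^ 2)
      + μ * (a * a2 + b * b2) * (ε * g) * q ^ 2 + (μ + r * μ) * b * (a1 + b2) * (ε * g) * q ^ 2
      - (1 + c) * ρ * s * b * g * q ^ 2 - c * ρ * s ^ 2 * b * (ε * g) * q ^ 3
      - ρ * s ^ 2 * (a1 + b2) * q ^ 2 + 2 * κ * s * z2 * (ε * g) * q ^ 3
      + (2 * μ * (a1 ^ 2 + b2 ^ 2 + (b1 + a2) ^ 2 / 2)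
        + 4 * μ * ((b1 + a2) / 2) + r * μ * (a1 + b2) ^ 2) * (ε * s) * q ^ 2
    ≤ -(μ / 2 * (a1 ^ 2 + a2 ^ 2 + b1 ^ 2 + b2 ^ 2)) - κ / 4 * (z1 ^ 2 + z2 ^ 2)
      + cW c μ r ε K * (a ^ 2 + b ^ 2) + cK μ r ε K * (a1 ^ 2 + a2 ^ 2 + b1 ^ 2 + b2 ^ 2)
      + cV c μ κ ε K * s ^ 2 + cZ κ ε K * (z1 ^ 2 + z2 ^ 2) := by
  have w3 : a2 ^ 2 + b2 ^ 2 ≤ a1 ^ 2 + a2 ^ 2 + b1 ^ 2 + b2 ^ 2 := by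
    linarith only [sq_nonneg a1, sq_nonneg b1]
  have w9 : z2 ^ 2 ≤ z1 ^ 2 + z2 ^ 2 := by linarith only [sq_nonneg z1]
  have w10 : a1 ^ 2 + b2 ^ 2 + (b1 + a2) ^ 2 / 2 ≤ a1 ^ 2 + a2 ^ 2 + b1 ^ 2 + b2 ^ 2 := by
    linarith only [sq_nonneg (b1 - a2)]
  have hl : 0 < μ + r * μ := by
    have := mul_pos hr hμ
    linarith only [this]
  have q2 : |q ^ 2| ≤ 4 := by have := absmul hq hq; rw [pow_two]; linarith
  have q3 : |q ^ 3| ≤ 8 := by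
    have := absmul q2 hq; rw [show q ^ 3 = q ^ 2 * q by ring]; linarith
  have eε : |ε| ≤ ε := (abs_of_pos hε).le
  have eμ : |μ| ≤ μ := (abs_of_pos hμ).le
  have eκ : |κ| ≤ κ := (abs_of_pos hκ).le
  have ec : |c| ≤ c := (abs_of_pos hc).le
  have ec1 : |1 + c| ≤ 1 + c := (abs_of_pos (by linarith)).le
  have el : |μ + r * μ| ≤ μ + r * μ := (abs_of_pos hl).le
  have yg : ∀ x y : ℝ, |x * y| ≤ (x ^ 2 + y ^ 2) / 2 := fun x y => by
    rw [abs_le]; constructor <;> nlinarith [sq_nonneg (x + y), sq_nonneg (x - y)]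
  have kdiv : (a1 + b2) ^ 2 ≤ 2 * (a1 ^ 2 + a2 ^ 2 + b1 ^ 2 + b2 ^ 2) := by
    linarith only [sq_nonneg (a1 - b2), sq_nonneg a2, sq_nonneg b1]
  have kdef : (b1 + a2) ^ 2 ≤ 2 * (a1 ^ 2 + a2 ^ 2 + b1 ^ 2 + b2 ^ 2) := by
    linarith only [sq_nonneg (b1 - a2), sq_nonneg a1, sq_nonneg b2]
  have D1 : μ / 2 * (a1 ^ 2 + a2 ^ 2 + b1 ^ 2 + b2 ^ 2)
      ≤ μ * (a1 ^ 2 + a2 ^ 2 + b1 ^ 2 + b2 ^ 2) * q := by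
    have h : 0 ≤ μ * (a1 ^ 2 + a2 ^ 2 + b1 ^ 2 + b2 ^ 2) := by positivity
    linarith [mul_le_mul_of_nonneg_left hq0 h]
  have D2 : 0 ≤ (μ + r * μ) * (a1 + b2) ^ 2 * q := by
    have : 0 ≤ q := by linarith
    positivity
  have D3 : κ / 4 * (z1 ^ 2 + z2 ^ 2) ≤ κ * (z1 ^ 2 + z2 ^ 2) * q ^ 2 := by
    have h : 0 ≤ κ * (z1 ^ 2 + z2 ^ 2) := by positivity
    have h1 : 1 / 4 ≤ q ^ 2 := by
      have := mul_self_le_mul_self (by norm_num) hq0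
      linarith
    linarith [mul_le_mul_of_nonneg_left h1 h]
  have t1 := absmul (absmul hρ hq) (yg a b)
  have t2 := absmul (absmul (absmul (absmul hρ hb) (absmul eε hg)) q2)
    (abs_of_nonneg (by positivity : 0 ≤ a ^ 2 + b ^ 2)).le
  have t3 := absmul (absmul (absmul eμ (absmul eε hg)) q2) (yg a a2)
  have t3' := absmul (absmul (absmul eμ (absmul eε hg)) q2) (yg b b2)
  have t4 := absmul (absmul (absmul el (absmul eε hg)) q2) (yg b (a1 + b2))
  have t5 := absmul (absmul (absmul (absmul ec1 hρ) hg) q2) (yg s b)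
  have t6 := absmul (absmul (absmul (absmul (absmul ec hρ) hb) (absmul eε hg)) q3)
    (abs_of_nonneg (by positivity : 0 ≤ s ^ 2)).le
  have t8 := absmul (absmul (absmul hρ hs) q2) (yg s (a1 + b2))
  have t9 := absmul (absmul (absmul eκ (absmul eε hg)) q3) (yg s z2)
  have t10 := absmul (absmul (absmul (absmul eμ eε) hs) q2)
    (abs_of_nonneg (by positivity : 0 ≤ a1 ^ 2 + b2 ^ 2 + (b1 + a2) ^ 2 / 2)).le
  have t11 := absmul (absmul (absmul (absmul (absmul (le_refl |r|) eμ) eε) hs) q2)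
    (abs_of_nonneg (by positivity : 0 ≤ (a1 + b2) ^ 2)).le
  have t12 := absmul (absmul (absmul eμ eε) q2) (yg s (b1 + a2))
  have hKe : 0 < K * ε := by positivity
  have u4 : 2 * (μ + r * μ) * (K * ε) * (a1 + b2) ^ 2
     ≤ 2 * (μ + r * μ) * (K * ε) * (2 * (a1 ^ 2 + a2 ^ 2 + b1 ^ 2 + b2 ^ 2)) :=
    mul_le_mul_of_nonneg_left kdiv (by positivity)
  have u3 : 2 * (μ * (K * ε)) * (a2 ^ 2 + b2 ^ 2)
     ≤ 2 * (μ * (K * ε)) * (a1 ^ 2 + a2 ^ 2 + b1 ^ 2 + b2 ^ 2) :=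
    mul_le_mul_of_nonneg_left w3 (by positivity)
  have u9 : 8 * (κ * (K * ε)) * (z2 ^ 2) ≤ 8 * (κ * (K * ε)) * (z1 ^ 2 + z2 ^ 2) :=
    mul_le_mul_of_nonneg_left w9 (by positivity)
  have u10 : 24 * (μ * ε) * (a1 ^ 2 + b2 ^ 2 + (b1 + a2) ^ 2 / 2)
     ≤ 24 * (μ * ε) * (a1 ^ 2 + a2 ^ 2 + b1 ^ 2 + b2 ^ 2) :=
    mul_le_mul_of_nonneg_left w10 (by positivity)
  have u11 : 12 * (|r| * μ * ε) * (a1 + b2) ^ 2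
     ≤ 12 * (|r| * μ * ε) * (2 * (a1 ^ 2 + a2 ^ 2 + b1 ^ 2 + b2 ^ 2)) :=
    mul_le_mul_of_nonneg_left kdiv (by positivity)
  have u12 : 4 * (μ * ε) * (b1 + a2) ^ 2
     ≤ 4 * (μ * ε) * (2 * (a1 ^ 2 + a2 ^ 2 + b1 ^ 2 + b2 ^ 2)) :=
    mul_le_mul_of_nonneg_left kdef (by positivity)
  have s1 := (abs_le.1 t1).1
  have s2 := (abs_le.1 t2).1
  have s3 := (abs_le.1 t3).2
  have s3' := (abs_le.1 t3').2
  have s4 := (abs_le.1 t4).2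
  have s5 := (abs_le.1 t5).1
  have s6 := (abs_le.1 t6).1
  have s8 := (abs_le.1 t8).1
  have s9 := (abs_le.1 t9).2
  have s10 := (abs_le.1 t10).2
  have s11 := (abs_le.1 t11).2
  have s12 := (abs_le.1 t12).2
  have x1 : 0 ≤ 2 * (μ + r * μ) * (K * ε) * a ^ 2 := by positivity
  have x2 : 0 ≤ 6 * (1 + c) * K * a ^ 2 := by positivity
  unfold cW cK cV cZ
  clear t1 t2 t3 t3' t4 t5 t6 t8 t9 t10 t11 t12
  linear_combination s1 + s2 / 2 + s3 + s3' + s4 + s5 + s6 + s8 + 2 * s9 + 2 * s10 + s11 + 2 * s12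
    + 18 * kdiv + x1 + x2 + D1 + D2 + D3 + u3 + u4 + u9 + u10 + u11 + u12

section
variable {c μ r κ ε T K : ℝ} {τ τ1 : ℝ → ℝ} {a b φ θ : E3 → ℝ}

/-- `|∇ψ|²` -/
def kk (a b : E3 → ℝ) (p : E3) : ℝ := DD v1 a p ^ 2 + DD v2 a p ^ 2 + DD v1 b p ^ 2 + DD v2 b p ^ 2
/-- `|∇θ|²` -/
def gg (θ : E3 → ℝ) (p : E3) : ℝ := DD v1 θ p ^ 2 + DD v2 θ p ^ 2

lemma cont_kk (ha : Sm a) (hb : Sm b) : Continuous (kk a b) := by unfold kk; fun_prop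
lemma cont_gg (ha : Sm θ) : Continuous (gg θ) := by unfold gg; fun_prop

lemma KT_Ω {t : ℝ} {x : ℝ × ℝ} (ht : t ∈ Set.Icc 0 T) (hx : x ∈ Ω) : ((t, x) : E3) ∈ KT T :=
  ⟨ht, Ω_sub hx⟩

namespace Sys

/-- The full energy density. -/
def eng (c ε : ℝ) (τ : ℝ → ℝ) (a b φ θ : E3 → ℝ) (p : E3) : ℝ :=
  1 / 2 * (((τ p.2.2)⁻¹ + φ p) * (a p * a p + b p * b p) * (τ p.2.2)⁻¹)
  + (ε ^ 2)⁻¹ * ((((τ p.2.2)⁻¹ + φ p) * (Real.log ((τ p.2.2)⁻¹ + φ p) + Real.log (τ p.2.2))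
        - ((τ p.2.2)⁻¹ + φ p) + (τ p.2.2)⁻¹)
     + 1 / 2 * (c * ((τ p.2.2)⁻¹ + φ p) * (θ p * θ p) * ((τ p.2.2)⁻¹ * (τ p.2.2)⁻¹)))

lemma ent_nonneg {ρ t : ℝ} (hρ : 0 < ρ) (ht : 0 < t) :
    0 ≤ ρ * (Real.log ρ + Real.log t) - ρ + t⁻¹ := by
  have h := Real.one_sub_inv_le_log_of_pos (mul_pos hρ ht)
  rw [Real.log_mul hρ.ne' ht.ne'] at h
  have h2 := mul_le_mul_of_nonneg_left h hρ.le
  have : ρ * (1 - (ρ * t)⁻¹) = ρ - t⁻¹ := by field_simp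
  linarith

lemma ent_le {ρ t : ℝ} (hρ : 0 < ρ) (ht : 0 < t) :
    ρ * (Real.log ρ + Real.log t) - ρ + t⁻¹ ≤ t * (ρ - t⁻¹) ^ 2 := by
  have h := Real.log_le_sub_one_of_pos (mul_pos hρ ht)
  rw [Real.log_mul hρ.ne' ht.ne'] at h
  have h2 := mul_le_mul_of_nonneg_left h hρ.le
  have : t * (ρ - t⁻¹) ^ 2 = ρ * (ρ * t - 1) - ρ + t⁻¹ := by field_simp; ring
  linarith

lemma eng_nonneg (H : Sys c μ r κ ε T K τ τ1 a b φ θ) {p : E3} (hp : p ∈ KT T) :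
    0 ≤ eng c ε τ a b φ θ p := by
  have h1 := H.ρlo hp
  have h2 := H.τpos hp.2.2
  have h3 : 0 < (τ p.2.2)⁻¹ + φ p := by linarith
  have h4 := ent_nonneg h3 h2
  have := H.hc
  unfold eng
  have : 0 ≤ a p * a p + b p * b p := by nlinarith
  have : 0 ≤ θ p * θ p := by nlinarith
  positivity

lemma eng_le (H : Sys c μ r κ ε T K τ τ1 a b φ θ) {p : E3} (hp : p ∈ KT T) :
    eng c ε τ a b φ θ p
      ≤ 3 * (a p ^ 2 + b p ^ 2) + (ε ^ 2)⁻¹ * (2 * φ p ^ 2 + 6 * c * θ p ^ 2) := by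
  have h1 := H.ρlo hp
  have h1' := H.ρhi hp
  have h2 := H.τpos hp.2.2
  have h2' := H.τhi _ hp.2.2
  have h5 := H.qhi hp.2.2
  have h3 : 0 < (τ p.2.2)⁻¹ + φ p := by linarith
  have h4 := ent_le h3 h2
  have hc := H.hc
  have hε := H.hε
  unfold eng
  have e1 : τ p.2.2 * ((τ p.2.2)⁻¹ + φ p - (τ p.2.2)⁻¹) ^ 2 ≤ 2 * φ p ^ 2 := by
    rw [add_sub_cancel_left]
    exact mul_le_mul_of_nonneg_right h2' (sq_nonneg _)
  have hq : 0 < (τ p.2.2)⁻¹ := by positivity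
  have e2 : ((τ p.2.2)⁻¹ + φ p) * (a p * a p + b p * b p) * (τ p.2.2)⁻¹
      ≤ 3 * (a p * a p + b p * b p) * 2 := by
    have : 0 ≤ a p * a p + b p * b p := by nlinarith
    gcongr
  have e3 : c * ((τ p.2.2)⁻¹ + φ p) * (θ p * θ p) * ((τ p.2.2)⁻¹ * (τ p.2.2)⁻¹)
      ≤ c * 3 * (θ p * θ p) * (2 * 2) := by
    have : 0 ≤ θ p * θ p := by nlinarith
    gcongr
  have e4 : 0 < (ε ^ 2)⁻¹ := by positivity
  have e5 := mul_le_mul_of_nonneg_left (h4.trans e1) e4.le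
  have e6 := mul_le_mul_of_nonneg_left e3 e4.le
  linear_combination e5 + e6 / 2 + e2 / 2

/-- Total source term. -/
def src (c μ r κ ε : ℝ) (τ τ1 : ℝ → ℝ) (a b φ θ : E3 → ℝ) (p : E3) : ℝ :=
  -(μ * (DD v1 a p ^ 2 + DD v2 a p ^ 2 + DD v1 b p ^ 2 + DD v2 b p ^ 2) * (τ p.2.2)⁻¹)
        - (μ + r * μ) * (DD v1 a p + DD v2 b p) ^ 2 * (τ p.2.2)⁻¹
        - ((τ p.2.2)⁻¹ + φ p) * (a p * b p) * (τ p.2.2)⁻¹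
        - 1 / 2 * (((τ p.2.2)⁻¹ + φ p) * (a p * a p + b p * b p) * b p * τ1 p.2.2 * (τ p.2.2)⁻¹ ^ 2)
        + (ε ^ 2)⁻¹ * (((τ p.2.2)⁻¹ + φ p) * (τ p.2.2 + θ p) * ((DD v1 a p + DD v2 b p) * (τ p.2.2)⁻¹
          - b p * τ1 p.2.2 * (τ p.2.2)⁻¹ ^ 2))
        + μ * (a p * DD v2 a p + b p * DD v2 b p) * τ1 p.2.2 * (τ p.2.2)⁻¹ ^ 2
        + (μ + r * μ) * b p * (DD v1 a p + DD v2 b p) * τ1 p.2.2 * (τ p.2.2)⁻¹ ^ 2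
  + (ε ^ 2)⁻¹ * ((-(((τ p.2.2)⁻¹ + φ p) * (DD v1 a p + DD v2 b p))
        + ((τ p.2.2)⁻¹ + φ p) * b p * τ1 p.2.2 * (τ p.2.2)⁻¹)
    + (-(κ * (DD v1 θ p ^ 2 + DD v2 θ p ^ 2) * (τ p.2.2)⁻¹ ^ 2)
        + 2 * κ * θ p * DD v2 θ p * τ1 p.2.2 * (τ p.2.2)⁻¹ ^ 3
        - c * ((τ p.2.2)⁻¹ + φ p) * θ p ^ 2 * b p * τ1 p.2.2 * (τ p.2.2)⁻¹ ^ 3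
        - c * ((τ p.2.2)⁻¹ + φ p) * θ p * b p * τ1 p.2.2 * (τ p.2.2)⁻¹ ^ 2
        - ((τ p.2.2)⁻¹ + φ p) * (τ p.2.2 + θ p) * θ p * (DD v1 a p + DD v2 b p) * (τ p.2.2)⁻¹ ^ 2
        + ε ^ 2 * (2 * μ * (DD v1 a p ^ 2 + DD v2 b p ^ 2 + (DD v1 b p + DD v2 a p) ^ 2 / 2)
        + 4 * μ * ((DD v1 b p + DD v2 a p) / 2) + r * μ * (DD v1 a p + DD v2 b p) ^ 2)
          * θ p * (τ p.2.2)⁻¹ ^ 2))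

lemma balEng (H : Sys c μ r κ ε T K τ τ1 a b φ θ) :
    Bal T (eng c ε τ a b φ θ) (src c μ r κ ε τ τ1 a b φ θ) :=
  H.balKin.add ((H.balEnt.add H.balTh).smul (ε ^ 2)⁻¹)

lemma src_le (H : Sys c μ r κ ε T K τ τ1 a b φ θ) {p : E3} (hp : p ∈ KT T) :
    src c μ r κ ε τ τ1 a b φ θ p ≤
      -(μ / 2 * kk a b p) - κ / 4 * ((ε ^ 2)⁻¹ * gg θ p) + cW c μ r ε K * (a p ^ 2 + b p ^ 2)
      + cK μ r ε K * kk a b p + cV c μ κ ε K * ((ε ^ 2)⁻¹ * θ p ^ 2)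
      + cZ κ ε K * ((ε ^ 2)⁻¹ * gg θ p) := by
  have hε := H.hε
  have h1 := H.ρlo hp
  have h1' := H.ρhi hp
  have h2 := H.τpos hp.2.2
  have h4 := H.qlo hp.2.2
  have h5 := H.qhi hp.2.2
  have hg : |τ1 p.2.2 / ε| ≤ K := by
    rw [abs_div, abs_of_pos hε, div_le_iff₀ hε]; exact H.τder_bd _ hp.2.2
  have hs : |θ p / ε| ≤ 3 := by
    rw [abs_div, abs_of_pos hε, div_le_iff₀ hε]; exact H.θb p hp
  have := ptw1 (c := c) (μ := μ) (r := r) (κ := κ) (ε := ε) (K := K) (ρ := (τ p.2.2)⁻¹ + φ p)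
    (q := (τ p.2.2)⁻¹) (g := τ1 p.2.2 / ε) (a := a p) (b := b p) (s := θ p / ε)
    (a1 := DD v1 a p) (a2 := DD v2 a p) (b1 := DD v1 b p) (b2 := DD v2 b p)
    (z1 := DD v1 θ p / ε) (z2 := DD v2 θ p / ε) hε H.hc H.hμ H.hr H.hκ H.hK
    (abs_le.2 ⟨by linarith, h1'⟩) (abs_le.2 ⟨by linarith, h5⟩) h4 hg (H.bbd p hp) hs
  have e : τ p.2.2 * (τ p.2.2)⁻¹ = 1 := mul_inv_cancel₀ h2.ne'
  have eε : ε * ε⁻¹ = 1 := mul_inv_cancel₀ hε.ne'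
  refine le_trans (le_of_eq ?_) (this.trans (le_of_eq ?_))
  · unfold src
    generalize (τ p.2.2)⁻¹ + φ p = ρ
    generalize DD v1 a p = a1
    generalize DD v2 a p = a2
    generalize DD v1 b p = b1
    generalize DD v2 b p = b2
    generalize DD v1 θ p = t1
    generalize DD v2 θ p = t2
    generalize θ p = th
    generalize a p = a0
    generalize b p = b0
    generalize τ1 p.2.2 = T1
    have eq : τ p.2.2 = ((τ p.2.2)⁻¹)⁻¹ := (inv_inv _).symm
    have hq : (τ p.2.2)⁻¹ ≠ 0 := by positivity
    rw [eq]
    generalize (τ p.2.2)⁻¹ = q at *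
    simp only [inv_inv]
    field_simp
    ring
  · unfold kk gg
    field_simp

lemma cont_src (H : Sys c μ r κ ε T K τ τ1 a b φ θ) :
    ContinuousOn (src c μ r κ ε τ τ1 a b φ θ) (KT T) := by
  have hq := H.cq
  have h1 := H.hτ1
  have cτ := H.cτ
  have sa := H.sa
  have sb := H.sb
  have sθ := H.sθ
  have sφ := H.sφ
  have ca := H.sa.continuous
  have cb := H.sb.continuous
  have cφ := H.sφ.continuous
  have cθ := H.sθ.continuous
  unfold Sm at sa sb sφ sθ
  unfold src
  fun_prop

lemma slice_src (H : Sys c μ r κ ε T K τ τ1 a b φ θ)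
    (hA : cW c μ r ε K + cK μ r ε K ≤ μ / 4) (hB : cV c μ κ ε K + cZ κ ε K ≤ κ / 8)
    {t : ℝ} (ht : t ∈ Set.Icc 0 T) :
    ∫ x in Ω, src c μ r κ ε τ τ1 a b φ θ (t, x)
      ≤ ∫ x in Ω, -(μ / 4 * kk a b (t, x) + κ / 8 * ((ε ^ 2)⁻¹ * gg θ (t, x))) := by
  have sa := H.sa
  have sb := H.sb
  have sθ := H.sθ
  have ca := H.sa.continuous
  have cb := H.sb.continuous
  have cθ := H.sθ.continuous
  have ck := cont_kk sa sb
  have cg := cont_gg sθ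
  have I : ∀ {f : E3 → ℝ}, Continuous f → Integrable (fun x : ℝ × ℝ => f (t, x)) (volume.restrict Ω) :=
    fun hf => intΩ (sliceT (T := T) hf.continuousOn ht)
  have h1 : ∫ x in Ω, src c μ r κ ε τ τ1 a b φ θ (t, x) ≤ ∫ x in Ω,
      ((-(μ / 2) + cK μ r ε K) * kk a b (t, x) + ((-(κ / 4) + cZ κ ε K) * (ε ^ 2)⁻¹) * gg θ (t, x)
        + (cW c μ r ε K * a (t, x) ^ 2 + cW c μ r ε K * b (t, x) ^ 2
          + (cV c μ κ ε K * (ε ^ 2)⁻¹) * θ (t, x) ^ 2)) := by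
    refine setIntegral_mono_on (intΩ (sliceT H.cont_src ht)) ?_ Ω_meas fun x hx => ?_
    · exact I (f := fun p => (-(μ / 2) + cK μ r ε K) * kk a b p
        + ((-(κ / 4) + cZ κ ε K) * (ε ^ 2)⁻¹) * gg θ p
        + (cW c μ r ε K * a p ^ 2 + cW c μ r ε K * b p ^ 2
          + (cV c μ κ ε K * (ε ^ 2)⁻¹) * θ p ^ 2)) (by fun_prop)
    · refine (H.src_le (KT_Ω ht hx)).trans (le_of_eq ?_)
      ring
  refine h1.trans ?_
  have i1 := I ck
  have i2 := I cg
  have i3 := I (f := fun p => a p ^ 2) (by fun_prop)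
  have i4 := I (f := fun p => b p ^ 2) (by fun_prop)
  have i5 := I (f := fun p => θ p ^ 2) (by fun_prop)
  rw [integral_add, integral_add (i1.const_mul _) (i2.const_mul _), integral_add,
    integral_add (i3.const_mul _) (i4.const_mul _), integral_neg,
    integral_add (i1.const_mul _) ((i2.const_mul _).const_mul _)]
  rotate_left
  · exact (i3.const_mul _).add (i4.const_mul _)
  · exact i5.const_mul _
  · exact (i1.const_mul _).add (i2.const_mul _)
  · exact ((i3.const_mul _).add (i4.const_mul _)).add (i5.const_mul _)
  simp only [integral_const_mul]
  have pa := poincare sa H.ba ht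
  have pb := poincare sb H.bb ht
  have pθ := poincare sθ H.bθ ht
  have j : ∀ {f g : E3 → ℝ}, Continuous f → Continuous g → (∀ p, f p ≤ g p) →
      ∫ x in Ω, f (t, x) ≤ ∫ x in Ω, g (t, x) := fun hf hg h =>
    integral_mono (I hf) (I hg) fun x => h (t, x)
  have k1 : (∫ x in Ω, a (t, x) ^ 2) + ∫ x in Ω, b (t, x) ^ 2 ≤ ∫ x in Ω, kk a b (t, x) := by
    refine (add_le_add pa pb).trans ?_
    rw [← integral_add (I (f := fun p => DD v2 a p ^ 2) (by fun_prop))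
      (I (f := fun p => DD v2 b p ^ 2) (by fun_prop))]
    refine j (f := fun p => DD v2 a p ^ 2 + DD v2 b p ^ 2) (by fun_prop) ck fun p => ?_
    unfold kk
    linarith [sq_nonneg (DD v1 a p), sq_nonneg (DD v1 b p)]
  have k2 : (∫ x in Ω, θ (t, x) ^ 2) ≤ ∫ x in Ω, gg θ (t, x) := by
    refine pθ.trans ?_
    refine j (f := fun p => DD v2 θ p ^ 2) (by fun_prop) cg fun p => ?_
    unfold gg
    linarith [sq_nonneg (DD v1 θ p)]
  have hε := H.hε
  have hK := H.hK
  have hμ := H.hμ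
  have hc := H.hc
  have hκ := H.hκ
  have hl : 0 < μ + r * μ := by
    have := mul_pos H.hr hμ
    linarith
  have W0 : 0 ≤ cW c μ r ε K := by unfold cW; positivity
  have V0 : 0 ≤ cV c μ κ ε K := by unfold cV; positivity
  have kn : 0 ≤ ∫ x in Ω, kk a b (t, x) := integral_nonneg fun x => by
    simp only [kk, Pi.zero_apply]; positivity
  have gn : 0 ≤ (ε ^ 2)⁻¹ * ∫ x in Ω, gg θ (t, x) := mul_nonneg (by positivity) <|
    integral_nonneg fun x => by simp only [gg, Pi.zero_apply]; positivity
  have m1 := mul_le_mul_of_nonneg_left k1 W0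
  have m2 := mul_le_mul_of_nonneg_left (mul_le_mul_of_nonneg_left k2 (by positivity : 0 ≤ (ε ^ 2)⁻¹)) V0
  have m3 := mul_le_mul_of_nonneg_right hA kn
  have m4 := mul_le_mul_of_nonneg_right hB gn
  linear_combination m1 + m2 + m3 + m4

/-- First energy estimate. -/
lemma first (H : Sys c μ r κ ε T K τ τ1 a b φ θ)
    (hA : cW c μ r ε K + cK μ r ε K ≤ μ / 4) (hB : cV c μ κ ε K + cZ κ ε K ≤ κ / 8)
    {t : ℝ} (ht : t ∈ Set.Icc 0 T) :
    μ / 4 * (∫ s in (0 : ℝ)..t, ∫ x in Ω, kk a b (s, x))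
      + κ / 8 * ((ε ^ 2)⁻¹ * ∫ s in (0 : ℝ)..t, ∫ x in Ω, gg θ (s, x))
    ≤ ∫ x in Ω, (3 * (a (0, x) ^ 2 + b (0, x) ^ 2)
        + (ε ^ 2)⁻¹ * (2 * φ (0, x) ^ 2 + 6 * c * θ (0, x) ^ 2)) := by
  have hb := H.balEng.eq ht
  have sa := H.sa
  have sb := H.sb
  have sθ := H.sθ
  have ca := H.sa.continuous
  have cb := H.sb.continuous
  have cθ := H.sθ.continuous
  have cφ := H.sφ.continuous
  have ck := cont_kk sa sb
  have cg := cont_gg sθ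
  have h0 : (0 : ℝ) ∈ Set.Icc 0 T := ⟨le_rfl, H.hT.le⟩
  obtain ⟨-, -, -, -, -, ce, -⟩ := H.balEng
  have n : 0 ≤ ∫ x in Ω, eng c ε τ a b φ θ (t, x) :=
    setIntegral_nonneg Ω_meas fun x hx => H.eng_nonneg (KT_Ω ht hx)
  have m := timeMono (g := fun p => -(μ / 4 * kk a b p + κ / 8 * ((ε ^ 2)⁻¹ * gg θ p)))
    H.cont_src (by fun_prop) (fun s hs => H.slice_src hA hB hs) ht
  have e : ∫ s in (0 : ℝ)..t, ∫ x in Ω, -(μ / 4 * kk a b (s, x) + κ / 8 * ((ε ^ 2)⁻¹ * gg θ (s, x)))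
      = -(μ / 4 * (∫ s in (0 : ℝ)..t, ∫ x in Ω, kk a b (s, x))
      + κ / 8 * ((ε ^ 2)⁻¹ * ∫ s in (0 : ℝ)..t, ∫ x in Ω, gg θ (s, x))) := by
    have : ∀ s ∈ Set.uIcc 0 t, ∫ x in Ω, -(μ / 4 * kk a b (s, x) + κ / 8 * ((ε ^ 2)⁻¹ * gg θ (s, x)))
        = -(μ / 4 * (∫ x in Ω, kk a b (s, x)) + κ / 8 * ((ε ^ 2)⁻¹ * ∫ x in Ω, gg θ (s, x))) := by
      intro s hs
      rw [Set.uIcc_of_le ht.1] at hs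
      have hs' : s ∈ Set.Icc 0 T := ⟨hs.1, hs.2.trans ht.2⟩
      have i1 : Integrable (fun x : ℝ × ℝ => kk a b (s, x)) (volume.restrict Ω) :=
        intΩ (sliceT (T := T) ck.continuousOn hs')
      have i2 : Integrable (fun x : ℝ × ℝ => gg θ (s, x)) (volume.restrict Ω) :=
        intΩ (sliceT (T := T) cg.continuousOn hs')
      rw [integral_neg, integral_add (i1.const_mul _) ((i2.const_mul _).const_mul _)]
      simp only [integral_const_mul]
    rw [intervalIntegral.integral_congr this, intervalIntegral.integral_neg,
      intervalIntegral.integral_add ((intT' ck.continuousOn ht).const_mul _)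
        (((intT' cg.continuousOn ht).const_mul _).const_mul _)]
    simp only [intervalIntegral.integral_const_mul]
  have l : ∫ x in Ω, eng c ε τ a b φ θ (0, x) ≤ ∫ x in Ω, (3 * (a (0, x) ^ 2 + b (0, x) ^ 2)
        + (ε ^ 2)⁻¹ * (2 * φ (0, x) ^ 2 + 6 * c * θ (0, x) ^ 2)) := by
    refine setIntegral_mono_on (intΩ (sliceT ce h0)) (intΩ ?_) Ω_meas fun x hx => H.eng_le (KT_Ω h0 hx)
    exact sliceT (T := T) (f := fun p => 3 * (a p ^ 2 + b p ^ 2)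
        + (ε ^ 2)⁻¹ * (2 * φ p ^ 2 + 6 * c * θ p ^ 2)) (by fun_prop) h0
  rw [e] at m
  linarith
end Sys
end

/-! ### Second order estimate -/

/-- constant in the bound of the forcing -/
def cF (c μ r K : ℝ) : ℝ :=
  4 * (225 * c ^ 2 + 9 * c ^ 2 * K ^ 2 + 162 + 456 * μ ^ 2 + 432 * r ^ 2 * μ ^ 2)

lemma sqle {x X : ℝ} (h : |x| ≤ X) : x ^ 2 ≤ X ^ 2 := by
  rw [← sq_abs x]
  exact pow_le_pow_left₀ (abs_nonneg x) h 2

lemma sq4 (x y z w : ℝ) : (x + y + z + w) ^ 2 ≤ 4 * (x ^ 2 + y ^ 2 + z ^ 2 + w ^ 2) := by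
  linarith [sq_nonneg (x - y), sq_nonneg (x - z), sq_nonneg (x - w), sq_nonneg (y - z),
    sq_nonneg (y - w), sq_nonneg (z - w)]

lemma sq3 (x y z : ℝ) : (x + y + z) ^ 2 ≤ 3 * (x ^ 2 + y ^ 2 + z ^ 2) := by
  linarith [sq_nonneg (x - y), sq_nonneg (x - z), sq_nonneg (y - z)]

lemma bndQ {μ r ε a1 a2 b1 b2 : ℝ} (hε : 0 < ε) (hε1 : ε ≤ 1)
    (h1 : |ε * a1| ≤ 3) (h2 : |ε * a2| ≤ 3) (h3 : |ε * b1| ≤ 3) (h4 : |ε * b2| ≤ 3) :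
    (ε ^ 2 * (2 * μ * (a1 ^ 2 + b2 ^ 2 + (b1 + a2) ^ 2 / 2)
        + 4 * μ * ((b1 + a2) / 2) + r * μ * (a1 + b2) ^ 2)) ^ 2
      ≤ (456 * μ ^ 2 + 432 * r ^ 2 * μ ^ 2) * (a1 ^ 2 + a2 ^ 2 + b1 ^ 2 + b2 ^ 2) := by
  have e1 := sqle h1
  have e2 := sqle h2
  have e3 := sqle h3
  have e4 := sqle h4
  have w10 : a1 ^ 2 + b2 ^ 2 + (b1 + a2) ^ 2 / 2 ≤ a1 ^ 2 + a2 ^ 2 + b1 ^ 2 + b2 ^ 2 := by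
    linarith only [sq_nonneg (b1 - a2)]
  have kdiv : (a1 + b2) ^ 2 ≤ 2 * (a1 ^ 2 + a2 ^ 2 + b1 ^ 2 + b2 ^ 2) := by
    linarith only [sq_nonneg (a1 - b2), sq_nonneg a2, sq_nonneg b1]
  have kdef : (b1 + a2) ^ 2 ≤ 2 * (a1 ^ 2 + a2 ^ 2 + b1 ^ 2 + b2 ^ 2) := by
    linarith only [sq_nonneg (b1 - a2), sq_nonneg a1, sq_nonneg b2]
  have p10 : 0 ≤ a1 ^ 2 + b2 ^ 2 + (b1 + a2) ^ 2 / 2 := by positivity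
  have pdiv : 0 ≤ (a1 + b2) ^ 2 := by positivity
  have hk : ε ^ 2 * (a1 ^ 2 + a2 ^ 2 + b1 ^ 2 + b2 ^ 2) ≤ 36 := by linarith only [e1, e2, e3, e4]
  have k0 : 0 ≤ a1 ^ 2 + a2 ^ 2 + b1 ^ 2 + b2 ^ 2 := by positivity
  have hs := sq3 (2 * μ * (ε ^ 2 * (a1 ^ 2 + b2 ^ 2 + (b1 + a2) ^ 2 / 2)))
    (2 * μ * (ε ^ 2 * (b1 + a2))) (r * μ * (ε ^ 2 * (a1 + b2) ^ 2))
  generalize a1 ^ 2 + a2 ^ 2 + b1 ^ 2 + b2 ^ 2 = k at *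
  have hε2 : ε ^ 2 ≤ 1 := pow_le_one₀ hε.le hε1
  have hkk : (ε ^ 2 * k) ^ 2 ≤ 36 * k := by
    have a := mul_le_mul_of_nonneg_right hk (by positivity : 0 ≤ ε ^ 2 * k)
    have b := mul_le_mul_of_nonneg_right hε2 k0
    linarith only [a, b]
  have f1 : (ε ^ 2 * (a1 ^ 2 + b2 ^ 2 + (b1 + a2) ^ 2 / 2)) ^ 2 ≤ (ε ^ 2 * k) ^ 2 := by
    gcongr
  have f2 : (ε ^ 2 * (a1 + b2) ^ 2) ^ 2 ≤ (ε ^ 2 * (2 * k)) ^ 2 := by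
    gcongr
  have f3 : (ε ^ 2 * (b1 + a2)) ^ 2 ≤ 2 * k := by
    have : (ε ^ 2) ^ 2 * (b1 + a2) ^ 2 ≤ 1 ^ 2 * (2 * k) := by gcongr
    linarith only [this]
  have g1 := mul_le_mul_of_nonneg_left (f1.trans hkk) (by positivity : 0 ≤ (2 * μ) ^ 2)
  have g2 := mul_le_mul_of_nonneg_left f3 (by positivity : 0 ≤ (2 * μ) ^ 2)
  have g3 := mul_le_mul_of_nonneg_left f2 (by positivity : 0 ≤ (r * μ) ^ 2)
  have g4 := mul_le_mul_of_nonneg_left hkk (by positivity : 0 ≤ (r * μ) ^ 2)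
  linear_combination hs + 3 * g1 + 3 * g2 + 3 * g3 + 12 * g4

lemma bndF {c μ r ε K ρ P t1 u a b a1 a2 b1 b2 z1 z2 : ℝ} (hc : 0 < c) (hε : 0 < ε) (hε1 : ε ≤ 1)
    (hK : 0 < K) (hρ : |ρ| ≤ 3) (hP : |P| ≤ 9) (ht : |t1| ≤ K * ε) (hu : |u| ≤ 4) (hb : |b| ≤ 3)
    (h1 : |ε * a1| ≤ 3) (h2 : |ε * a2| ≤ 3) (h3 : |ε * b1| ≤ 3) (h4 : |ε * b2| ≤ 3) :
    (-(c * ρ * (u * z1 + b * z2)) - c * ρ * (b * t1) - P * (a1 + b2)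
      + ε ^ 2 * (2 * μ * (a1 ^ 2 + b2 ^ 2 + (b1 + a2) ^ 2 / 2)
        + 4 * μ * ((b1 + a2) / 2) + r * μ * (a1 + b2) ^ 2)) ^ 2
      ≤ cF c μ r K * ((z1 ^ 2 + z2 ^ 2) + (a1 ^ 2 + a2 ^ 2 + b1 ^ 2 + b2 ^ 2) + (a ^ 2 + b ^ 2)) := by
  have hQ := bndQ (μ := μ) (r := r) hε hε1 h1 h2 h3 h4
  have kdiv : (a1 + b2) ^ 2 ≤ 2 * (a1 ^ 2 + a2 ^ 2 + b1 ^ 2 + b2 ^ 2) := by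
    linarith only [sq_nonneg (a1 - b2), sq_nonneg a2, sq_nonneg b1]
  have k0 : 0 ≤ a1 ^ 2 + a2 ^ 2 + b1 ^ 2 + b2 ^ 2 := by positivity
  generalize a1 ^ 2 + a2 ^ 2 + b1 ^ 2 + b2 ^ 2 = k at *
  generalize ε ^ 2 * (2 * μ * (a1 ^ 2 + b2 ^ 2 + (b1 + a2) ^ 2 / 2)
        + 4 * μ * ((b1 + a2) / 2) + r * μ * (a1 + b2) ^ 2) = Q at *
  have ρ2 := sqle hρ
  have P2 := sqle hP
  have T2 : t1 ^ 2 ≤ K ^ 2 := sqle (ht.trans (by nlinarith))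
  have u2 := sqle hu
  have b2' := sqle hb
  have U2 : (u * z1 + b * z2) ^ 2 ≤ 25 * (z1 ^ 2 + z2 ^ 2) := by
    have : (u * z1 + b * z2) ^ 2 ≤ (u ^ 2 + b ^ 2) * (z1 ^ 2 + z2 ^ 2) := by
      linarith only [sq_nonneg (u * z2 - b * z1)]
    refine this.trans (mul_le_mul_of_nonneg_right (by linarith only [u2, b2']) (by positivity))
  have x1 : (c * ρ) ^ 2 * (u * z1 + b * z2) ^ 2 ≤ (c ^ 2 * 9) * (25 * (z1 ^ 2 + z2 ^ 2)) :=
    mul_le_mul (by rw [mul_pow]; exact mul_le_mul_of_nonneg_left (by linarith) (by positivity)) U2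
      (by positivity) (by positivity)
  have x2 : (c * ρ) ^ 2 * (b ^ 2 * t1 ^ 2) ≤ (c ^ 2 * 9) * ((a ^ 2 + b ^ 2) * K ^ 2) :=
    mul_le_mul (by rw [mul_pow]; exact mul_le_mul_of_nonneg_left (by linarith) (by positivity))
      (mul_le_mul (by linarith [sq_nonneg a]) T2 (by positivity) (by positivity))
      (by positivity) (by positivity)
  have x3 : P ^ 2 * (a1 + b2) ^ 2 ≤ 81 * (2 * k) :=
    mul_le_mul (by linarith) kdiv (by positivity) (by positivity)
  have h := sq4 (-(c * ρ * (u * z1 + b * z2))) (-(c * ρ * (b * t1))) (-(P * (a1 + b2))) Q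
  have hz : 0 ≤ z1 ^ 2 + z2 ^ 2 := by positivity
  have hw : 0 ≤ a ^ 2 + b ^ 2 := by positivity
  have y1 : 0 ≤ (9 * c ^ 2 * K ^ 2 + 162 + 456 * μ ^ 2 + 432 * r ^ 2 * μ ^ 2) * (z1 ^ 2 + z2 ^ 2) := by
    positivity
  have y2 : 0 ≤ (225 * c ^ 2 + 9 * c ^ 2 * K ^ 2) * k := by positivity
  have y3 : 0 ≤ (225 * c ^ 2 + 162 + 456 * μ ^ 2 + 432 * r ^ 2 * μ ^ 2) * (a ^ 2 + b ^ 2) := by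
    positivity
  unfold cF
  linear_combination h + 4 * x1 + 4 * x2 + 4 * x3 + 4 * hQ + 4 * y1 + 4 * y2 + 4 * y3

lemma young_src {c κ ρ X L F G : ℝ} (hc : 0 < c) (hκ : 0 < κ) (h1 : 1 / 4 ≤ ρ) (h3 : ρ ≤ 3)
    (h : c * ρ * X = κ * L + F) (hF : F ^ 2 ≤ G) :
    -(X * L) ≤ -(κ / (6 * c)) * L ^ 2 + 2 / (κ * c) * G := by
  have hρ : 0 < ρ := by linarith
  have hX : X = (κ * L + F) / (c * ρ) := by field_simp; linarith
  have e : -(X * L) ≤ (1 / ρ) * (-(κ / (2 * c)) * L ^ 2 + 1 / (2 * (κ * c)) * F ^ 2) := by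
    have : (1 / ρ) * (-(κ / (2 * c)) * L ^ 2 + 1 / (2 * (κ * c)) * F ^ 2) - -(X * L)
      = (1 / (2 * κ * c * ρ)) * (κ * L + F) ^ 2 := by
      rw [hX]; field_simp; ring
    have h2 : 0 ≤ (1 / (2 * κ * c * ρ)) * (κ * L + F) ^ 2 := by positivity
    linarith
  have r1 : 1 / 3 ≤ 1 / ρ := one_div_le_one_div_of_le hρ h3
  have r2 : 1 / ρ ≤ 4 := by
    rw [div_le_iff₀ hρ]; linarith
  have s1 := mul_le_mul_of_nonneg_right r1 (by positivity : 0 ≤ κ / (2 * c) * L ^ 2)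
  have s2 := mul_le_mul_of_nonneg_right r2 (by positivity : 0 ≤ 1 / (2 * (κ * c)) * F ^ 2)
  have s3 := mul_le_mul_of_nonneg_left hF (by positivity : 0 ≤ 2 / (κ * c))
  have q1 : κ / (6 * c) = 1 / 3 * (κ / (2 * c)) := by field_simp; ring
  have q2 : 2 / (κ * c) = 4 * (1 / (2 * (κ * c))) := by field_simp; ring
  rw [q1]
  rw [q2] at s3 ⊢
  linarith

section
variable {c μ r κ ε T K : ℝ} {τ τ1 : ℝ → ℝ} {a b φ θ : E3 → ℝ}

/-- Laplacian of `θ`. -/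
def ll (θ : E3 → ℝ) (p : E3) : ℝ := DD v1 (DD v1 θ) p + DD v2 (DD v2 θ) p
/-- Squared Hessian of `θ`. -/
def hh (θ : E3 → ℝ) (p : E3) : ℝ :=
  DD v1 (DD v1 θ) p ^ 2 + 2 * DD v1 (DD v2 θ) p ^ 2 + DD v2 (DD v2 θ) p ^ 2

lemma cont_ll (ha : Sm θ) : Continuous (ll θ) := by
  unfold Sm at ha
  unfold ll; fun_prop
lemma cont_hh (ha : Sm θ) : Continuous (hh θ) := by
  unfold Sm at ha
  unfold hh; fun_prop

namespace Sys

lemma ptw2 (H : Sys c μ r κ ε T K τ τ1 a b φ θ) {t : ℝ} (ht : t ∈ Set.Icc 0 T) {x : ℝ × ℝ}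
    (hx : x ∈ Ω) :
    - (DD vt θ (t, x) * ll θ (t, x)) ≤ -(κ / (6 * c)) * ll θ (t, x) ^ 2
      + 2 / (κ * c) * (cF c μ r K * (gg θ (t, x) + kk a b (t, x) + (a (t, x) ^ 2 + b (t, x) ^ 2))) := by
  have hp : ((t, x) : E3) ∈ KT T := KT_Ω ht hx
  have hE := H.energy t ht x.1 x.2 hx (t, x) rfl
  have hε := H.hε
  have hε1 : ε ≤ 1 := by linarith [H.hε1]
  have h1 := H.ρlo hp
  have h1' := H.ρhi hp
  have h2 := H.τpos hp.2.2
  have h2' := H.τhi _ hp.2.2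
  have hθ := abs_le.1 (H.θb _ hp)
  have ha := abs_le.1 (H.ab _ hp)
  have sc : ∀ z : ℝ, |z| ≤ 3 * ε⁻¹ → |ε * z| ≤ 3 := fun z hz => by
    rw [abs_mul, abs_of_pos hε]
    calc ε * |z| ≤ ε * (3 * ε⁻¹) := by gcongr
      _ = 3 := by field_simp
  have hρ : |(τ x.2)⁻¹ + φ (t, x)| ≤ 3 := abs_le.2 ⟨by simp at h1; linarith, h1'⟩
  have hP : |((τ x.2)⁻¹ + φ (t, x)) * (τ x.2 + θ (t, x))| ≤ 9 := by
    have : |τ x.2 + θ (t, x)| ≤ 3 := by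
      rw [abs_le]; simp only at h2 h2'; constructor <;> linarith [H.hε1]
    have := absmul hρ this
    linarith
  have hu : |x.2 + a (t, x)| ≤ 4 := by
    have := hx.2.1; have := hx.2.2
    rw [abs_le]; constructor <;> linarith
  refine young_src H.hc H.hκ h1 h1' ?_ (bndF (a := a (t, x)) (z1 := DD v1 θ (t, x)) (z2 := DD v2 θ (t, x))
    H.hc hε hε1 H.hK hρ hP (H.τder_bd x.2 hp.2.2) hu
    (H.bbd _ hp) (sc _ (H.a1b _ hp)) (sc _ (H.a2b _ hp)) (sc _ (H.b1b _ hp)) (sc _ (H.b2b _ hp)))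
  unfold ll
  simp only at hE ⊢
  linear_combination hE

/-- constant -/
def cD (c μ r κ K : ℝ) : ℝ := 2 / (κ * c) * cF c μ r K

lemma lap_est (H : Sys c μ r κ ε T K τ τ1 a b φ θ) {t : ℝ} (ht : t ∈ Set.Icc 0 T) :
    κ / (6 * c) * (∫ s in (0 : ℝ)..t, ∫ x in Ω, hh θ (s, x))
      ≤ 1 / 2 * (∫ x in Ω, gg θ (0, x)) + cD c μ r κ K *
        ((∫ s in (0 : ℝ)..t, ∫ x in Ω, gg θ (s, x)) + 2 * ∫ s in (0 : ℝ)..t, ∫ x in Ω, kk a b (s, x)) := by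
  have hb := H.balGrad.eq ht
  have sa := H.sa
  have sb := H.sb
  have sθ := H.sθ
  have ca := H.sa.continuous
  have cb := H.sb.continuous
  have cθ := H.sθ.continuous
  have ck := cont_kk sa sb
  have cg := cont_gg sθ
  have ch := cont_hh sθ
  have cl := cont_ll sθ
  have hD : 0 ≤ cD c μ r κ K := by
    have := H.hκ; have := H.hc; have := H.hμ
    unfold cD cF; positivity
  have I : ∀ {f : E3 → ℝ} (t : ℝ), Continuous f →
      Integrable (fun x : ℝ × ℝ => f (t, x)) (volume.restrict Ω) :=
    fun t hf => intΩ (Continuous.continuousOn (by fun_prop))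
  have key : ∀ s ∈ Set.Icc (0 : ℝ) T, ∫ x in Ω, -(DD vt θ (s, x) * ll θ (s, x))
      ≤ ∫ x in Ω, (-(κ / (6 * c)) * hh θ (s, x)
        + cD c μ r κ K * (gg θ (s, x) + 2 * kk a b (s, x))) := by
    intro s hs
    have h1 : ∫ x in Ω, -(DD vt θ (s, x) * ll θ (s, x)) ≤ ∫ x in Ω, (-(κ / (6 * c)) * ll θ (s, x) ^ 2
        + cD c μ r κ K * ((gg θ (s, x) + kk a b (s, x)) + (a (s, x) ^ 2 + b (s, x) ^ 2))) := by
      refine setIntegral_mono_on (I (f := fun p => -(DD vt θ p * ll θ p)) s (by fun_prop))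
        (I (f := fun p => -(κ / (6 * c)) * ll θ p ^ 2
        + cD c μ r κ K * ((gg θ p + kk a b p) + (a p ^ 2 + b p ^ 2))) s (by fun_prop)) Ω_meas
        fun x hx => ?_
      refine (H.ptw2 hs hx).trans (le_of_eq ?_)
      unfold cD; ring
    refine h1.trans ?_
    have il := I (f := fun p => ll θ p ^ 2) s (by fun_prop)
    have i1 := I s ck
    have i2 := I s cg
    have i3 := I (f := fun p => a p ^ 2) s (by fun_prop)
    have i4 := I (f := fun p => b p ^ 2) s (by fun_prop)
    have ih := I s ch
    rw [integral_add, integral_const_mul, integral_const_mul, integral_add, integral_add i2 i1,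
      integral_add i3 i4, integral_add, integral_const_mul, integral_const_mul, integral_add,
      integral_const_mul]
    rotate_left
    · exact i2
    · exact i1.const_mul _
    · exact ih.const_mul _
    · exact (i2.add (i1.const_mul _)).const_mul _
    · exact i2.add i1
    · exact i3.add i4
    · exact il.const_mul _
    · exact ((i2.add i1).add (i3.add i4)).const_mul _
    have pa := poincare sa H.ba hs
    have pb := poincare sb H.bb hs
    have k1 : (∫ x in Ω, a (s, x) ^ 2) + ∫ x in Ω, b (s, x) ^ 2 ≤ ∫ x in Ω, kk a b (s, x) := by
      refine (add_le_add pa pb).trans ?_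
      rw [← integral_add (I (f := fun p => DD v2 a p ^ 2) s (by fun_prop))
        (I (f := fun p => DD v2 b p ^ 2) s (by fun_prop))]
      refine integral_mono (I (f := fun p => DD v2 a p ^ 2 + DD v2 b p ^ 2) s (by fun_prop))
        (I s ck) fun x => ?_
      simp only [kk]
      linarith [sq_nonneg (DD v1 a (s, x)), sq_nonneg (DD v1 b (s, x))]
    have el : ∫ x in Ω, hh θ (s, x) = ∫ x in Ω, ll θ (s, x) ^ 2 := elliptic sθ H.pθ H.bθ hs
    rw [el]
    have := mul_le_mul_of_nonneg_left k1 hD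
    linear_combination this
  have m := timeMono (f := fun p => -(DD vt θ p * ll θ p))
    (g := fun p => -(κ / (6 * c)) * hh θ p + cD c μ r κ K * (gg θ p + 2 * kk a b p))
    (by fun_prop) (by fun_prop) key ht
  have e : ∫ s in (0 : ℝ)..t, ∫ x in Ω, (-(κ / (6 * c)) * hh θ (s, x)
        + cD c μ r κ K * (gg θ (s, x) + 2 * kk a b (s, x)))
      = -(κ / (6 * c)) * (∫ s in (0 : ℝ)..t, ∫ x in Ω, hh θ (s, x)) + cD c μ r κ K *
        ((∫ s in (0 : ℝ)..t, ∫ x in Ω, gg θ (s, x)) + 2 * ∫ s in (0 : ℝ)..t, ∫ x in Ω, kk a b (s, x)) := by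
    have : ∀ s, ∫ x in Ω, (-(κ / (6 * c)) * hh θ (s, x)
        + cD c μ r κ K * (gg θ (s, x) + 2 * kk a b (s, x)))
        = -(κ / (6 * c)) * (∫ x in Ω, hh θ (s, x)) + cD c μ r κ K *
        ((∫ x in Ω, gg θ (s, x)) + 2 * ∫ x in Ω, kk a b (s, x)) := by
      intro s
      rw [integral_add, integral_const_mul, integral_const_mul, integral_add, integral_const_mul]
      · exact I s cg
      · exact (I s ck).const_mul _
      · exact (I s ch).const_mul _
      · exact ((I s cg).add ((I s ck).const_mul _)).const_mul _
    simp only [this]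
    have j1 := intT' (T := T) ck.continuousOn ht
    have j2 := intT' (T := T) cg.continuousOn ht
    have j3 := intT' (T := T) ch.continuousOn ht
    rw [intervalIntegral.integral_add (j3.const_mul _) ((j2.add (j1.const_mul _)).const_mul _),
      intervalIntegral.integral_const_mul, intervalIntegral.integral_const_mul,
      intervalIntegral.integral_add j2 (j1.const_mul _), intervalIntegral.integral_const_mul]
  have g1 : ∀ s, ∫ x in Ω, 1 / 2 * (DD v1 θ (s, x) * DD v1 θ (s, x) + DD v2 θ (s, x) * DD v2 θ (s, x))
      = 1 / 2 * ∫ x in Ω, gg θ (s, x) := fun s => by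
    rw [integral_const_mul]; simp only [gg, pow_two]
  have gn : 0 ≤ ∫ x in Ω, gg θ (t, x) := 
    integral_nonneg fun x => by simp only [gg, Pi.zero_apply]; positivity
  rw [e] at m
  simp only [g1] at hb
  unfold ll at m
  linarith

/-- final constant -/
def cC (c μ r κ K : ℝ) : ℝ := 6 * c / κ * (1 + cD c μ r κ K * (8 / κ + 8 / μ))

/-- Second-order estimate in coordinates. -/
lemma second (H : Sys c μ r κ ε T K τ τ1 a b φ θ)
    (hA : cW c μ r ε K + cK μ r ε K ≤ μ / 4) (hB : cV c μ κ ε K + cZ κ ε K ≤ κ / 8)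
    {t : ℝ} (ht : t ∈ Set.Icc 0 T) :
    (ε ^ 2)⁻¹ * (∫ s in (0 : ℝ)..t, ∫ x in Ω, hh θ (s, x)) ≤ cC c μ r κ K *
      ((ε ^ 2)⁻¹ * (∫ x in Ω, gg θ (0, x)) + (ε ^ 2)⁻¹ * ∫ x in Ω, (3 * (a (0, x) ^ 2 + b (0, x) ^ 2)
        + (ε ^ 2)⁻¹ * (2 * φ (0, x) ^ 2 + 6 * c * θ (0, x) ^ 2))) := by
  have h1 := H.first hA hB ht
  have h2 := H.lap_est ht
  have hε := H.hε
  have hμ := H.hμ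
  have hκ := H.hκ
  have hc := H.hc
  have hE : 1 ≤ (ε ^ 2)⁻¹ := by
    rw [one_le_inv₀ (by positivity)]
    exact pow_le_one₀ hε.le (by linarith [H.hε1])
  have hD : 0 ≤ cD c μ r κ K := by
    unfold cD cF; positivity
  have g0 : 0 ≤ ∫ x in Ω, gg θ (0, x) :=
    integral_nonneg fun x => by simp only [gg, Pi.zero_apply]; positivity
  have gt : 0 ≤ ∫ s in (0 : ℝ)..t, ∫ x in Ω, gg θ (s, x) :=
    intervalIntegral.integral_nonneg ht.1 fun s _ =>
    integral_nonneg fun x => by simp only [gg, Pi.zero_apply]; positivity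
  have kt : 0 ≤ ∫ s in (0 : ℝ)..t, ∫ x in Ω, kk a b (s, x) :=
    intervalIntegral.integral_nonneg ht.1 fun s _ =>
    integral_nonneg fun x => by simp only [kk, Pi.zero_apply]; positivity
  generalize (∫ x in Ω, (3 * (a (0, x) ^ 2 + b (0, x) ^ 2)
        + (ε ^ 2)⁻¹ * (2 * φ (0, x) ^ 2 + 6 * c * θ (0, x) ^ 2))) = E0 at *
  generalize ∫ s in (0 : ℝ)..t, ∫ x in Ω, hh θ (s, x) = hI at *
  generalize ∫ s in (0 : ℝ)..t, ∫ x in Ω, gg θ (s, x) = gI at *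
  generalize ∫ s in (0 : ℝ)..t, ∫ x in Ω, kk a b (s, x) = kI at *
  generalize ∫ x in Ω, gg θ (0, x) = gz at *
  generalize (ε ^ 2)⁻¹ = e at *
  unfold cC
  generalize cD c μ r κ K = D at *
  have e0 : 0 < e := by linarith
  have n1 : 0 ≤ μ / 4 * kI := by positivity
  have n2 : 0 ≤ κ / 8 * (e * gI) := by positivity
  have E0n : 0 ≤ E0 := by linarith
  have EE : E0 ≤ e * E0 := by nlinarith
  have a1 : e * gI ≤ 8 / κ * (e * E0) := by
    have : e * gI = 8 / κ * (κ / 8 * (e * gI)) := by field_simp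
    rw [this]
    exact mul_le_mul_of_nonneg_left (by linarith) (by positivity)
  have a2 : 2 * (e * kI) ≤ 8 / μ * (e * E0) := by
    have : 2 * (e * kI) = 8 / μ * (e * (μ / 4 * kI)) := by field_simp; ring
    rw [this]
    exact mul_le_mul_of_nonneg_left (mul_le_mul_of_nonneg_left (by linarith) e0.le) (by positivity)
  have a3 : e * hI = 6 * c / κ * (e * (κ / (6 * c) * hI)) := by field_simp
  rw [a3, mul_assoc]
  refine mul_le_mul_of_nonneg_left ?_ (by positivity)
  have a4 := mul_le_mul_of_nonneg_left h2 e0.le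
  have a5 := mul_le_mul_of_nonneg_left (add_le_add a1 a2) hD
  have x1 : 0 ≤ e * gz := by positivity
  have x2 : 0 ≤ e * E0 := by positivity
  have x3 : 0 ≤ D * (8 / κ + 8 / μ) * (e * gz) := by positivity
  linear_combination a4 + a5 + x1 / 2 + x2 + x3

end Sys
end

/-! ### Norms of iterated derivatives and the energy functionals -/

section
variable {G : Type*} [NormedAddCommGroup G] [NormedSpace ℝ G]

/-- Joint smoothness of a time-dependent field. -/
def Js (f : ℝ → ℝ × ℝ → G) : Prop := ContDiff ℝ (⊤ : ℕ∞) (Function.uncurry f)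

lemma Js.slice {f : ℝ → ℝ × ℝ → G} (hf : Js f) (s : ℝ) : ContDiff ℝ (⊤ : ℕ∞) (f s) :=
  ContDiff.comp (g := Function.uncurry f) hf (contDiff_prodMk_right s)

lemma Js.fd {f : ℝ → ℝ × ℝ → G} (hf : Js f) : Js (fun s => fderiv ℝ (f s)) := by
  unfold Js at *
  have : ContDiff ℝ (⊤ : ℕ∞) (fun p : ℝ × (ℝ × ℝ) => fderiv ℝ (f p.1) p.2) := by
    refine ContDiff.fderiv (m := (⊤ : ℕ∞)) (n := (⊤ : ℕ∞)) (f := fun (p : ℝ × (ℝ × ℝ)) (x : ℝ × ℝ) => f p.1 x) ?_ contDiff_snd (by simp)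
    exact hf.comp (contDiff_fst.fst.prodMk contDiff_snd)
  exact this

lemma Js.hasDt {f : ℝ → ℝ × ℝ → G} (hf : Js f) (t : ℝ) (x : ℝ × ℝ) :
    dt f t x = fderiv ℝ (Function.uncurry f) (t, x) ((1, 0) : ℝ × (ℝ × ℝ)) := by
  have h1 : HasFDerivAt (Function.uncurry f) (fderiv ℝ (Function.uncurry f) (t, x)) (t, x) :=
    (hf.differentiable (by simp) _).hasFDerivAt
  have h2 : HasDerivAt (fun s : ℝ => (s, x)) ((1, 0) : ℝ × (ℝ × ℝ)) t :=
    (hasDerivAt_id t).prodMk (hasDerivAt_const t x)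
  exact (h1.comp_hasDerivAt t h2).deriv

lemma Js.dt {f : ℝ → ℝ × ℝ → G} (hf : Js f) : Js (dt f) := by
  have : Function.uncurry (Couette.dt f)
      = fun p => fderiv ℝ (Function.uncurry f) p ((1, 0) : ℝ × (ℝ × ℝ)) := by
    funext p
    exact hf.hasDt p.1 p.2
  unfold Js
  rw [this]
  exact (ContDiff.fderiv_right (m := (⊤ : ℕ∞)) hf (by simp)).clm_apply contDiff_const

lemma Js.cont_iter.{u} (j : ℕ) : ∀ {G : Type u} [NormedAddCommGroup G] [NormedSpace ℝ G]
    {f : ℝ → ℝ × ℝ → G}, Js f →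
    Continuous (fun p : ℝ × (ℝ × ℝ) => ‖iteratedFDeriv ℝ j (f p.1) p.2‖) := by
  induction j with
  | zero =>
    intro G _ _ f hf
    simp only [norm_iteratedFDeriv_zero]
    exact (ContDiff.continuous hf).norm
  | succ j ih =>
    intro G _ _ f hf
    have := ih hf.fd
    simpa only [norm_iteratedFDeriv_fderiv] using this

lemma Js.int_iter {f : ℝ → ℝ × ℝ → G} (hf : Js f) (j : ℕ) (s : ℝ) :
    Integrable (fun x => ‖iteratedFDeriv ℝ j (f s) x‖ ^ 2) (volume.restrict Ω) := by
  have := hf.cont_iter j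
  refine intΩ (Continuous.continuousOn ?_)
  exact (this.comp (Continuous.prodMk_right s)).pow 2

/-- Boundedness from above on a time interval. -/
def Bd (T : ℝ) (g : ℝ → ℝ) : Prop := ∃ B, ∀ s ∈ Set.Icc (0 : ℝ) T, g s ≤ B

lemma Bd.add {T : ℝ} {g h : ℝ → ℝ} (hg : Bd T g) (hh : Bd T h) : Bd T (fun s => g s + h s) := by
  obtain ⟨B, hB⟩ := hg
  obtain ⟨C, hC⟩ := hh
  exact ⟨B + C, fun s hs => add_le_add (hB s hs) (hC s hs)⟩

lemma Bd.mul {T : ℝ} {g : ℝ → ℝ} (hg : Bd T g) {z : ℝ} (hz : 0 ≤ z) : Bd T (fun s => z * g s) := by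
  obtain ⟨B, hB⟩ := hg
  exact ⟨z * B, fun s hs => mul_le_mul_of_nonneg_left (hB s hs) hz⟩

lemma Bd.mono {T t : ℝ} {g : ℝ → ℝ} (hg : Bd T g) (ht : t ≤ T) : Bd t g := by
  obtain ⟨B, hB⟩ := hg
  exact ⟨B, fun s hs => hB s ⟨hs.1, hs.2.trans ht⟩⟩

lemma dSq_nonneg (j : ℕ) (f : ℝ × ℝ → G) : 0 ≤ dSq j f :=
  integral_nonneg fun x => by positivity

lemma HSq_nonneg (j : ℕ) (f : ℝ × ℝ → G) : 0 ≤ HSq j f :=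
  Finset.sum_nonneg fun _ _ => dSq_nonneg _ _

lemma Js.bd {f : ℝ → ℝ × ℝ → G} (hf : Js f) (j : ℕ) (T : ℝ) : Bd T (fun s => dSq j (f s)) := by
  have hc := (hf.cont_iter j).pow 2
  obtain ⟨B, hB⟩ := (KT_compact T).exists_bound_of_continuousOn hc.continuousOn
  refine ⟨B * (volume.restrict Ω).real Set.univ, fun s hs => ?_⟩
  have h1 : dSq j (f s) ≤ ∫ x in Ω, B := by
    refine setIntegral_mono_on (hf.int_iter j s) (integrableOn_const Ω_finite.ne) Ω_meas fun x hx => ?_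
    exact (le_abs_self _).trans (hB (s, x) (KT_Ω hs hx))
  refine h1.trans (le_of_eq ?_)
  simp [mul_comm]

lemma le_sup {t s : ℝ} {g : ℝ → ℝ} (hg : Bd t g) (hs : s ∈ Set.Icc 0 t) :
    g s ≤ ⨆ s ∈ Set.Icc (0 : ℝ) t, g s := by
  obtain ⟨B, hB⟩ := hg
  have hb : BddAbove (Set.range fun s => ⨆ (_ : s ∈ Set.Icc (0 : ℝ) t), g s) := by
    refine ⟨max B 0, ?_⟩
    rintro _ ⟨s, rfl⟩
    by_cases h : s ∈ Set.Icc (0 : ℝ) t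
    · simp only [ciSup_pos h]
      exact (hB s h).trans (le_max_left _ _)
    · have : IsEmpty (s ∈ Set.Icc (0 : ℝ) t) := ⟨h⟩
      simp only [Real.iSup_of_isEmpty]
      exact le_max_right _ _
  refine le_trans (le_of_eq ?_) (le_ciSup hb s)
  simp only [ciSup_pos hs]

lemma sup_nn {t : ℝ} {g : ℝ → ℝ} (hg : ∀ s, 0 ≤ g s) : 0 ≤ ⨆ s ∈ Set.Icc (0 : ℝ) t, g s :=
  Real.iSup_nonneg fun s => Real.iSup_nonneg fun _ => hg s

lemma ti_nn {t : ℝ} (ht : 0 ≤ t) {g : ℝ → ℝ} (hg : ∀ s, 0 ≤ g s) : 0 ≤ ∫ s in (0 : ℝ)..t, g s :=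
  intervalIntegral.integral_nonneg ht fun s _ => hg s

end

/-- The bounds extracted from `N ≤ 1`. -/
structure Ext (ε : ℝ) (φ : ℝ × ℝ → ℝ) (ψ : ℝ × ℝ → ℝ × ℝ) (θ : ℝ × ℝ → ℝ) : Prop where
  ψ0 : dSq 0 ψ ≤ ε ^ 2
  φ0 : dSq 0 φ ≤ ε ^ 4
  θ0 : dSq 0 θ ≤ ε ^ 4
  ψ1 : dSq 1 ψ ≤ 1
  φ1 : dSq 1 φ ≤ ε ^ 2
  θ1 : dSq 1 θ ≤ ε ^ 2
  ψ2 : ε ^ 2 * dSq 2 ψ ≤ 1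
  φ2 : dSq 2 φ ≤ 1
  θ2 : dSq 2 θ ≤ 1
  ψ3 : ε ^ 4 * dSq 3 ψ ≤ 1

lemma extract {ε T : ℝ} {φ θ : ℝ → ℝ × ℝ → ℝ} {ψ : ℝ → ℝ × ℝ → ℝ × ℝ} (hε : 0 < ε) (hT : 0 ≤ T)
    (hφ : Js φ) (hψ : Js ψ) (hθ : Js θ) (hN : Nfun ε φ ψ θ T ≤ 1) {s : ℝ} (hs : s ∈ Set.Icc 0 T) :
    Ext ε (φ s) (ψ s) (θ s) := by
  have e2 : 0 ≤ (ε ^ 2)⁻¹ := by positivity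
  have dn := fun j {G : Type} [NormedAddCommGroup G] [NormedSpace ℝ G] (f : ℝ × ℝ → G) =>
    dSq_nonneg j f
  have hn := fun j {G : Type} [NormedAddCommGroup G] [NormedSpace ℝ G] (f : ℝ × ℝ → G) =>
    HSq_nonneg j f
  have a0 : L2Sq (ψ s) + (ε ^ 2)⁻¹ * L2Sq (φ s) + (ε ^ 2)⁻¹ * L2Sq (θ s) ≤ A0 ε φ ψ θ T := by
    unfold A0
    have i := ti_nn hT (g := fun s => HSq 1 (ψ s) + (ε ^ 2)⁻¹ * HSq 1 (θ s)) fun s =>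
      add_nonneg (hn _ _) (mul_nonneg e2 (hn _ _))
    have := le_sup (g := fun s => L2Sq (ψ s) + (ε ^ 2)⁻¹ * L2Sq (φ s) + (ε ^ 2)⁻¹ * L2Sq (θ s))
      (((hψ.bd 0 T).add ((hφ.bd 0 T).mul e2)).add ((hθ.bd 0 T).mul e2)) hs
    linarith
  have a1 : dSq 1 (ψ s) + (ε ^ 2)⁻¹ * dSq 1 (θ s) ≤ A1 ε φ ψ θ T := by
    unfold A1
    have i := ti_nn hT (g := fun s => L2Sq (dt ψ s) + (ε ^ 2)⁻¹ * L2Sq (dt θ s)) fun s =>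
      add_nonneg (dn _ _) (mul_nonneg e2 (dn _ _))
    have := le_sup (g := fun s => dSq 1 (ψ s) + (ε ^ 2)⁻¹ * dSq 1 (θ s))
      ((hψ.bd 1 T).add ((hθ.bd 1 T).mul e2)) hs
    linarith
  have a2 : (ε ^ 2)⁻¹ * dSq 1 (φ s) ≤ A2 ε φ ψ θ T := by
    unfold A2
    have i := ti_nn hT (g := fun s => (ε ^ 4)⁻¹ * HSq 1 (φ s) + (ε ^ 2)⁻¹ * L2Sq (dt φ s)) fun s =>
      add_nonneg (mul_nonneg (by positivity) (hn _ _)) (mul_nonneg e2 (dn _ _))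
    have i' := ti_nn hT (g := fun s => HSq 2 (ψ s) + (ε ^ 2)⁻¹ * HSq 2 (θ s)) fun s =>
      add_nonneg (hn _ _) (mul_nonneg e2 (hn _ _))
    have := mul_le_mul_of_nonneg_left (le_sup (g := fun s => dSq 1 (φ s)) (hφ.bd 1 T) hs) e2
    linarith
  have a3 : 0 ≤ A3 ε φ ψ θ T := by
    unfold A3
    refine add_nonneg (sup_nn fun s => ?_) (ti_nn hT fun s => ?_)
    · exact add_nonneg (add_nonneg (mul_nonneg e2 (dn _ _)) (dn _ _)) (mul_nonneg e2 (dn _ _))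
    · exact add_nonneg (dn _ _) (mul_nonneg e2 (dn _ _))
  have a4 : (ε ^ 2)⁻¹ * dSq 2 (φ s) + dSq 2 (ψ s) + (ε ^ 2)⁻¹ * dSq 2 (θ s) ≤ A4 ε φ ψ θ T := by
    unfold A4
    have i := ti_nn hT (g := fun s => (ε ^ 4)⁻¹ * HSq 2 (φ s) + HSq 3 (ψ s) + (ε ^ 2)⁻¹ * HSq 3 (θ s))
      fun s => add_nonneg (add_nonneg (mul_nonneg (by positivity) (hn _ _)) (hn _ _))
        (mul_nonneg e2 (hn _ _))
    have := le_sup (g := fun s => (ε ^ 2)⁻¹ * dSq 2 (φ s) + dSq 2 (ψ s) + (ε ^ 2)⁻¹ * dSq 2 (θ s))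
      ((((hφ.bd 2 T).mul e2).add (hψ.bd 2 T)).add ((hθ.bd 2 T).mul e2)) hs
    linarith
  have a5 : dSq 3 (ψ s) ≤ A5 ε φ ψ θ T := by
    unfold A5
    have i := ti_nn hT (g := fun s => L2Sq (dt (dt ψ) s) + (ε ^ 2)⁻¹ * L2Sq (dt (dt θ) s)) fun s =>
      add_nonneg (dn _ _) (mul_nonneg e2 (dn _ _))
    have := le_sup (g := fun s => (ε ^ 2)⁻¹ * dSq 3 (φ s) + (dSq 3 (ψ s) + dSq 1 (dt ψ s))
        + (ε ^ 2)⁻¹ * (dSq 3 (θ s) + dSq 1 (dt θ s)))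
      ((((hφ.bd 3 T).mul e2).add ((hψ.bd 3 T).add (hψ.dt.bd 1 T))).add
        (((hθ.bd 3 T).add (hθ.dt.bd 1 T)).mul e2)) hs
    have p1 : 0 ≤ (ε ^ 2)⁻¹ * dSq 3 (φ s) := mul_nonneg e2 (dn _ _)
    have p2 : 0 ≤ (ε ^ 2)⁻¹ * (dSq 3 (θ s) + dSq 1 (dt θ s)) :=
      mul_nonneg e2 (add_nonneg (dn _ _) (dn _ _))
    have p3 := dn 1 (dt ψ s)
    linarith
  unfold L2Sq at a0
  unfold Nfun at hN
  have b0 := mul_le_mul_of_nonneg_left a0 e2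
  have b3 := mul_nonneg (by positivity : 0 ≤ ε ^ 2) a3
  have b4 := mul_le_mul_of_nonneg_left a4 (by positivity : 0 ≤ ε ^ 2)
  have b5 := mul_le_mul_of_nonneg_left a5 (by positivity : 0 ≤ ε ^ 4)
  have n1 := dn 0 (φ s)
  have n2 := dn 0 (ψ s)
  have n3 := dn 0 (θ s)
  have n4 := dn 1 (φ s)
  have n5 := dn 1 (ψ s)
  have n6 := dn 1 (θ s)
  have n7 := dn 2 (φ s)
  have n8 := dn 2 (ψ s)
  have n9 := dn 2 (θ s)
  have n10 := dn 3 (ψ s)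
  have c1 : ε ^ 2 * ((ε ^ 2)⁻¹ * dSq 2 (φ s) + dSq 2 (ψ s) + (ε ^ 2)⁻¹ * dSq 2 (θ s))
    = dSq 2 (φ s) + ε ^ 2 * dSq 2 (ψ s) + dSq 2 (θ s) := by field_simp
  have c0 : (ε ^ 2)⁻¹ * (dSq 0 (ψ s) + (ε ^ 2)⁻¹ * dSq 0 (φ s) + (ε ^ 2)⁻¹ * dSq 0 (θ s))
    = (ε ^ 2)⁻¹ * dSq 0 (ψ s) + (ε ^ 4)⁻¹ * dSq 0 (φ s) + (ε ^ 4)⁻¹ * dSq 0 (θ s) := by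
    field_simp
  rw [c1] at b4
  rw [c0] at b0
  have e4 : 0 ≤ (ε ^ 4)⁻¹ := by positivity
  have q1 := mul_nonneg e2 n2
  have q2 := mul_nonneg e4 n1
  have q3 := mul_nonneg e4 n3
  have q4 := mul_nonneg e2 n4
  have q5 := mul_nonneg e2 n6
  have q6 := mul_nonneg (by positivity : 0 ≤ ε ^ 2) n8
  have q7 := mul_nonneg (by positivity : 0 ≤ ε ^ 4) n10
  have inv2 : ∀ z : ℝ, (ε ^ 2)⁻¹ * z ≤ 1 → z ≤ ε ^ 2 := fun z hz => by
    rwa [inv_mul_le_iff₀ (by positivity), mul_one] at hz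
  have inv4 : ∀ z : ℝ, (ε ^ 4)⁻¹ * z ≤ 1 → z ≤ ε ^ 4 := fun z hz => by
    rwa [inv_mul_le_iff₀ (by positivity), mul_one] at hz
  constructor
  · exact inv2 _ (by linarith)
  · exact inv4 _ (by linarith)
  · exact inv4 _ (by linarith)
  · linarith
  · exact inv2 _ (by linarith)
  · exact inv2 _ (by linarith)
  · linarith
  · linarith
  · linarith
  · linarith

/-- Initial values of the functionals control the initial norms. -/
lemma init_bd {ε : ℝ} {φ θ : ℝ → ℝ × ℝ → ℝ} {ψ : ℝ → ℝ × ℝ → ℝ × ℝ} (hε : 0 < ε)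
    (hφ : Js φ) (hψ : Js ψ) (hθ : Js θ) :
    dSq 0 (ψ 0) + (ε ^ 2)⁻¹ * dSq 0 (φ 0) + (ε ^ 2)⁻¹ * dSq 0 (θ 0) ≤ A0 ε φ ψ θ 0
    ∧ dSq 1 (ψ 0) + (ε ^ 2)⁻¹ * dSq 1 (θ 0) ≤ A1 ε φ ψ θ 0 := by
  have e2 : 0 ≤ (ε ^ 2)⁻¹ := by positivity
  have h0 : (0 : ℝ) ∈ Set.Icc (0 : ℝ) 0 := ⟨le_rfl, le_rfl⟩
  constructor
  · unfold A0
    rw [intervalIntegral.integral_same, add_zero]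
    exact le_sup (g := fun s => L2Sq (ψ s) + (ε ^ 2)⁻¹ * L2Sq (φ s) + (ε ^ 2)⁻¹ * L2Sq (θ s))
      (((hψ.bd 0 0).add ((hφ.bd 0 0).mul e2)).add ((hθ.bd 0 0).mul e2)) h0
  · unfold A1
    rw [intervalIntegral.integral_same, add_zero]
    exact le_sup (g := fun s => dSq 1 (ψ s) + (ε ^ 2)⁻¹ * dSq 1 (θ s))
      ((hψ.bd 1 0).add ((hθ.bd 1 0).mul e2)) h0

/-! ### Translation between the two descriptions of derivatives -/

lemma slice_fd {g : E3 → ℝ} (hg : Sm g) (s : ℝ) (x w : ℝ × ℝ) :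
    fderiv ℝ (fun x : ℝ × ℝ => g (s, x)) x w = DD (0, w) g (s, x) := by
  have h1 : HasFDerivAt (fun x : ℝ × ℝ => ((s, x) : E3)) (ContinuousLinearMap.inr ℝ ℝ (ℝ × ℝ)) x :=
    hasFDerivAt_prodMk_right s x
  have h2 := ((hg.diff (s, x)).hasFDerivAt).comp x h1
  have h3 : HasFDerivAt (fun x : ℝ × ℝ => g (s, x))
    ((fderiv ℝ g (s, x)).comp (ContinuousLinearMap.inr ℝ ℝ (ℝ × ℝ))) x := h2
  rw [h3.fderiv]
  rfl

lemma slice_d1 {g : E3 → ℝ} (hg : Sm g) (s : ℝ) :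
    d1 (fun x : ℝ × ℝ => g (s, x)) = fun x => DD v1 g (s, x) := by
  funext x; exact slice_fd hg s x (1, 0)

lemma slice_d2 {g : E3 → ℝ} (hg : Sm g) (s : ℝ) :
    d2 (fun x : ℝ × ℝ => g (s, x)) = fun x => DD v2 g (s, x) := by
  funext x; exact slice_fd hg s x (0, 1)

lemma slice_cd {g : E3 → ℝ} (hg : Sm g) (s : ℝ) :
    ContDiff ℝ (⊤ : ℕ∞) (fun x : ℝ × ℝ => g (s, x)) :=
  ContDiff.comp (g := g) hg (contDiff_prodMk_right s)

lemma it_comp_left {G H : Type*} [NormedAddCommGroup G] [NormedSpace ℝ G] [NormedAddCommGroup H]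
    [NormedSpace ℝ H] (L : G →L[ℝ] H) {f : ℝ × ℝ → G} {x : ℝ × ℝ} {n : WithTop ℕ∞}
    (hf : ContDiffAt ℝ n f x) {i : ℕ} (hi : (i : WithTop ℕ∞) ≤ n) :
    ‖iteratedFDeriv ℝ i (L ∘ f) x‖ ≤ ‖L‖ * ‖iteratedFDeriv ℝ i f x‖ := by
  rw [L.iteratedFDeriv_comp_left hf hi]
  exact L.norm_compContinuousMultilinearMap_le _

lemma iter_fd_apply {f : ℝ × ℝ → ℝ} (hf : ContDiff ℝ (⊤ : ℕ∞) f) (k : ℕ) {w : ℝ × ℝ} (hw : ‖w‖ ≤ 1)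
    (x : ℝ × ℝ) :
    ‖iteratedFDeriv ℝ k (fun y => fderiv ℝ f y w) x‖ ≤ ‖iteratedFDeriv ℝ (k + 1) f x‖ := by
  have hd : ContDiff ℝ (⊤ : ℕ∞) (fderiv ℝ f) := hf.fderiv_right (by simp)
  have h1 : (fun y => fderiv ℝ f y w) = (ContinuousLinearMap.apply ℝ ℝ w) ∘ (fderiv ℝ f) := rfl
  rw [h1, ← norm_iteratedFDeriv_fderiv]
  have h2 := it_comp_left (ContinuousLinearMap.apply ℝ ℝ w)
    (hd.contDiffAt (x := x)) (i := k) (by exact_mod_cast le_top)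
  refine h2.trans ?_
  have h3 : ‖ContinuousLinearMap.apply ℝ ℝ w‖ ≤ 1 := by
    refine ContinuousLinearMap.opNorm_le_bound _ zero_le_one fun L => ?_
    rw [one_mul]
    calc ‖L w‖ ≤ ‖L‖ * ‖w‖ := L.le_opNorm w
      _ ≤ ‖L‖ * 1 := by gcongr
      _ = ‖L‖ := mul_one _
  calc _ ≤ 1 * ‖iteratedFDeriv ℝ k (fderiv ℝ f) x‖ := by gcongr
    _ = _ := one_mul _

lemma it_v1 {g : E3 → ℝ} (hg : Sm g) (s : ℝ) (k : ℕ) (x : ℝ × ℝ) :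
    ‖iteratedFDeriv ℝ k (fun y : ℝ × ℝ => DD v1 g (s, y)) x‖
      ≤ ‖iteratedFDeriv ℝ (k + 1) (fun y : ℝ × ℝ => g (s, y)) x‖ := by
  rw [← slice_d1 hg s]
  exact iter_fd_apply (slice_cd hg s) k (by simp [Prod.norm_def]) x

lemma it_v2 {g : E3 → ℝ} (hg : Sm g) (s : ℝ) (k : ℕ) (x : ℝ × ℝ) :
    ‖iteratedFDeriv ℝ k (fun y : ℝ × ℝ => DD v2 g (s, y)) x‖
      ≤ ‖iteratedFDeriv ℝ (k + 1) (fun y : ℝ × ℝ => g (s, y)) x‖ := by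
  rw [← slice_d2 hg s]
  exact iter_fd_apply (slice_cd hg s) k (by simp [Prod.norm_def]) x

lemma it_0 (f : ℝ × ℝ → ℝ) (x : ℝ × ℝ) : ‖iteratedFDeriv ℝ 0 f x‖ = |f x| := by
  rw [norm_iteratedFDeriv_zero, Real.norm_eq_abs]

/-- Control of the squared `L²` norms of scalar derivatives by a bound on iterated derivatives. -/
structure Ctl (s : ℝ) (g : E3 → ℝ) (N : ℕ → ℝ × ℝ → ℝ) : Prop where
  sm : Sm g
  ci : ∀ k, IntegrableOn (fun x => N k x ^ 2) Ω
  le : ∀ k x, ‖iteratedFDeriv ℝ k (fun y : ℝ × ℝ => g (s, y)) x‖ ≤ N k x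

lemma Ctl.v1 {s : ℝ} {g : E3 → ℝ} {N : ℕ → ℝ × ℝ → ℝ} (h : Ctl s g N) :
    Ctl s (DD v1 g) (fun k => N (k + 1)) :=
  ⟨h.sm.dd _, fun _ => h.ci _, fun k x => (it_v1 h.sm s k x).trans (h.le _ _)⟩

lemma Ctl.v2 {s : ℝ} {g : E3 → ℝ} {N : ℕ → ℝ × ℝ → ℝ} (h : Ctl s g N) :
    Ctl s (DD v2 g) (fun k => N (k + 1)) :=
  ⟨h.sm.dd _, fun _ => h.ci _, fun k x => (it_v2 h.sm s k x).trans (h.le _ _)⟩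

lemma Ctl.pt {s : ℝ} {g : E3 → ℝ} {N : ℕ → ℝ × ℝ → ℝ} (h : Ctl s g N) (x : ℝ × ℝ) :
    g (s, x) ^ 2 ≤ N 0 x ^ 2 := by
  have := h.le 0 x
  rw [it_0] at this
  exact sq_le_sq' (by linarith [neg_abs_le (g (s, x))]) ((le_abs_self _).trans this)

lemma Ctl.int {s : ℝ} {g : E3 → ℝ} {N : ℕ → ℝ × ℝ → ℝ} (h : Ctl s g N) :
    ∫ x in Ω, g (s, x) ^ 2 ≤ ∫ x in Ω, N 0 x ^ 2 := by
  refine setIntegral_mono_on ?_ (h.ci 0) Ω_meas fun x _ => h.pt x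
  have := h.sm.continuous
  exact intΩ (Continuous.continuousOn (by fun_prop))

lemma Ctl.of_scalar {f : ℝ → ℝ × ℝ → ℝ} (hf : Js f) (s : ℝ) :
    Ctl s (Function.uncurry f) (fun k x => ‖iteratedFDeriv ℝ k (f s) x‖) :=
  ⟨hf, fun k => hf.int_iter k s, fun _ _ => le_rfl⟩

/-- First component of a time-dependent vector field. -/
def cp1 (ψ : ℝ → ℝ × ℝ → ℝ × ℝ) (p : E3) : ℝ := (ψ p.1 p.2).1

/-- Second component of a time-dependent vector field. -/
def cp2 (ψ : ℝ → ℝ × ℝ → ℝ × ℝ) (p : E3) : ℝ := (ψ p.1 p.2).2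

lemma cp1_sm {ψ : ℝ → ℝ × ℝ → ℝ × ℝ} (hψ : Js ψ) : Sm (cp1 ψ) := ContDiff.fst hψ

lemma cp2_sm {ψ : ℝ → ℝ × ℝ → ℝ × ℝ} (hψ : Js ψ) : Sm (cp2 ψ) := ContDiff.snd hψ

lemma iter_clm {f : ℝ × ℝ → ℝ × ℝ} (hf : ContDiff ℝ (⊤ : ℕ∞) f) (L : ℝ × ℝ →L[ℝ] ℝ) (hL : ‖L‖ ≤ 1)
    (k : ℕ) (x : ℝ × ℝ) : ‖iteratedFDeriv ℝ k (L ∘ f) x‖ ≤ ‖iteratedFDeriv ℝ k f x‖ := by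
  have h2 := it_comp_left L
    (hf.contDiffAt (x := x)) (i := k) (by exact_mod_cast le_top)
  refine h2.trans ?_
  calc _ ≤ 1 * ‖iteratedFDeriv ℝ k f x‖ := by gcongr
    _ = _ := one_mul _

lemma Ctl.of_fst {f : ℝ → ℝ × ℝ → ℝ × ℝ} (hf : Js f) (s : ℝ) :
    Ctl s (cp1 f) (fun k x => ‖iteratedFDeriv ℝ k (f s) x‖) :=
  ⟨cp1_sm hf, fun k => hf.int_iter k s, fun k x =>
    iter_clm (hf.slice s) (ContinuousLinearMap.fst ℝ ℝ ℝ) (ContinuousLinearMap.norm_fst_le ℝ ℝ ℝ) k x⟩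

lemma Ctl.of_snd {f : ℝ → ℝ × ℝ → ℝ × ℝ} (hf : Js f) (s : ℝ) :
    Ctl s (cp2 f) (fun k x => ‖iteratedFDeriv ℝ k (f s) x‖) :=
  ⟨cp2_sm hf, fun k => hf.int_iter k s, fun k x =>
    iter_clm (hf.slice s) (ContinuousLinearMap.snd ℝ ℝ ℝ) (ContinuousLinearMap.norm_snd_le ℝ ℝ ℝ) k x⟩

/-- Pointwise bound from the control of derivatives. -/
lemma Ctl.sup {s : ℝ} {g : E3 → ℝ} {N : ℕ → ℝ × ℝ → ℝ} (h : Ctl s g N) {ε M : ℝ} (hε : 0 < ε)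
    (hε1 : ε ≤ 1) (hM : 0 ≤ M) (h0 : ∫ x in Ω, N 0 x ^ 2 ≤ ε ^ 2 * M ^ 2)
    (h1 : ∫ x in Ω, N 1 x ^ 2 ≤ M ^ 2) (h2 : ε ^ 2 * ∫ x in Ω, N 2 x ^ 2 ≤ M ^ 2)
    {x : ℝ × ℝ} (hx : x ∈ Kc) : |g (s, x)| ≤ 3 * M := by
  refine sup_bound h.sm hε hε1 hM (h.int.trans h0) (h.v1.int.trans h1) (h.v2.int.trans h1) ?_ hx
  refine le_trans ?_ h2
  exact mul_le_mul_of_nonneg_left h.v2.v1.int (by positivity)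

lemma iter_two_le {g : E3 → ℝ} (hg : Sm g) (s : ℝ) (x : ℝ × ℝ) :
    ‖iteratedFDeriv ℝ 2 (fun y : ℝ × ℝ => g (s, y)) x‖ ^ 2 ≤ 4 * hh g (s, x) := by
  set f : ℝ × ℝ → ℝ := fun y => g (s, y) with hfdef
  have hf : ContDiff ℝ (⊤ : ℕ∞) f := slice_cd hg s
  have hd : Differentiable ℝ (fderiv ℝ f) :=
    (hf.fderiv_right (m := (⊤ : ℕ∞)) (by simp)).differentiable (by simp)
  have key : ∀ v w : ℝ × ℝ, DD (0, v) (DD (0, w) g) (s, x) = fderiv ℝ (fderiv ℝ f) x v w := by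
    intro v w
    have h2 : HasFDerivAt (fun y => fderiv ℝ f y w)
        ((ContinuousLinearMap.apply ℝ ℝ w).comp (fderiv ℝ (fderiv ℝ f) x)) x :=
      (ContinuousLinearMap.apply ℝ ℝ w).hasFDerivAt.comp x (hd x).hasFDerivAt
    have h3 : (fun y => fderiv ℝ f y w) = fun y => DD (0, w) g (s, y) := by
      funext y; exact slice_fd hg s y w
    rw [h3] at h2
    rw [← slice_fd (hg.dd _) s x v, h2.fderiv]; rfl
  have hn : ‖iteratedFDeriv ℝ 2 f x‖ = ‖fderiv ℝ (fderiv ℝ f) x‖ := by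
    rw [← norm_iteratedFDeriv_fderiv (n := 1), norm_iteratedFDeriv_one]
  set A := DD v1 (DD v1 g) (s, x) with hA
  set B := DD v1 (DD v2 g) (s, x) with hB
  set C := DD v2 (DD v2 g) (s, x) with hC
  have hB' : DD v2 (DD v1 g) (s, x) = B := hg.dd_comm _ _ _
  have hb : ‖fderiv ℝ (fderiv ℝ f) x‖ ≤ |A| + 2 * |B| + |C| := by
    refine ContinuousLinearMap.opNorm_le_bound₂ _ (by positivity) fun v w => ?_
    have ev : v = v.1 • ((1, 0) : ℝ × ℝ) + v.2 • ((0, 1) : ℝ × ℝ) := by ext <;> simp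
    have ew : w = w.1 • ((1, 0) : ℝ × ℝ) + w.2 • ((0, 1) : ℝ × ℝ) := by ext <;> simp
    have e : fderiv ℝ (fderiv ℝ f) x v w
        = v.1 * w.1 * A + v.1 * w.2 * B + v.2 * w.1 * B + v.2 * w.2 * C := by
      conv_lhs => rw [ev, ew]
      simp only [map_add, map_smul, add_apply, smul_apply,
        ← key, smul_eq_mul]
      change _ * (_ * DD v1 (DD v1 g) (s, x) + _ * DD v2 (DD v1 g) (s, x))
        + _ * (_ * DD v1 (DD v2 g) (s, x) + _ * DD v2 (DD v2 g) (s, x)) = _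
      rw [hB']
      ring
    have nv1 : |v.1| ≤ ‖v‖ := norm_fst_le v
    have nv2 : |v.2| ≤ ‖v‖ := norm_snd_le v
    have nw1 : |w.1| ≤ ‖w‖ := norm_fst_le w
    have nw2 : |w.2| ≤ ‖w‖ := norm_snd_le w
    rw [e, Real.norm_eq_abs]
    have t : ∀ z1 z2 z3 : ℝ, |z1| ≤ ‖v‖ → |z2| ≤ ‖w‖ → |z1 * z2 * z3| ≤ ‖v‖ * ‖w‖ * |z3| := by
      intro z1 z2 z3 h1 h2
      rw [abs_mul, abs_mul]
      gcongr
    have t1 := t v.1 w.1 A nv1 nw1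
    have t2 := t v.1 w.2 B nv1 nw2
    have t3 := t v.2 w.1 B nv2 nw1
    have t4 := t v.2 w.2 C nv2 nw2
    have a1 := abs_add_le (v.1 * w.1 * A + v.1 * w.2 * B + v.2 * w.1 * B) (v.2 * w.2 * C)
    have a2 := abs_add_le (v.1 * w.1 * A + v.1 * w.2 * B) (v.2 * w.1 * B)
    have a3 := abs_add_le (v.1 * w.1 * A) (v.1 * w.2 * B)
    linarith only [t1, t2, t3, t4, a1, a2, a3]
  rw [hn]
  have h1 : ‖fderiv ℝ (fderiv ℝ f) x‖ ^ 2 ≤ (|A| + 2 * |B| + |C|) ^ 2 := by gcongr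
  refine h1.trans ?_
  unfold hh
  rw [← hA, ← hB, ← hC, ← sq_abs A, ← sq_abs B, ← sq_abs C]
  linarith only [sq_nonneg (|A| - |B|), sq_nonneg (|A| - |C|), sq_nonneg (|B| - |C|)]

lemma dSq_two_le {f : ℝ → ℝ × ℝ → ℝ} (hf : Js f) {T t : ℝ} (ht : t ∈ Set.Icc 0 T) :
    ∫ s in (0 : ℝ)..t, dSq 2 (f s)
      ≤ 4 * ∫ s in (0 : ℝ)..t, ∫ x in Ω, hh (Function.uncurry f) (s, x) := by
  have c1 : Continuous (fun p : E3 => ‖iteratedFDeriv ℝ 2 (f p.1) p.2‖ ^ 2) := (hf.cont_iter 2).pow 2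
  have c2 : Continuous (fun p : E3 => 4 * hh (Function.uncurry f) p) :=
    continuous_const.mul (cont_hh hf)
  have h := timeMono (T := T) c1.continuousOn c2.continuousOn (fun s hs => ?_) ht
  · simp only [integral_const_mul, intervalIntegral.integral_const_mul] at h
    exact h
  · refine setIntegral_mono_on (intΩ (sliceT c1.continuousOn hs)) (intΩ (sliceT c2.continuousOn hs))
      Ω_meas fun x _ => ?_
    exact iter_two_le (g := Function.uncurry f) hf s x

/-! ### The perturbation system in coordinates: translation -/

/-- Background temperature as a function of the height. -/
def τf (γ Pr ε χ : ℝ) (y : ℝ) : ℝ :=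
  χ + (1 - χ) * y - ε ^ 2 * Pr / (2 * (γ / (γ - 1))) * (y ^ 2 - y)

/-- Derivative of the background temperature. -/
def τf1 (γ Pr ε χ : ℝ) (y : ℝ) : ℝ :=
  (1 - χ) - ε ^ 2 * Pr / (2 * (γ / (γ - 1))) * (2 * y - 1)

lemma τf_hd (γ Pr ε χ y : ℝ) : HasDerivAt (τf γ Pr ε χ) (τf1 γ Pr ε χ y) y := by
  have h := (((hasDerivAt_id y).const_mul (1 - χ)).const_add χ).sub
    ((((hasDerivAt_id y).pow 2).sub (hasDerivAt_id y)).const_mul (ε ^ 2 * Pr / (2 * (γ / (γ - 1)))))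
  refine (h.congr_deriv ?_)
  unfold τf1
  simp

lemma tT_hd (γ Pr ε χ : ℝ) (x : ℝ × ℝ) :
    HasFDerivAt (tT γ Pr ε χ) (τf1 γ Pr ε χ x.2 • ContinuousLinearMap.snd ℝ ℝ ℝ) x :=
  (τf_hd γ Pr ε χ x.2).comp_hasFDerivAt x (hasFDerivAt_snd)

lemma tρ_hd {γ Pr ε χ : ℝ} {x : ℝ × ℝ} (hx : τf γ Pr ε χ x.2 ≠ 0) :
    HasFDerivAt (tρ γ Pr ε χ) ((-(τf1 γ Pr ε χ x.2 * (τf γ Pr ε χ x.2)⁻¹ ^ 2)) •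
      ContinuousLinearMap.snd ℝ ℝ ℝ) x := by
  have h := (τf_hd γ Pr ε χ x.2).inv hx
  have h2 : HasFDerivAt (tρ γ Pr ε χ) ((-τf1 γ Pr ε χ x.2 / τf γ Pr ε χ x.2 ^ 2) •
      ContinuousLinearMap.snd ℝ ℝ ℝ) x := h.comp_hasFDerivAt x
    (hasFDerivAt_snd (𝕜 := ℝ) (E := ℝ) (F := ℝ) (p := x))
  convert h2 using 2
  rw [inv_pow, neg_div, div_eq_mul_inv]

/-- Directional derivatives of the pressure. -/
lemma press_hd {γ Pr ε χ : ℝ} {φ θ : ℝ → ℝ × ℝ → ℝ} (hφ : Js φ) (hθ : Js θ) {t : ℝ} {x : ℝ × ℝ}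
    (hx : τf γ Pr ε χ x.2 ≠ 0) (w : ℝ × ℝ) :
    fderiv ℝ (fun y => pρ γ Pr ε χ φ t y * pT γ Pr ε χ θ t y) x w
      = ((τf γ Pr ε χ x.2)⁻¹ + φ t x) * (τf1 γ Pr ε χ x.2 * w.2 + fderiv ℝ (θ t) x w)
        + (-(τf1 γ Pr ε χ x.2 * (τf γ Pr ε χ x.2)⁻¹ ^ 2) * w.2 + fderiv ℝ (φ t) x w)
          * (τf γ Pr ε χ x.2 + θ t x) := by
  have a1 := (tρ_hd hx).add (((hφ.slice t).differentiable (by simp)) x).hasFDerivAt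
  have a2 := (tT_hd γ Pr ε χ x).add (((hθ.slice t).differentiable (by simp)) x).hasFDerivAt
  have h : HasFDerivAt (fun y => pρ γ Pr ε χ φ t y * pT γ Pr ε χ θ t y) _ x := a1.mul a2
  rw [h.fderiv]
  simp only [add_apply, smul_apply, smul_eq_mul, ContinuousLinearMap.coe_snd', Pi.add_apply]
  change ((τf γ Pr ε χ x.2)⁻¹ + φ t x) * _ + (τf γ Pr ε χ x.2 + θ t x) * _ = _
  ring

lemma grad_tT (γ Pr ε χ : ℝ) (x : ℝ × ℝ) : grad (tT γ Pr ε χ) x = (0, τf1 γ Pr ε χ x.2) := by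
  unfold grad d1 d2
  rw [(tT_hd γ Pr ε χ x).fderiv]
  simp

lemma grad_tρ {γ Pr ε χ : ℝ} {x : ℝ × ℝ} (hx : τf γ Pr ε χ x.2 ≠ 0) : grad (tρ γ Pr ε χ) x
    = (0, -(τf1 γ Pr ε χ x.2 * (τf γ Pr ε χ x.2)⁻¹ ^ 2)) := by
  unfold grad d1 d2
  rw [(tρ_hd hx).fderiv]
  simp

lemma fd_tu1 (x : ℝ × ℝ) : fderiv ℝ (fun y => (tu y).1) x = ContinuousLinearMap.snd ℝ ℝ ℝ :=
  (hasFDerivAt_snd (𝕜 := ℝ) (p := x)).fderiv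

lemma fd_tu2 (x : ℝ × ℝ) : fderiv ℝ (fun y => (tu y).2) x = 0 :=
  (hasFDerivAt_const (0 : ℝ) x).fderiv

lemma grad_tu1 (x : ℝ × ℝ) : grad (fun y => (tu y).1) x = (0, 1) := by
  unfold grad d1 d2
  rw [fd_tu1]
  simp

lemma grad_tu2 (x : ℝ × ℝ) : grad (fun y => (tu y).2) x = (0, 0) := by
  unfold grad d1 d2
  rw [fd_tu2]
  simp

lemma dt_fst {ψ : ℝ → ℝ × ℝ → ℝ × ℝ} (hψ : Js ψ) (t : ℝ) (x : ℝ × ℝ) :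
    (dt ψ t x).1 = DD vt (cp1 ψ) (t, x) := by
  rw [hψ.hasDt]
  have h := ((hψ.differentiable (by simp)) (t, x)).hasFDerivAt.fst
  have h' : HasFDerivAt (cp1 ψ) _ (t, x) := h
  unfold DD
  rw [h'.fderiv]
  rfl

lemma dt_snd {ψ : ℝ → ℝ × ℝ → ℝ × ℝ} (hψ : Js ψ) (t : ℝ) (x : ℝ × ℝ) :
    (dt ψ t x).2 = DD vt (cp2 ψ) (t, x) := by
  rw [hψ.hasDt]
  have h := ((hψ.differentiable (by simp)) (t, x)).hasFDerivAt.snd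
  have h' : HasFDerivAt (cp2 ψ) _ (t, x) := h
  unfold DD
  rw [h'.fderiv]
  rfl

lemma grad_s {g : E3 → ℝ} (hg : Sm g) (t : ℝ) (x : ℝ × ℝ) :
    grad (fun y : ℝ × ℝ => g (t, y)) x = (DD v1 g (t, x), DD v2 g (t, x)) := by
  unfold grad
  rw [slice_d1 hg, slice_d2 hg]

lemma lap_s {g : E3 → ℝ} (hg : Sm g) (t : ℝ) (x : ℝ × ℝ) :
    lap (fun y : ℝ × ℝ => g (t, y)) x = DD v1 (DD v1 g) (t, x) + DD v2 (DD v2 g) (t, x) := by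
  unfold lap
  rw [slice_d1 hg, slice_d2 hg, slice_d1 (hg.dd _), slice_d2 (hg.dd _)]

lemma divv_s {ψ : ℝ → ℝ × ℝ → ℝ × ℝ} (hψ : Js ψ) (t : ℝ) :
    divv (ψ t) = fun x => (DD v1 (cp1 ψ) + DD v2 (cp2 ψ)) (t, x) := by
  funext x
  have h1 := congrFun (slice_d1 (cp1_sm hψ) t) x
  have h2 := congrFun (slice_d2 (cp2_sm hψ) t) x
  unfold divv
  rw [Pi.add_apply, ← h1, ← h2]
  rfl

lemma DD_add {f g : E3 → ℝ} (hf : Sm f) (hg : Sm g) (v p : E3) :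
    DD v (f + g) p = DD v f p + DD v g p := by
  unfold DD
  rw [fderiv_add (hf.diff p) (hg.diff p)]
  rfl


lemma τf_bounds {γ Pr ε χ Kχ : ℝ} (hγ : 1 < γ) (hPr : 0 < Pr) (hε : 0 < ε) (hε1 : ε ≤ 1)
    (hεP : ε * Pr ≤ 1) (h1 : |1 - χ| ≤ Kχ * ε) (h2 : |1 - χ| ≤ 1 / 2) {y : ℝ}
    (hy : y ∈ Set.Icc (0 : ℝ) 1) :
    1 / 2 ≤ τf γ Pr ε χ y ∧ τf γ Pr ε χ y ≤ 2 ∧ |τf1 γ Pr ε χ y| ≤ (Kχ + Pr) * ε := by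
  have hC : 1 ≤ γ / (γ - 1) := by
    rw [le_div_iff₀ (by linarith)]; linarith
  obtain ⟨z, hz⟩ : ∃ z, z = ε ^ 2 * Pr / (2 * (γ / (γ - 1))) := ⟨_, rfl⟩
  have hz0 : 0 ≤ z := by
    rw [hz]; positivity
  have hz1 : z ≤ ε * (ε * Pr) / 2 := by
    rw [hz, show ε * (ε * Pr) = ε ^ 2 * Pr by ring]
    apply div_le_div_of_nonneg_left (by positivity) (by norm_num) (by linarith)
  have hz2 : z ≤ 1 / 2 := by
    have : ε * (ε * Pr) ≤ 1 * 1 := by gcongr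
    linarith
  have hz3 : z ≤ ε * Pr / 2 := by
    have : ε * (ε * Pr) ≤ 1 * (ε * Pr) := by gcongr
    linarith
  obtain ⟨y0, y1⟩ := hy
  obtain ⟨c1, c2⟩ := abs_le.1 h2
  have w0 : 0 ≤ y - y ^ 2 := by
    have := mul_nonneg y0 (sub_nonneg.2 y1); linarith
  have w1 : y - y ^ 2 ≤ 1 := by linarith [sq_nonneg y]
  have e0 : 0 ≤ z * (y - y ^ 2) := mul_nonneg hz0 w0
  have e1 : z * (y - y ^ 2) ≤ z * 1 := mul_le_mul_of_nonneg_left w1 hz0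
  have f0 : -(1 / 2) * (1 - y) ≤ (χ - 1) * (1 - y) :=
    mul_le_mul_of_nonneg_right (by linarith) (by linarith)
  have f1 : (χ - 1) * (1 - y) ≤ 1 / 2 * (1 - y) :=
    mul_le_mul_of_nonneg_right (by linarith) (by linarith)
  have ht : τf γ Pr ε χ y = 1 + (χ - 1) * (1 - y) + z * (y - y ^ 2) := by
    unfold τf; rw [← hz]; ring
  have ht1 : τf1 γ Pr ε χ y = (1 - χ) - z * (2 * y - 1) := by
    unfold τf1; rw [← hz]
  refine ⟨by rw [ht]; linarith, by rw [ht]; linarith, ?_⟩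
  rw [ht1]
  have g1 : |z * (2 * y - 1)| ≤ z * 1 := by
    rw [abs_mul, abs_of_nonneg hz0]
    exact mul_le_mul_of_nonneg_left (abs_le.2 ⟨by linarith, by linarith⟩) hz0
  have g2 := abs_sub (1 - χ) (z * (2 * y - 1))
  have g3 : 0 ≤ ε * Pr := by positivity
  linarith

/-- A solution of the perturbation system in coordinates. -/
lemma sys_of {γ Pr r Re ε χ T Kχ : ℝ} (S : PerturbSol γ Pr r Re ε χ T) (hS : SmoothSol S)
    (hγ : 1 < γ) (hPr : 0 < Pr) (hr : 0 < 1 + r) (hKχ : 0 < Kχ) (hRe : 0 < Re) (hε : 0 < ε)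
    (hε1 : 3 * ε ≤ 1 / 4) (hεP : ε * Pr ≤ 1) (h1 : |1 - χ| ≤ Kχ * ε) (h2 : |1 - χ| ≤ 1 / 2)
    (hT : 0 < T) (hN : Nfun ε S.φ S.ψ S.θ T ≤ 1) :
    Sys (1 / (γ - 1)) Re⁻¹ r (γ / (γ - 1) / (Re * Pr)) ε T (Kχ + Pr) (τf γ Pr ε χ) (τf1 γ Pr ε χ)
      (cp1 S.ψ) (cp2 S.ψ) (Function.uncurry S.φ) (Function.uncurry S.θ) := by
  have hφ : Js S.φ := hS.1
  have hψ : Js S.ψ := hS.2.1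
  have hθ : Js S.θ := hS.2.2
  have hg : 0 < γ - 1 := by linarith
  have hg0 : 0 < γ := by linarith
  have hεl : ε ≤ 1 := by linarith
  have hE := fun s (hs : s ∈ Set.Icc 0 T) => extract hε hT.le hφ hψ hθ hN hs
  have sa := cp1_sm hψ
  have sb := cp2_sm hψ
  have hτ0 : ∀ x ∈ Ω, τf γ Pr ε χ x.2 ≠ 0 := fun x hx => by
    have := (τf_bounds hγ hPr hε hεl hεP h1 h2 (Set.Ioo_subset_Icc_self hx.2)).1
    intro h
    rw [h] at this
    norm_num at this
  have ei : ε ^ 2 * (ε⁻¹) ^ 2 = 1 := by field_simp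
  -- derivative bounds for the velocity
  have vel : ∀ (s : ℝ) (g : E3 → ℝ), s ∈ Set.Icc 0 T →
      Ctl s g (fun k x => ‖iteratedFDeriv ℝ (k + 1) (S.ψ s) x‖) → ∀ x ∈ Kc,
      |g (s, x)| ≤ 3 * ε⁻¹ := by
    intro s g hs hc x hx
    have E := hE s hs
    refine hc.sup hε hεl (by positivity) ?_ ?_ ?_ hx
    · rw [ei]; exact E.ψ1
    · have := E.ψ2
      rw [inv_pow, ← one_div, le_div_iff₀ (by positivity), mul_comm]; exact this
    · have := E.ψ3
      rw [inv_pow, ← one_div, le_div_iff₀ (by positivity)]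
      refine le_trans (le_of_eq ?_) this
      change ε ^ 2 * dSq 3 (S.ψ s) * ε ^ 2 = _
      ring
  have vel0 : ∀ (s : ℝ) (g : E3 → ℝ), s ∈ Set.Icc 0 T →
      Ctl s g (fun k x => ‖iteratedFDeriv ℝ k (S.ψ s) x‖) → ∀ x ∈ Kc, |g (s, x)| ≤ 3 := by
    intro s g hs hc x hx
    have E := hE s hs
    have := hc.sup hε hεl (M := 1) (by positivity) ?_ ?_ ?_ hx
    · linarith
    · rw [one_pow, mul_one]; exact E.ψ0
    · rw [one_pow]; exact E.ψ1
    · rw [one_pow]; exact E.ψ2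
  have e4 : ε ^ 2 * ε ^ 2 = ε ^ 4 := by ring
  have c1 : ∀ t x, dt S.φ t x = DD vt (Function.uncurry S.φ) (t, x) := fun t x => hφ.hasDt t x
  have c2 : ∀ t x, dt S.θ t x = DD vt (Function.uncurry S.θ) (t, x) := fun t x => hθ.hasDt t x
  have gφ := grad_s (g := Function.uncurry S.φ) hφ
  have gθ := grad_s (g := Function.uncurry S.θ) hθ
  have lθ := lap_s (g := Function.uncurry S.θ) hθ
  have ga := grad_s sa
  have gb := grad_s sb
  have la := lap_s sa
  have lb := lap_s sb
  have ddv : ∀ t x, divv (S.ψ t) x = DD v1 (cp1 S.ψ) (t, x) + DD v2 (cp2 S.ψ) (t, x) :=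
    fun t x => congrFun (divv_s hψ t) x
  have d1d : ∀ t x, d1 (divv (S.ψ t)) x
      = DD v1 (DD v1 (cp1 S.ψ)) (t, x) + DD v1 (DD v2 (cp2 S.ψ)) (t, x) := fun t x => by
    rw [divv_s hψ t, slice_d1 (g := DD v1 (cp1 S.ψ) + DD v2 (cp2 S.ψ)) (ContDiff.add (sa.dd v1) (sb.dd v2)) t]
    exact DD_add (sa.dd v1) (sb.dd v2) _ _
  have d2d : ∀ t x, d2 (divv (S.ψ t)) x
      = DD v2 (DD v1 (cp1 S.ψ)) (t, x) + DD v2 (DD v2 (cp2 S.ψ)) (t, x) := fun t x => by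
    rw [divv_s hψ t, slice_d2 (g := DD v1 (cp1 S.ψ) + DD v2 (cp2 S.ψ)) (ContDiff.add (sa.dd v1) (sb.dd v2)) t]
    exact DD_add (sa.dd v1) (sb.dd v2) _ _
  have a1e := fun t => slice_d1 sa t
  have a2e := fun t => slice_d2 sa t
  have b1e := fun t => slice_d1 sb t
  have b2e := fun t => slice_d2 sb t
  have slcphi_1 := fun t => slice_d1 (g := Function.uncurry S.φ) hφ t
  have slcphi_2 := fun t => slice_d2 (g := Function.uncurry S.φ) hφ t
  have slctheta_1 := fun t => slice_d1 (g := Function.uncurry S.θ) hθ t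
  have slctheta_2 := fun t => slice_d2 (g := Function.uncurry S.θ) hθ t
  have p1 : ∀ t, ∀ x ∈ Ω, d1 (fun y => pρ γ Pr ε χ S.φ t y * pT γ Pr ε χ S.θ t y) x
      = ((τf γ Pr ε χ x.2)⁻¹ + S.φ t x) * DD v1 (Function.uncurry S.θ) (t, x)
        + DD v1 (Function.uncurry S.φ) (t, x) * (τf γ Pr ε χ x.2 + S.θ t x) := by
    intro t x hx
    have h := press_hd hφ hθ (t := t) (hτ0 x hx) ((1, 0) : ℝ × ℝ)
    have h3 := congrFun (slcphi_1 t) x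
    have h4 := congrFun (slctheta_1 t) x
    rw [← h3, ← h4]
    refine h.trans ?_
    rw [mul_zero, mul_zero, zero_add, zero_add]
    rfl
  have p2 : ∀ t, ∀ x ∈ Ω, d2 (fun y => pρ γ Pr ε χ S.φ t y * pT γ Pr ε χ S.θ t y) x
      = ((τf γ Pr ε χ x.2)⁻¹ + S.φ t x) * (τf1 γ Pr ε χ x.2 + DD v2 (Function.uncurry S.θ) (t, x))
        + (-(τf1 γ Pr ε χ x.2 * (τf γ Pr ε χ x.2)⁻¹ ^ 2) + DD v2 (Function.uncurry S.φ) (t, x))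
          * (τf γ Pr ε χ x.2 + S.θ t x) := by
    intro t x hx
    have h := press_hd hφ hθ (t := t) (hτ0 x hx) ((0, 1) : ℝ × ℝ)
    have h3 := congrFun (slcphi_2 t) x
    have h4 := congrFun (slctheta_2 t) x
    rw [← h3, ← h4]
    refine h.trans ?_
    rw [mul_one, mul_one]
    rfl
  constructor
  case hε => exact hε
  case hε1 => exact hε1
  case hc => positivity
  case hμ => positivity
  case hr => exact hr
  case hκ => positivity
  case hT => exact hT
  case hK => positivity
  case sa => exact sa
  case sb => exact sb
  case sφ => exact hφ
  case sθ => exact hθ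
  case pa => intro t x y; exact congrArg Prod.fst (S.periodic_ψ t (x, y))
  case pb => intro t x y; exact congrArg Prod.snd (S.periodic_ψ t (x, y))
  case pφ => intro t x y; exact S.periodic_φ t (x, y)
  case pθ => intro t x y; exact S.periodic_θ t (x, y)
  case ba =>
    intro t ht x
    exact ⟨congrArg Prod.fst (S.bc_ψ t ht (x, 0) (Or.inl rfl)),
      congrArg Prod.fst (S.bc_ψ t ht (x, 1) (Or.inr rfl))⟩
  case bb =>
    intro t ht x
    exact ⟨congrArg Prod.snd (S.bc_ψ t ht (x, 0) (Or.inl rfl)),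
      congrArg Prod.snd (S.bc_ψ t ht (x, 1) (Or.inr rfl))⟩
  case bθ =>
    intro t ht x
    exact ⟨S.bc_θ t ht (x, 0) (Or.inl rfl), S.bc_θ t ht (x, 1) (Or.inr rfl)⟩
  case hτ => exact τf_hd γ Pr ε χ
  case hτ1 => unfold τf1; fun_prop
  case τlo => exact fun y hy => (τf_bounds hγ hPr hε hεl hεP h1 h2 hy).1
  case τhi => exact fun y hy => (τf_bounds hγ hPr hε hεl hεP h1 h2 hy).2.1
  case τder_bd => exact fun y hy => (τf_bounds hγ hPr hε hεl hεP h1 h2 hy).2.2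
  case φb =>
    rintro ⟨s, x⟩ ⟨hs, hx⟩
    have E := hE s hs
    refine (Ctl.of_scalar hφ s).sup hε hεl hε.le ?_ E.φ1 ?_ hx
    · rw [e4]; exact E.φ0
    · exact (mul_le_mul_of_nonneg_left E.φ2 (by positivity)).trans (by rw [mul_one])
  case θb =>
    rintro ⟨s, x⟩ ⟨hs, hx⟩
    have E := hE s hs
    refine (Ctl.of_scalar hθ s).sup hε hεl hε.le ?_ E.θ1 ?_ hx
    · rw [e4]; exact E.θ0
    · exact (mul_le_mul_of_nonneg_left E.θ2 (by positivity)).trans (by rw [mul_one])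
  case ab =>
    rintro ⟨s, x⟩ ⟨hs, hx⟩
    exact vel0 s _ hs (Ctl.of_fst hψ s) x hx
  case bbd =>
    rintro ⟨s, x⟩ ⟨hs, hx⟩
    exact vel0 s _ hs (Ctl.of_snd hψ s) x hx
  case a1b =>
    rintro ⟨s, x⟩ ⟨hs, hx⟩
    exact vel s _ hs (Ctl.of_fst hψ s).v1 x hx
  case a2b =>
    rintro ⟨s, x⟩ ⟨hs, hx⟩
    exact vel s _ hs (Ctl.of_fst hψ s).v2 x hx
  case b1b =>
    rintro ⟨s, x⟩ ⟨hs, hx⟩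
    exact vel s _ hs (Ctl.of_snd hψ s).v1 x hx
  case b2b =>
    rintro ⟨s, x⟩ ⟨hs, hx⟩
    exact vel s _ hs (Ctl.of_snd hψ s).v2 x hx
  case mass =>
    rintro t ht x y hx p rfl
    have h := S.mass_eq t ht (x, y) hx
    have g1 : grad (S.φ t) (x, y) = _ := gφ t (x, y)
    rw [grad_tρ (hτ0 _ hx), c1, ddv, g1] at h
    unfold dot pu tu at h
    refine Eq.trans ?_ h
    change _ = _ + ((y + cp1 S.ψ (t, x, y)) * _ + (0 + cp2 S.ψ (t, x, y)) * _)
      + ((τf γ Pr ε χ y)⁻¹ + Function.uncurry S.φ (t, x, y)) * _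
      + (cp1 S.ψ (t, x, y) * 0 + cp2 S.ψ (t, x, y) * _)
    ring
  case mom1 =>
    rintro t ht x y hx p rfl
    have h := S.mom_eq1 t ht (x, y) hx
    have g1 : grad (fun z => (S.ψ t z).1) (x, y) = _ := ga t (x, y)
    have l1 : lap (fun z => (S.ψ t z).1) (x, y) = _ := la t (x, y)
    rw [grad_tu1, g1, l1, p1 t _ hx, d1d, dt_fst hψ] at h
    unfold dot pu tu at h
    refine Eq.trans ?_ h
    change _ = ((τf γ Pr ε χ y)⁻¹ + Function.uncurry S.φ (t, x, y)) * (_ +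
        ((y + cp1 S.ψ (t, x, y)) * _ + (0 + cp2 S.ψ (t, x, y)) * _)
         + (cp1 S.ψ (t, x, y) * 0 + cp2 S.ψ (t, x, y) * 1))
      + _ * (((τf γ Pr ε χ y)⁻¹ + Function.uncurry S.φ (t, x, y)) * _
        + _ * (τf γ Pr ε χ y + Function.uncurry S.θ (t, x, y))) - _ - _
    ring
  case mom2 =>
    rintro t ht x y hx p rfl
    have h := S.mom_eq2 t ht (x, y) hx
    have g1 : grad (fun z => (S.ψ t z).2) (x, y) = _ := gb t (x, y)
    have l1 : lap (fun z => (S.ψ t z).2) (x, y) = _ := lb t (x, y)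
    rw [grad_tu2, g1, l1, p2 t _ hx, d2d, dt_snd hψ] at h
    unfold dot pu tu at h
    refine Eq.trans ?_ h
    change _ = ((τf γ Pr ε χ y)⁻¹ + Function.uncurry S.φ (t, x, y)) * (_ +
        ((y + cp1 S.ψ (t, x, y)) * _ + (0 + cp2 S.ψ (t, x, y)) * _)
         + (cp1 S.ψ (t, x, y) * 0 + cp2 S.ψ (t, x, y) * 0))
      + _ * (((τf γ Pr ε χ y)⁻¹ + Function.uncurry S.φ (t, x, y)) * (τf1 γ Pr ε χ y + _)
        + (-(τf1 γ Pr ε χ y * (τf γ Pr ε χ y)⁻¹ ^ 2) + _)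
          * (τf γ Pr ε χ y + Function.uncurry S.θ (t, x, y))) - _ - _
    ring
  case energy =>
    rintro t ht x y hx p rfl
    have h := S.energy_eq t ht (x, y) hx
    have g1 : grad (S.θ t) (x, y) = _ := gθ t (x, y)
    have l1 : lap (S.θ t) (x, y) = _ := lθ t (x, y)
    have q1 : d1 (fun z => (S.ψ t z).1) (x, y) = _ := congrFun (a1e t) (x, y)
    have q2 : d2 (fun z => (S.ψ t z).1) (x, y) = _ := congrFun (a2e t) (x, y)
    have q3 : d1 (fun z => (S.ψ t z).2) (x, y) = _ := congrFun (b1e t) (x, y)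
    have q4 : d2 (fun z => (S.ψ t z).2) (x, y) = _ := congrFun (b2e t) (x, y)
    have k1 : d1 (fun z => (tu z).1) (x, y) = 0 := by unfold d1; rw [fd_tu1]; simp
    have k2 : d2 (fun z => (tu z).1) (x, y) = 1 := by unfold d2; rw [fd_tu1]; simp
    have k3 : d1 (fun z => (tu z).2) (x, y) = 0 := by unfold d1; rw [fd_tu2]; simp
    have k4 : d2 (fun z => (tu z).2) (x, y) = 0 := by unfold d2; rw [fd_tu2]; simp
    unfold defContract at h
    rw [grad_tT, c2, ddv, g1, l1, q1, q2, q3, q4, k1, k2, k3, k4] at h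
    unfold dot pu tu at h
    have h' : ((τf γ Pr ε χ y)⁻¹ + Function.uncurry S.φ (t, x, y)) / (γ - 1)
          * (DD vt (Function.uncurry S.θ) (t, x, y) +
          ((y + cp1 S.ψ (t, x, y)) * DD v1 (Function.uncurry S.θ) (t, x, y)
            + (0 + cp2 S.ψ (t, x, y)) * DD v2 (Function.uncurry S.θ) (t, x, y))
          + (cp1 S.ψ (t, x, y) * 0 + cp2 S.ψ (t, x, y) * τf1 γ Pr ε χ y))
        + ((τf γ Pr ε χ y)⁻¹ + Function.uncurry S.φ (t, x, y))
          * (τf γ Pr ε χ y + Function.uncurry S.θ (t, x, y)) * _ - _ = _ := h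
    rw [div_eq_mul_one_div] at h'
    linear_combination h'

/-! ### Conclusion -/

lemma Ctl.cont {s : ℝ} {g : E3 → ℝ} {N : ℕ → ℝ × ℝ → ℝ} (h : Ctl s g N) :
    IntegrableOn (fun x => g (s, x) ^ 2) Ω := by
  have := h.sm.continuous
  exact intΩ (Continuous.continuousOn (by fun_prop))

/-- The initial data of the coordinate system are controlled by the functionals. -/
lemma init_coord {ε c : ℝ} {φ θ : ℝ → ℝ × ℝ → ℝ} {ψ : ℝ → ℝ × ℝ → ℝ × ℝ} (hε : 0 < ε) (hc : 0 < c)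
    (hφ : Js φ) (hψ : Js ψ) (hθ : Js θ) :
    (ε ^ 2)⁻¹ * (∫ x in Ω, gg (Function.uncurry θ) (0, x)) + (ε ^ 2)⁻¹ * (∫ x in Ω,
        (3 * (cp1 ψ (0, x) ^ 2 + cp2 ψ (0, x) ^ 2) + (ε ^ 2)⁻¹ *
          (2 * Function.uncurry φ (0, x) ^ 2 + 6 * c * Function.uncurry θ (0, x) ^ 2)))
      ≤ (6 + 6 * c) * (A1 ε φ ψ θ 0 + (ε ^ 2)⁻¹ * A0 ε φ ψ θ 0) := by
  obtain ⟨i0, i1⟩ := init_bd hε hφ hψ hθ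
  have e2 : 0 ≤ (ε ^ 2)⁻¹ := by positivity
  have ka := Ctl.of_fst hψ 0
  have kb := Ctl.of_snd hψ 0
  have kf := Ctl.of_scalar hφ 0
  have kt := Ctl.of_scalar hθ 0
  have ia : _ ≤ dSq 0 (ψ 0) := ka.int
  have ib : _ ≤ dSq 0 (ψ 0) := kb.int
  have jf : _ ≤ dSq 0 (φ 0) := kf.int
  have jt : _ ≤ dSq 0 (θ 0) := kt.int
  have t1 : _ ≤ dSq 1 (θ 0) := kt.v1.int
  have t2 : _ ≤ dSq 1 (θ 0) := kt.v2.int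
  have E1 : ∫ x in Ω, gg (Function.uncurry θ) (0, x) = (∫ x in Ω, DD v1 (Function.uncurry θ) (0, x) ^ 2)
      + ∫ x in Ω, DD v2 (Function.uncurry θ) (0, x) ^ 2 := integral_add kt.v1.cont kt.v2.cont
  have m1 : IntegrableOn (fun x => 3 * (cp1 ψ (0, x) ^ 2 + cp2 ψ (0, x) ^ 2)) Ω :=
    (ka.cont.add kb.cont).const_mul 3
  have m2 : IntegrableOn (fun x => 2 * Function.uncurry φ (0, x) ^ 2) Ω := kf.cont.const_mul 2
  have m3 : IntegrableOn (fun x => 6 * c * Function.uncurry θ (0, x) ^ 2) Ω := kt.cont.const_mul (6 * c)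
  have m4 : IntegrableOn (fun x => (ε ^ 2)⁻¹ *
      (2 * Function.uncurry φ (0, x) ^ 2 + 6 * c * Function.uncurry θ (0, x) ^ 2)) Ω :=
    (m2.add m3).const_mul _
  have E2 : ∫ x in Ω, (3 * (cp1 ψ (0, x) ^ 2 + cp2 ψ (0, x) ^ 2) + (ε ^ 2)⁻¹ *
          (2 * Function.uncurry φ (0, x) ^ 2 + 6 * c * Function.uncurry θ (0, x) ^ 2))
      = 3 * ((∫ x in Ω, cp1 ψ (0, x) ^ 2) + ∫ x in Ω, cp2 ψ (0, x) ^ 2)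
        + (ε ^ 2)⁻¹ * (2 * (∫ x in Ω, Function.uncurry φ (0, x) ^ 2)
          + 6 * c * ∫ x in Ω, Function.uncurry θ (0, x) ^ 2) := by
    rw [integral_add m1 m4, integral_const_mul, integral_const_mul, integral_add ka.cont kb.cont,
      integral_add m2 m3, integral_const_mul, integral_const_mul]
  have n1 := dSq_nonneg 0 (φ 0)
  have n2 := dSq_nonneg 0 (ψ 0)
  have n3 := dSq_nonneg 0 (θ 0)
  have n4 := dSq_nonneg 1 (ψ 0)
  have n5 := dSq_nonneg 1 (θ 0)
  have F1 : (ε ^ 2)⁻¹ * (∫ x in Ω, gg (Function.uncurry θ) (0, x)) ≤ (6 + 6 * c) * A1 ε φ ψ θ 0 := by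
    have q : 0 ≤ (ε ^ 2)⁻¹ * dSq 1 (θ 0) := mul_nonneg e2 n5
    have h1 : (ε ^ 2)⁻¹ * (∫ x in Ω, gg (Function.uncurry θ) (0, x)) ≤ (ε ^ 2)⁻¹ * (2 * dSq 1 (θ 0)) :=
      mul_le_mul_of_nonneg_left (by linarith) e2
    have h2 : 0 ≤ A1 ε φ ψ θ 0 := by linarith
    have h3 := mul_nonneg hc.le h2
    linarith
  have F2 : ∫ x in Ω, (3 * (cp1 ψ (0, x) ^ 2 + cp2 ψ (0, x) ^ 2) + (ε ^ 2)⁻¹ *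
          (2 * Function.uncurry φ (0, x) ^ 2 + 6 * c * Function.uncurry θ (0, x) ^ 2))
      ≤ (6 + 6 * c) * A0 ε φ ψ θ 0 := by
    rw [E2]
    have h1 : (ε ^ 2)⁻¹ * (2 * (∫ x in Ω, Function.uncurry φ (0, x) ^ 2)
          + 6 * c * ∫ x in Ω, Function.uncurry θ (0, x) ^ 2)
        ≤ (ε ^ 2)⁻¹ * (2 * dSq 0 (φ 0) + 6 * c * dSq 0 (θ 0)) := by gcongr
    have q1 := mul_nonneg e2 n1
    have q2 := mul_nonneg e2 n3
    have q3 := mul_nonneg hc.le q1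
    have q4 := mul_nonneg hc.le n2
    have q5 := mul_le_mul_of_nonneg_left i0 (by positivity : 0 ≤ 6 + 6 * c)
    linarith
  have F3 := mul_le_mul_of_nonneg_left F2 e2
  linarith

/-- second-order estimate for the temperature perturbation. -/
theorem temperature_second_order_estimate (γ Pr r Kχ : ℝ)
    (hγ : 1 < γ) (hPr : 0 < Pr) (hr : 0 < 1 + r) (hK : 0 < Kχ) :
    ∃ Re₀ ε₁ : ℝ, 0 < Re₀ ∧ 0 < ε₁ ∧
      ∀ Re : ℝ, 0 < Re → Re < Re₀ →
        ∃ ε₂ C : ℝ, 0 < ε₂ ∧ 0 < C ∧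
          ∀ (ε χ T : ℝ) (S : PerturbSol γ Pr r Re ε χ T),
            0 < ε → ε ≤ 1 → ε < ε₁ → ε ≤ ε₂ → 0 < χ → |1 - χ| ≤ Kχ * ε →
            |1 - χ| ≤ 1 / 2 → 0 ≤ T → SmoothSol S → StdHyp S →
            Nfun ε S.φ S.ψ S.θ T ≤ 1 →
            ∀ t ∈ Set.Icc (0 : ℝ) T,
              (ε ^ 2)⁻¹ * (∫ s in (0 : ℝ)..t, dSq 2 (S.θ s))
                ≤ C * (A1 ε S.φ S.ψ S.θ 0 + (ε ^ 2)⁻¹ * A0 ε S.φ S.ψ S.θ 0) := by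
  have hg : 0 < γ - 1 := by linarith
  have hg0 : 0 < γ := by linarith
  obtain ⟨c, hc⟩ : ∃ c, c = 1 / (γ - 1) := ⟨_, rfl⟩
  obtain ⟨K, hKd⟩ : ∃ K, K = Kχ + Pr := ⟨_, rfl⟩
  have c0 : 0 < c := by rw [hc]; positivity
  have K0 : 0 < K := by rw [hKd]; positivity
  obtain ⟨P, hP⟩ : ∃ P, P = 39 + 6 * (1 + c) * K := ⟨_, rfl⟩
  have P0 : 0 < P := by rw [hP]; positivity
  have hCp : 1 ≤ γ / (γ - 1) := by
    rw [le_div_iff₀ hg]; linarith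
  refine ⟨1 / (8 * P + 16 * P * Pr), 1, by positivity, one_pos, fun Re hRe hRe0 => ?_⟩
  rw [lt_div_iff₀ (by positivity)] at hRe0
  obtain ⟨μ, hμ⟩ : ∃ μ, μ = Re⁻¹ := ⟨_, rfl⟩
  obtain ⟨κ, hκ⟩ : ∃ κ, κ = γ / (γ - 1) / (Re * Pr) := ⟨_, rfl⟩
  have μ0 : 0 < μ := by rw [hμ]; positivity
  have κ0 : 0 < κ := by rw [hκ]; positivity
  have hPμ : P ≤ μ / 8 := by
    have h : P * 8 * Re ≤ 1 := by
      have : 0 ≤ Re * (16 * P * Pr) := by positivity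
      linarith
    have h2 : P * 8 ≤ μ := by
      rw [hμ, ← one_div, le_div_iff₀ hRe]; exact h
    linarith
  have hPκ : P ≤ κ / 16 := by
    have h : P * 16 * (Re * Pr) ≤ 1 := by
      have : 0 ≤ Re * (8 * P) := by positivity
      linarith
    have h2 : P * 16 ≤ κ := by
      rw [hκ, le_div_iff₀ (by positivity)]; exact h.trans hCp
    linarith
  obtain ⟨A, hA⟩ : ∃ A, A = 18 * K + 4 * μ * K + 6 * (μ + r * μ) * K + 32 * μ + 24 * |r| * μ :=
    ⟨_, rfl⟩
  obtain ⟨B, hB⟩ : ∃ B, B = 72 * c * K + 16 * κ * K + 4 * μ := ⟨_, rfl⟩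
  have rμ : 0 < μ + r * μ := by
    have := mul_pos hr μ0
    linarith
  have A0' : 0 < A := by rw [hA]; positivity
  have B0 : 0 < B := by rw [hB]; positivity
  refine ⟨1 / (12 + Pr + 8 * A / μ + 16 * B / κ),
    4 * (|Sys.cC c μ r κ K| * (6 + 6 * c)) + 1, by positivity, by positivity, ?_⟩
  intro ε χ T S hε hε1 _ hε2 _ hχ1 hχ2 hT hS _ hN t ht
  have hφ : Js S.φ := hS.1
  have hψ : Js S.ψ := hS.2.1
  have hθ : Js S.θ := hS.2.2
  have e2 : 0 ≤ (ε ^ 2)⁻¹ := by positivity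
  obtain ⟨X, hX⟩ : ∃ X, X = A1 ε S.φ S.ψ S.θ 0 + (ε ^ 2)⁻¹ * A0 ε S.φ S.ψ S.θ 0 := ⟨_, rfl⟩
  have X0 : 0 ≤ X := by
    obtain ⟨i0, i1⟩ := init_bd hε hφ hψ hθ
    have n1 := mul_nonneg e2 (dSq_nonneg 0 (S.φ 0))
    have n2 := dSq_nonneg 0 (S.ψ 0)
    have n3 := mul_nonneg e2 (dSq_nonneg 0 (S.θ 0))
    have n4 := dSq_nonneg 1 (S.ψ 0)
    have n5 := mul_nonneg e2 (dSq_nonneg 1 (S.θ 0))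
    have z0 : 0 ≤ A0 ε S.φ S.ψ S.θ 0 := by linarith
    have z1 : 0 ≤ A1 ε S.φ S.ψ S.θ 0 := by linarith
    rw [hX]
    exact add_nonneg z1 (mul_nonneg e2 z0)
  rw [← hX]
  rcases hT.eq_or_lt with hT0 | hT0
  · have t0 : t = 0 := le_antisymm (by rw [hT0]; exact ht.2) ht.1
    rw [t0, intervalIntegral.integral_same, mul_zero]
    positivity
  rw [le_div_iff₀ (by positivity)] at hε2
  have w1 : 0 ≤ ε * Pr := by positivity
  have w2 : 0 ≤ ε * (8 * A / μ) := by positivity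
  have w3 : 0 ≤ ε * (16 * B / κ) := by positivity
  have hεP : ε * Pr ≤ 1 := by linarith
  have hε3 : 3 * ε ≤ 1 / 4 := by linarith
  have hεA : ε * A ≤ μ / 8 := by
    have h : ε * (8 * A / μ) ≤ 1 := by linarith
    rw [← mul_div_assoc, div_le_one μ0] at h
    linarith
  have hεB : ε * B ≤ κ / 16 := by
    have h : ε * (16 * B / κ) ≤ 1 := by linarith
    rw [← mul_div_assoc, div_le_one κ0] at h
    linarith
  have H := sys_of S hS hγ hPr hr hK hRe hε hε3 hεP hχ1 hχ2 hT0 hN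
  rw [← hc, ← hμ, ← hκ, ← hKd] at H
  have hAA : cW c μ r ε K + cK μ r ε K ≤ μ / 4 := by
    have : cW c μ r ε K + cK μ r ε K = P + ε * A := by
      rw [hP, hA]; unfold cW cK; ring
    linarith
  have hBB : cV c μ κ ε K + cZ κ ε K ≤ κ / 8 := by
    have : cV c μ κ ε K + cZ κ ε K = P - 21 + ε * B := by
      rw [hP, hB]; unfold cV cZ; ring
    linarith
  have h2 := H.second hAA hBB ht
  have h3 := init_coord (c := c) hε c0 hφ hψ hθ
  rw [← hX] at h3
  have h4 := mul_le_mul_of_nonneg_left (dSq_two_le hθ ht) e2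
  obtain ⟨Y, hY⟩ : ∃ Y, Y = (ε ^ 2)⁻¹ * (∫ x in Ω, gg (Function.uncurry S.θ) (0, x)) + (ε ^ 2)⁻¹ * (∫ x in Ω,
        (3 * (cp1 S.ψ (0, x) ^ 2 + cp2 S.ψ (0, x) ^ 2) + (ε ^ 2)⁻¹ *
          (2 * Function.uncurry S.φ (0, x) ^ 2 + 6 * c * Function.uncurry S.θ (0, x) ^ 2))) := ⟨_, rfl⟩
  rw [← hY] at h2 h3
  have Y0 : 0 ≤ Y := by
    rw [hY]
    refine add_nonneg (mul_nonneg e2 ?_) (mul_nonneg e2 ?_)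
    · refine integral_nonneg fun x => ?_
      unfold gg
      positivity
    · refine integral_nonneg fun x => ?_
      positivity
  have h5 : Sys.cC c μ r κ K * Y ≤ |Sys.cC c μ r κ K| * ((6 + 6 * c) * X) :=
    mul_le_mul (le_abs_self _) h3 Y0 (abs_nonneg _)
  linarith only [h2, h4, h5, X0]

end Couette
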